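/- Let (R,m) be a 3-dimensional complete local Noetherian domain of mixed characteristic p, and suppose p, x, y is a system of parameters of R. For n ≥ 1 let J_n = (x,y)R :_R p^n. Then for every minimal prime 𝔭 of the ideal pR and every n ≥ 1, the image of J_n in R̄ = R/𝔭 is contained in the tight closure ((x̄,ȳ)R̄)^* computed in the characteristic-p domain R̄, where x̄, ȳ denote the images of x, y in R̄. -/

import Mathlib

universe u

/-- `u` lies in the tight closure of the ideal `J` in the ring `T` of
prime characteristic `p`. -/
def MemTightClosure (T : Type u) [CommRing T] (p : ℕ) (J : Ideal T) (u : T) : Prop :=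
  ∃ c : T, (∀ P ∈ minimalPrimes T, c ∉ P) ∧
    ∀ e : ℕ, c * u ^ p ^ e ∈ Ideal.span ((fun a => a ^ p ^ e) '' (J : Set T))

section P1asec
/-- `a` is a nonzerodivisor modulo `𝔟`. -/
def Nzd {A : Type*} [CommRing A] (a : A) (𝔟 : Ideal A) : Prop := ∀ t, a * t ∈ 𝔟 → t ∈ 𝔟

namespace Nzd
variable {A : Type*} [CommRing A]

theorem congr {a b : A} {𝔟 : Ideal A} (h : a - b ∈ 𝔟) (hb : Nzd b 𝔟) : Nzd a 𝔟 := by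
  intro t ht
  apply hb
  have : b * t = a * t - (a - b) * t := by ring
  rw [this]
  exact 𝔟.sub_mem ht (𝔟.mul_mem_right _ h)

theorem pow {a : A} {𝔟 : Ideal A} (h : Nzd a 𝔟) (n : ℕ) : Nzd (a ^ n) 𝔟 := by
  induction n with
  | zero => intro t ht; simpa using ht
  | succ n ih =>
    intro t ht
    apply h
    apply ih
    rw [pow_succ] at ht
    rwa [← mul_assoc]

/-- exchange lemma -/
theorem step {a e : A} {𝔟 : Ideal A} (ha : Nzd a 𝔟) (he : Nzd e (𝔟 ⊔ Ideal.span {a})) :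
    Nzd a (𝔟 ⊔ Ideal.span {e}) := by
  intro t ht
  obtain ⟨β, hβ, z, hz, hsum⟩ := Submodule.mem_sup.1 ht
  obtain ⟨g, rfl⟩ := Ideal.mem_span_singleton'.1 hz
  have hg : g ∈ 𝔟 ⊔ Ideal.span {a} := by
    apply he
    have : e * g = a * t + (-β) := by rw [← hsum]; ring
    rw [this, add_comm]
    exact Submodule.add_mem_sup (𝔟.neg_mem hβ)
      (Ideal.mul_mem_right _ _ (Ideal.mem_span_singleton_self a))
  obtain ⟨β', hβ', z', hz', hsum'⟩ := Submodule.mem_sup.1 hg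
  obtain ⟨g', rfl⟩ := Ideal.mem_span_singleton'.1 hz'
  have h1 : t - e * g' ∈ 𝔟 := by
    apply ha
    have : a * (t - e * g') = β + β' * e := by
      rw [mul_sub, ← hsum, ← hsum']; ring
    rw [this]
    exact 𝔟.add_mem hβ (𝔟.mul_mem_right _ hβ')
  have : t = (t - e * g') + g' * e := by ring
  rw [this]
  exact Submodule.add_mem_sup h1 (Ideal.mem_span_singleton'.2 ⟨g', rfl⟩)

theorem comap {B : Type*} [CommRing B] (f : A →+* B) {a : A} {𝔟 : Ideal B} (h : Nzd (f a) 𝔟) :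
    Nzd a (𝔟.comap f) := by
  intro t ht
  rw [Ideal.mem_comap] at ht ⊢
  apply h
  rwa [← map_mul]

theorem mvC {σ : Type*} {a : A} {𝔟 : Ideal A} (h : Nzd a 𝔟) :
    Nzd (MvPolynomial.C (σ := σ) a) (𝔟.map (MvPolynomial.C (σ := σ))) := by
  intro t ht
  rw [MvPolynomial.mem_map_C_iff] at ht ⊢
  intro m
  apply h
  have := ht m
  rwa [MvPolynomial.coeff_C_mul] at this

theorem polyC {a : A} {𝔟 : Ideal A} (h : Nzd a 𝔟) :
    Nzd (Polynomial.C a) (𝔟.map (Polynomial.C)) := by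
  intro t ht
  rw [Ideal.mem_map_C_iff] at ht ⊢
  intro m
  apply h
  have := ht m
  rwa [Polynomial.coeff_C_mul] at this

theorem polyX {𝔟 : Ideal A} : Nzd (Polynomial.X) (𝔟.map (Polynomial.C)) := by
  intro t ht
  rw [Ideal.mem_map_C_iff] at ht ⊢
  intro m
  have := ht (m+1)
  rwa [Polynomial.coeff_X_mul] at this

theorem polyMonic {f : Polynomial A} (hf : f.Monic) (𝔟 : Ideal A) :
    Nzd f (𝔟.map (Polynomial.C)) := by
  intro t ht
  rw [← Ideal.mk_ker (I := 𝔟), ← Polynomial.ker_mapRingHom, RingHom.mem_ker] at ht ⊢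
  simp only [Polynomial.coe_mapRingHom, Polynomial.map_mul] at ht ⊢
  exact ((hf.map _).mul_right_eq_zero_iff).1 ht

end Nzd

theorem poly_contract {A : Type*} [CommRing A] {f : Polynomial A} (hf : f.Monic)
    (hdeg : 0 < f.natDegree) (𝔟 : Ideal A) (c : A)
    (h : Polynomial.C c ∈ 𝔟.map (Polynomial.C) ⊔ Ideal.span {f}) : c ∈ 𝔟 := by
  obtain ⟨β, hβ, z, hz, hsum⟩ := Submodule.mem_sup.1 h
  obtain ⟨g, rfl⟩ := Ideal.mem_span_singleton'.1 hz
  by_contra hc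
  rw [← Ideal.mk_ker (I := 𝔟), ← Polynomial.ker_mapRingHom, RingHom.mem_ker] at hβ
  have hh := congrArg (Polynomial.map (Ideal.Quotient.mk 𝔟)) hsum
  simp only [Polynomial.coe_mapRingHom] at hβ
  simp only [Polynomial.map_add, hβ, Polynomial.map_mul, Polynomial.map_C, zero_add] at hh
  have hne : Ideal.Quotient.mk 𝔟 c ≠ 0 := by
    rwa [Ne, Ideal.Quotient.eq_zero_iff_mem]
  have : Nontrivial (A ⧸ 𝔟) := ⟨_, _, hne⟩
  have hfm := hf.map (Ideal.Quotient.mk 𝔟)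
  have hg0 : g.map (Ideal.Quotient.mk 𝔟) ≠ 0 := by
    intro h0; rw [h0, zero_mul] at hh
    exact hne (Polynomial.C_eq_zero.1 hh.symm)
  have h2 := congrArg Polynomial.natDegree hh
  rw [mul_comm, hfm.natDegree_mul' hg0, hf.natDegree_map, Polynomial.natDegree_C] at h2
  omega

end P1asec

section P1bsec
open MvPolynomial in
theorem exists_equiv_poly {σ S : Type*} [CommRing S] (s : σ) :
    ∃ e : MvPolynomial σ S ≃+* Polynomial (MvPolynomial {t // t ≠ s} S),
      e (X s) = Polynomial.X ∧
      ∀ d : MvPolynomial {t // t ≠ s} S, e (rename Subtype.val d) = Polynomial.C d := by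
  classical
  refine ⟨((renameEquiv S (Equiv.optionSubtypeNe s).symm).trans
    (optionEquivLeft S {t // t ≠ s})).toRingEquiv, ?_, ?_⟩
  · simp
  · intro d
    have : ((((renameEquiv S (Equiv.optionSubtypeNe s).symm).trans
      (optionEquivLeft S {t // t ≠ s})).toAlgHom).comp (rename Subtype.val)) =
      (Polynomial.CAlgHom :
        MvPolynomial {t // t ≠ s} S →ₐ[S] Polynomial (MvPolynomial {t // t ≠ s} S)) := by
      apply MvPolynomial.algHom_ext
      intro i
      have : (Equiv.optionSubtypeNe s).symm i.1 = some i := by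
        rw [Equiv.optionSubtypeNe_symm_of_ne]
      simp [this]
    exact DFunLike.congr_fun this d

open MvPolynomial in
theorem supported_eq_rename {σ S : Type*} [CommRing S] (s : σ) {f : MvPolynomial σ S}
    (hf : f ∈ supported S ({s}ᶜ : Set σ)) :
    ∃ d : MvPolynomial {t // t ≠ s} S, rename Subtype.val d = f := by
  rw [supported_eq_range_rename] at hf
  obtain ⟨d, hd⟩ := hf
  exact ⟨d, hd⟩

open MvPolynomial in
theorem mvMonic {σ S : Type*} [CommRing S] (s : σ) {p : ℕ} (hp : 2 ≤ p)
    {a b : MvPolynomial σ S} (ha : a ∈ supported S ({s}ᶜ : Set σ))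
    (hb : b ∈ supported S ({s}ᶜ : Set σ)) (Γ : Set (MvPolynomial σ S))
    (hΓ : ∀ γ ∈ Γ, γ ∈ supported S ({s}ᶜ : Set σ)) :
    Nzd (X s ^ p + (b * X s + a)) (Ideal.span Γ) ∧
    ∀ c ∈ supported S ({s}ᶜ : Set σ),
      c ∈ Ideal.span Γ ⊔ Ideal.span {X s ^ p + (b * X s + a)} → c ∈ Ideal.span Γ := by
  obtain ⟨e, heX, hed⟩ := exists_equiv_poly (S := S) s
  obtain ⟨a, rfl⟩ := supported_eq_rename s ha
  obtain ⟨b, rfl⟩ := supported_eq_rename s hb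
  set ψ : MvPolynomial {t // t ≠ s} S →ₐ[S] MvPolynomial σ S := rename Subtype.val with hψ
  set E := X s ^ p + (ψ b * X s + ψ a) with hE
  have hΓ' : Γ = ψ '' (ψ ⁻¹' Γ) := by
    apply Set.Subset.antisymm
    · intro γ hγ
      obtain ⟨d, hd⟩ := supported_eq_rename s (hΓ γ hγ)
      exact ⟨d, by rw [Set.mem_preimage, hψ, hd]; exact hγ, hd⟩
    · exact Set.image_preimage_subset _ _
  set 𝔡 := Ideal.span (ψ ⁻¹' Γ) with h𝔡
  have hmap : (Ideal.span Γ).map e.toRingHom = 𝔡.map Polynomial.C := by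
    rw [hΓ', Ideal.map_span, Ideal.map_span]
    congr 1
    ext z
    simp only [Set.mem_image, exists_exists_and_eq_and]
    constructor
    · rintro ⟨d, hd, rfl⟩; exact ⟨d, hd, (hed d).symm⟩
    · rintro ⟨d, hd, rfl⟩; exact ⟨d, hd, (hed d)⟩
  have hmem : ∀ (I : Ideal (MvPolynomial σ S)) t, t ∈ I ↔ e t ∈ I.map e.toRingHom := by
    intro I t
    constructor
    · intro h; exact Ideal.mem_map_of_mem e.toRingHom h
    · intro h
      obtain ⟨x, hx, hxt⟩ := (Ideal.mem_map_iff_of_surjective e.toRingHom e.surjective).1 h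
      have : x = t := e.injective hxt
      rwa [← this]
  have heE : e E = Polynomial.X ^ p + (Polynomial.C b * Polynomial.X + Polynomial.C a) := by
    rw [hE]; simp only [map_add, map_pow, map_mul, heX, hed]
  have hdeg : (Polynomial.C b * Polynomial.X + Polynomial.C a).degree < (p : WithBot ℕ) :=
    lt_of_le_of_lt Polynomial.degree_linear_le (by exact_mod_cast hp)
  have hmon : (e E).Monic := by
    rw [heE]; exact Polynomial.monic_X_pow_add hdeg
  constructor
  · intro t ht
    rw [hmem, hmap] at ht ⊢
    rw [map_mul] at ht
    exact Nzd.polyMonic hmon 𝔡 _ ht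
  · intro c hc h
    obtain ⟨c, rfl⟩ := supported_eq_rename s hc
    rw [hmem, Ideal.map_sup, hmap, Ideal.map_span (s := {E}), Set.image_singleton, ← hψ, hed] at h
    by_cases hS : Nontrivial S
    · have h3 : 0 < (e E).natDegree := by
        rw [heE, Polynomial.natDegree_add_eq_left_of_degree_lt]
        · simp; omega
        · simpa using hdeg
      have := poly_contract hmon h3 𝔡 c h
      rw [hmem, hmap, ← hψ, hed]
      exact Ideal.mem_map_of_mem _ this
    · rw [not_nontrivial_iff_subsingleton] at hS
      have : rename Subtype.val c = (0 : MvPolynomial σ S) := Subsingleton.elim _ _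
      rw [this]; exact Ideal.zero_mem _

open MvPolynomial in
/-- triangular systems of monic polynomials -/
theorem triangular {σ S : Type*} [CommRing S] (r : σ → ℕ) {p : ℕ} (hp : 2 ≤ p)
    (a b : σ → MvPolynomial σ S) (ha : ∀ s, a s ∈ supported S {t | r t < r s})
    (hb : ∀ s, b s ∈ supported S {t | r t < r s}) (𝔞 : Ideal S) (T : Finset σ) :
    (∀ s ∉ T, (∀ t ∈ T, r t ≤ r s) → Nzd (X s ^ p + (b s * X s + a s))
      (𝔞.map C ⊔ Ideal.span ((fun s => X s ^ p + (b s * X s + a s)) '' T))) ∧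
    ∀ c : S, C c ∈ 𝔞.map C ⊔ Ideal.span ((fun s => X s ^ p + (b s * X s + a s)) '' (T : Set σ))
      → c ∈ 𝔞 := by
  classical
  set E : σ → MvPolynomial σ S := fun s => X s ^ p + (b s * X s + a s) with hE
  have hEsup : ∀ s t, t ≠ s → r t ≤ r s → E t ∈ supported S ({s}ᶜ : Set σ) := by
    intro s t hts hr
    have hsub : supported S {t' | r t' < r t} ≤ supported S ({s}ᶜ : Set σ) := by
      apply supported_mono
      intro t' ht' h
      rw [Set.mem_singleton_iff] at h
      subst h
      simp at ht'; omega
    have hX : (X t : MvPolynomial σ S) ∈ supported S ({s}ᶜ : Set σ) :=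
      Algebra.subset_adjoin ⟨t, hts, rfl⟩
    exact add_mem (pow_mem hX _) (add_mem (mul_mem (hsub (hb t)) hX) (hsub (ha t)))
  have hCsup : ∀ (s : σ) (c : S), C c ∈ supported S ({s}ᶜ : Set σ) := fun s c =>
    Subalgebra.algebraMap_mem _ c
  have hspan : ∀ T : Finset σ, 𝔞.map C ⊔ Ideal.span (E '' T) =
      Ideal.span ((C '' (𝔞 : Set S)) ∪ E '' T) := by
    intro T; rw [Ideal.span_union]; rfl
  have key : ∀ (T : Finset σ) (s : σ), s ∉ T → (∀ t ∈ T, r t ≤ r s) →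
      Nzd (E s) (𝔞.map C ⊔ Ideal.span (E '' T)) ∧
      ∀ c ∈ supported S ({s}ᶜ : Set σ), c ∈ (𝔞.map C ⊔ Ideal.span (E '' T)) ⊔ Ideal.span {E s} →
        c ∈ (𝔞.map C ⊔ Ideal.span (E '' T)) := by
    intro T s hs hT
    rw [hspan]
    have hsub : supported S {t' | r t' < r s} ≤ supported S ({s}ᶜ : Set σ) := by
      apply supported_mono
      intro t' ht' h
      rw [Set.mem_singleton_iff] at h
      subst h
      simp at ht'
    apply mvMonic s hp (hsub (ha s)) (hsub (hb s))
    rintro γ (⟨c, _, rfl⟩ | ⟨t, ht, rfl⟩)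
    · exact hCsup _ _
    · refine hEsup s t ?_ (hT t ht)
      rintro rfl; exact hs ht
  refine ⟨fun s hs hT => (key T s hs hT).1, ?_⟩
  induction T using Finset.induction_on_max_value r with
  | empty =>
    intro c hc
    simp only [Finset.coe_empty, Set.image_empty, Ideal.span_empty, bot_le, sup_of_le_left] at hc
    rw [MvPolynomial.mem_map_C_iff] at hc
    simpa using hc 0
  | insert s T hs hT ih =>
    intro c hc
    apply ih
    apply (key T s hs hT).2 _ (hCsup s c)
    rw [Finset.coe_insert, Set.image_insert_eq, Ideal.span_insert] at hc
    rw [sup_assoc, sup_comm (Ideal.span (E '' T))]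
    exact hc

end P1bsec

section P1csec
/-- `φ` is a lift of Frobenius modulo `p`. -/
def IsFrobLift {A : Type*} [CommRing A] (p : ℕ) (φ : A →+* A) : Prop :=
  ∀ a, (p : A) ∣ φ a - a ^ p

theorem dvd_add_pow_sub {A : Type*} [CommRing A] {p : ℕ} (hp : p.Prime) (a b : A) :
    (p : A) ∣ (a + b) ^ p - (a ^ p + b ^ p) := by
  obtain ⟨r, hr⟩ := exists_add_pow_prime_eq hp a b
  exact ⟨a * b * r, by rw [hr]; ring⟩

theorem IsFrobLift.delta {A : Type*} [CommRing A] {p : ℕ} {φ : A →+* A} (h : IsFrobLift p φ) :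
    ∃ δ : A → A, ∀ a, φ a = a ^ p + p * δ a := by
  choose δ hδ using h
  exact ⟨δ, fun a => by rw [← hδ]; ring⟩

theorem dvd_pow_sub_of_dvd_sub {A : Type*} [CommRing A] {p a b : A} (n : ℕ) (h : p ∣ a - b) :
    p ∣ a ^ n - b ^ n := h.trans (sub_dvd_pow_sub_pow a b n)

theorem frobLift_add {A B : Type*} [CommRing A] [CommRing B] {p : ℕ} (hp : p.Prime)
    {φ : A →+* B} {ψ : A →+* B} {a b : A}
    (ha : (p : B) ∣ φ a - ψ a ^ p) (hb : (p : B) ∣ φ b - ψ b ^ p) :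
    (p : B) ∣ φ (a + b) - ψ (a + b) ^ p := by
  have h := dvd_add_pow_sub hp (ψ a) (ψ b)
  have : φ (a + b) - ψ (a + b) ^ p = (φ a - ψ a ^ p) + (φ b - ψ b ^ p) -
    ((ψ a + ψ b) ^ p - (ψ a ^ p + ψ b ^ p)) := by rw [map_add, map_add]; ring
  rw [this]
  exact dvd_sub (dvd_add ha hb) h

theorem frobLift_mul {A B : Type*} [CommRing A] [CommRing B] {p : ℕ}
    {φ : A →+* B} {ψ : A →+* B} {a b : A}
    (ha : (p : B) ∣ φ a - ψ a ^ p) (hb : (p : B) ∣ φ b - ψ b ^ p) :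
    (p : B) ∣ φ (a * b) - ψ (a * b) ^ p := by
  have : φ (a * b) - ψ (a * b) ^ p = (φ a - ψ a ^ p) * φ b + ψ a ^ p * (φ b - ψ b ^ p) := by
    rw [map_mul, map_mul]; ring
  rw [this]
  exact dvd_add (dvd_mul_of_dvd_left ha _) (dvd_mul_of_dvd_right hb _)

open MvPolynomial in
/-- the Frobenius lift on the polynomial ring in the variables `Y_{i,k}` -/
noncomputable def envPhi {S : Type*} [CommRing S] (ι : Type*) (p : ℕ) (φ : S →+* S) :
    MvPolynomial (ι × ℕ) S →+* MvPolynomial (ι × ℕ) S :=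
  eval₂Hom (C.comp φ) (fun s => X s ^ p + (p : MvPolynomial (ι × ℕ) S) * X (s.1, s.2 + 1))

open MvPolynomial in
theorem isFrobLift_mv {S σ : Type*} [CommRing S] {p : ℕ} (hp : p.Prime) {φ : S →+* S}
    (h : IsFrobLift p φ) (Φ : MvPolynomial σ S →+* MvPolynomial σ S)
    (hC : ∀ a, Φ (C a) = C (φ a)) (hX : ∀ s, (p : MvPolynomial σ S) ∣ Φ (X s) - X s ^ p) :
    IsFrobLift p Φ := by
  intro a
  have key : (p : MvPolynomial σ S) ∣ Φ a - (RingHom.id _ a) ^ p := by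
    induction a using MvPolynomial.induction_on with
    | C a =>
      obtain ⟨c, hc⟩ := h a
      refine ⟨C c, ?_⟩
      rw [hC, RingHom.id_apply, ← C_pow, ← C_sub, hc, C_mul]; simp
    | add a b ha hb => exact frobLift_add hp ha hb
    | mul_X a s ha => exact frobLift_mul ha (by simpa using hX s)
  exact key

open MvPolynomial in
theorem envPhi_isFrobLift {S : Type*} [CommRing S] (ι : Type*) {p : ℕ} (hp : p.Prime) {φ : S →+* S}
    (h : IsFrobLift p φ) : IsFrobLift p (envPhi ι p φ) := by
  apply isFrobLift_mv hp h
  · intro a; simp [envPhi]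
  · intro s
    exact ⟨X (s.1, s.2 + 1), by simp [envPhi]⟩

open MvPolynomial in
theorem mv_torsionfree {S σ : Type*} [CommRing S] {p : ℕ} (h : ∀ a : S, (p : S) * a = 0 → a = 0)
    (a : MvPolynomial σ S) (ha : (p : MvPolynomial σ S) * a = 0) : a = 0 := by
  ext m
  rw [coeff_zero]
  apply h
  have := congrArg (coeff m) ha
  rw [← C_eq_coe_nat, coeff_C_mul] at this
  simpa using this

open MvPolynomial in
theorem supported_of_mul {S σ : Type*} [CommRing S] {p : ℕ} (h : ∀ a : S, (p : S) * a = 0 → a = 0)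
    (W : Set σ) (a : MvPolynomial σ S)
    (ha : (p : MvPolynomial σ S) * a ∈ supported S W) : a ∈ supported S W := by
  rw [mem_supported] at ha ⊢
  intro s hs
  apply ha
  rw [Finset.mem_coe, mem_vars_iff_mem_support] at hs ⊢
  obtain ⟨m, hm, hms⟩ := hs
  refine ⟨m, ?_, hms⟩
  rw [mem_support_iff] at hm ⊢
  rw [← C_eq_coe_nat, coeff_C_mul]
  intro h0
  exact hm (h _ (by simpa using h0))

open MvPolynomial in
theorem envPhi_expand {S ι : Type*} [CommRing S] {p : ℕ} {φ : S →+* S} (i : ι) (k : ℕ)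
    (R : MvPolynomial (ι × ℕ) S) (hR : R ∈ supported S {t : ι × ℕ | t.1 = i ∧ t.2 < k}) :
    ∃ a ∈ supported S {t : ι × ℕ | t.1 = i ∧ t.2 < k},
    ∃ b ∈ supported S {t : ι × ℕ | t.1 = i ∧ t.2 < k}, ∃ c,
    envPhi ι p φ R = a +  (p : MvPolynomial (ι × ℕ) S) * X (i, k) * b + (p : MvPolynomial (ι × ℕ) S) ^ 2 * c := by
  rw [supported] at hR
  induction hR using Algebra.adjoin_induction with
  | mem z hz =>
    obtain ⟨⟨i', j⟩, ⟨rfl, hj⟩, rfl⟩ := hz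
    have hX : ∀ j' < k, (X (i', j') : MvPolynomial (ι × ℕ) S) ∈
      supported S {t : ι × ℕ | t.1 = i' ∧ t.2 < k} := fun j' hj' =>
      Algebra.subset_adjoin ⟨(i', j'), ⟨rfl, hj'⟩, rfl⟩
    simp only at hj
    rcases Nat.lt_or_ge (j + 1) k with h1 | h1
    · refine ⟨X (i', j) ^ p +  (p : MvPolynomial (ι × ℕ) S) * X (i', j+1), ?_, 0, zero_mem _, 0, ?_⟩
      · exact add_mem (pow_mem (hX _ hj) _) (mul_mem (natCast_mem _ _) (hX _ h1))
      · simp [envPhi]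
    · have : k = j + 1 := by omega
      subst this
      refine ⟨X (i', j) ^ p, pow_mem (hX _ hj) _, 1, one_mem _, 0, ?_⟩
      simp [envPhi]
  | algebraMap r =>
    refine ⟨C (φ r), Subalgebra.algebraMap_mem _ _, 0, zero_mem _, 0, ?_⟩
    simp [envPhi, algebraMap_eq]
  | add u v _ _ hu hv =>
    obtain ⟨a, ha, b, hb, c, h⟩ := hu
    obtain ⟨a', ha', b', hb', c', h'⟩ := hv
    refine ⟨a + a', add_mem ha ha', b + b', add_mem hb hb', c + c', ?_⟩
    rw [map_add, h, h']; ring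
  | mul u v _ _ hu hv =>
    obtain ⟨a, ha, b, hb, c, h⟩ := hu
    obtain ⟨a', ha', b', hb', c', h'⟩ := hv
    refine ⟨a * a', mul_mem ha ha', a * b' + a' * b, add_mem (mul_mem ha hb') (mul_mem ha' hb),
      a * c' + a' * c + (p : MvPolynomial (ι × ℕ) S) ^ 2 * c * c' + X (i, k) ^ 2 * b * b' +  (p : MvPolynomial (ι × ℕ) S) * X (i, k) * (b * c' + b' * c), ?_⟩
    rw [map_mul, h, h']; ring

open MvPolynomial in
theorem env_structure {S ι : Type*} [CommRing S] {p : ℕ} (hp : p.Prime)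
    (hS : ∀ a : S, (p : S) * a = 0 → a = 0) {φ : S →+* S} (hφ : IsFrobLift p φ)
    (𝔷 : Ideal S) (hp𝔷 : (p : S) ∈ 𝔷) (D ε : ℕ → S) (hD : ∀ k, φ (D k) = D (k + 1))
    (hDε : ∀ k, D (k + 1) = D k ^ p + p * ε k) (hD𝔷 : ∀ k, D k ∈ 𝔷) (hε : ∀ k, ε k - 1 ∈ 𝔷)
    (i : ι) (f : S) (G : ℕ → MvPolynomial (ι × ℕ) S) (hG0 : G 0 = C f + C (D 0) * X (i, 0))
    (hG : ∀ k, envPhi ι p φ (G k) = G k ^ p + p * G (k + 1)) (k : ℕ) :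
    ∃ a ∈ supported S {t : ι × ℕ | t.2 < k}, ∃ b ∈ supported S {t : ι × ℕ | t.2 < k},
      G (k + 1) - (X (i, k) ^ p + (b * X (i, k) + a)) ∈ 𝔷.map C := by
  set W : ℕ → Subalgebra S (MvPolynomial (ι × ℕ) S) :=
    fun k => supported S {t : ι × ℕ | t.1 = i ∧ t.2 < k} with hW
  have hWmono : ∀ k, W k ≤ W (k + 1) := fun k =>
    supported_mono (fun t ht => ⟨ht.1, by have := ht.2; omega⟩)
  have hXW : ∀ k, X (i, k) ∈ W (k + 1) := fun k =>
    Algebra.subset_adjoin ⟨(i, k), ⟨rfl, Nat.lt_succ_self k⟩, rfl⟩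
  have hCW : ∀ k s, C s ∈ W k := fun k s => Subalgebra.algebraMap_mem _ s
  have htf := mv_torsionfree (σ := ι × ℕ) hS
  have cancel : ∀ u v : MvPolynomial (ι × ℕ) S, (p : MvPolynomial (ι × ℕ) S) * u = p * v → u = v := by
    intro u v h
    rw [← sub_eq_zero]
    apply htf
    rw [mul_sub, h, sub_self]
  have hpC : (p : MvPolynomial (ι × ℕ) S) ∈ 𝔷.map (C (σ := ι × ℕ)) := by
    have := Ideal.mem_map_of_mem (C (σ := ι × ℕ)) hp𝔷
    simpa using this
  have hX0 : ∀ k, envPhi ι p φ (X (i, k)) = X (i, k) ^ p +  (p : MvPolynomial (ι × ℕ) S) * X (i, k + 1) := by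
    intro k; simp [envPhi]
  have hC0 : ∀ s, envPhi ι p φ (C s) = C (φ s) := by intro s; simp [envPhi]
  -- one step
  have step : ∀ k R, R ∈ W k → G k = C (D k) * X (i, k) + R →
      ∃ R' ∈ W (k + 1), G (k + 1) = C (D (k + 1)) * X (i, k + 1) + R' ∧
      ∃ a ∈ W k, ∃ b ∈ W k, R' - (X (i, k) ^ p + (b * X (i, k) + a)) ∈ 𝔷.map C := by
    intro k R hR hGk
    obtain ⟨a, ha, b, hb, c, habc⟩ := envPhi_expand (p := p) (φ := φ) i k R hR
    obtain ⟨r, hr⟩ := exists_add_pow_prime_eq hp (C (D k) * X (i, k)) R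
    obtain ⟨δR, hδR⟩ := envPhi_isFrobLift ι hp hφ R
    have hk := hG k
    -- the difference is divisible by the prime
    set a' := δR - X (i, k) * b - (p : MvPolynomial (ι × ℕ) S) * c with ha'
    have hpa' : a - R ^ p = p * a' := by
      rw [ha', mul_sub, mul_sub, ← hδR, habc]; ring
    have ha'W : a' ∈ W k := by
      apply supported_of_mul hS
      rw [← hpa']
      exact sub_mem ha (pow_mem hR _)
    set R' := G (k + 1) - C (D (k + 1)) * X (i, k + 1) with hR'
    have e1 : (p : MvPolynomial (ι × ℕ) S) * R' = envPhi ι p φ R + C (D (k + 1)) * X (i, k) ^ p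
        - (C (D k) * X (i, k) + R) ^ p := by
      rw [hR', mul_sub, ← hGk]
      have : (p : MvPolynomial (ι × ℕ) S) * G (k + 1) = envPhi ι p φ (G k) - G k ^ p := by
        rw [hk]; ring
      rw [this]
      conv_lhs => rw [show envPhi ι p φ (G k) = C (D (k+1)) * (X (i, k) ^ p +  (p : MvPolynomial (ι × ℕ) S) * X (i, k + 1)) +
        envPhi ι p φ R by rw [hGk, map_add, map_mul, hX0, hC0, hD]]
      ring
    have e2 : R' = X (i, k) ^ p + (b * X (i, k) + a') + ((C (ε k) - 1) * X (i, k) ^ p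
        + (p : MvPolynomial (ι × ℕ) S) * c - C (D k) * (X (i, k) * R * r)) := by
      apply cancel
      rw [e1, hr, hDε, habc, eq_add_of_sub_eq hpa']
      simp only [C_add, C_mul, C_pow]
      have : (C (p : S) : MvPolynomial (ι × ℕ) S) = p := by simp
      rw [this]
      ring
    refine ⟨R', ?_, by rw [hR']; ring, a', ha'W, b, hb, ?_⟩
    · apply supported_of_mul hS
      rw [e1]
      have h1 : envPhi ι p φ R ∈ W (k + 1) := by
        obtain ⟨a2, ha2, b2, hb2, c2, h2⟩ := envPhi_expand (p := p) (φ := φ) i (k+1) R (hWmono k hR)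
        have hc2 : envPhi ι p φ R ∈ W (k + 1) := by
          have hgen : ∀ Q ∈ W k, envPhi ι p φ Q ∈ W (k + 1) := by
            intro Q hQ
            rw [hW] at hQ
            simp only [supported] at hQ
            induction hQ using Algebra.adjoin_induction with
            | mem z hz =>
              obtain ⟨⟨i', j⟩, ⟨rfl, hj⟩, rfl⟩ := hz
              simp only at hj
              have hXj : ∀ j' ≤ k, (X (i', j') : MvPolynomial (ι × ℕ) S) ∈ W (k+1) := fun j' hj' =>
                Algebra.subset_adjoin ⟨(i', j'), ⟨rfl, Nat.lt_succ_of_le hj'⟩, rfl⟩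
              rw [hX0]
              exact add_mem (pow_mem (hXj _ hj.le) _) (mul_mem (natCast_mem _ _) (hXj _ hj))
            | algebraMap r => rw [algebraMap_eq, hC0]; exact hCW _ _
            | add u v _ _ hu hv => rw [map_add]; exact add_mem hu hv
            | mul u v _ _ hu hv => rw [map_mul]; exact mul_mem hu hv
          exact hgen R hR
        exact hc2
      exact sub_mem (add_mem h1 (mul_mem (hCW _ _) (pow_mem (hXW k) _)))
        (pow_mem (add_mem (mul_mem (hCW _ _) (hXW k)) (hWmono k hR)) _)
    · rw [e2, add_sub_cancel_left]
      refine sub_mem (add_mem (Ideal.mul_mem_right _ _ ?_) (Ideal.mul_mem_right _ _ hpC))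
        (Ideal.mul_mem_right _ _ (Ideal.mem_map_of_mem _ (hD𝔷 k)))
      have := Ideal.mem_map_of_mem (C (σ := ι × ℕ)) (hε k)
      simpa using this
  have all : ∀ k, ∃ R ∈ W k, G k = C (D k) * X (i, k) + R := by
    intro k
    induction k with
    | zero => exact ⟨C f, hCW _ _, by rw [hG0]; ring⟩
    | succ k ih =>
      obtain ⟨R, hR, h⟩ := ih
      obtain ⟨R', hR', h', _⟩ := step k R hR h
      exact ⟨R', hR', h'⟩
  obtain ⟨R, hR, h⟩ := all k
  obtain ⟨R', hR', h', a, ha, b, hb, hab⟩ := step k R hR h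
  have hsub : W k ≤ supported S {t : ι × ℕ | t.2 < k} := supported_mono (fun t ht => ht.2)
  refine ⟨a, hsub ha, b, hsub hb, ?_⟩
  rw [h', add_sub_assoc]
  exact add_mem (Ideal.mul_mem_right _ _ (Ideal.mem_map_of_mem _ (hD𝔷 _))) hab

end P1csec

section P1dsec
theorem ringEnd_pow_succ {A : Type*} [CommRing A] (φ : A →+* A) (l : ℕ) (z : A) :
    (φ ^ (l + 1)) z = φ ((φ ^ l) z) := by
  rw [pow_succ']; rfl

theorem ringEnd_pow_add {A : Type*} [CommRing A] (φ : A →+* A) (l m : ℕ) (z : A) :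
    (φ ^ (l + m)) z = (φ ^ l) ((φ ^ m) z) := by
  rw [pow_add]; rfl

theorem ringEnd_pow_apply {A : Type*} [CommRing A] {p : ℕ} {φ : A →+* A} {z : A} (h : φ z = z ^ p)
    (l : ℕ) : (φ ^ l) z = z ^ p ^ l := by
  induction l with
  | zero => simp
  | succ l ih => rw [ringEnd_pow_succ, ih, map_pow, h, ← pow_mul, pow_succ']

theorem IsFrobLift.pow {A : Type*} [CommRing A] {p : ℕ} {φ : A →+* A} (h : IsFrobLift p φ)
    (l : ℕ) (z : A) : (p : A) ∣ (φ ^ l) z - z ^ p ^ l := by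
  induction l with
  | zero => simp
  | succ l ih =>
    rw [ringEnd_pow_succ]
    have h1 := h ((φ ^ l) z)
    have h2 := dvd_pow_sub_of_dvd_sub p ih
    have : φ ((φ ^ l) z) - z ^ p ^ (l + 1) = (φ ((φ ^ l) z) - (φ ^ l) z ^ p) +
      ((φ ^ l) z ^ p - (z ^ p ^ l) ^ p) := by rw [← pow_mul z, ← pow_succ]; ring
    rw [this]
    exact dvd_add h1 h2

theorem mem_of_sub_mem {A : Type*} [CommRing A] {I : Ideal A} {a b : A} (h : a - b ∈ I)
    (hb : b ∈ I) : a ∈ I := by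
  have := I.add_mem h hb
  simpa using this

theorem pow_sub_mem {A : Type*} [CommRing A] {I : Ideal A} {a b : A} (h : a - b ∈ I) (n : ℕ) :
    a ^ n - b ^ n ∈ I := I.mem_of_dvd (sub_dvd_pow_sub_pow a b n) h

/-- The ideal `𝔱_e^M`. -/
def tIdeal {A : Type*} [CommRing A] (p : ℕ) (I : Ideal A) (P x y : A) (e M : ℕ) : Ideal A :=
  I ⊔ Ideal.span {(p : A) - P ^ p ^ e, x ^ M, y ^ M}

section iter
variable {A : Type*} [CommRing A] {p : ℕ} {Φ : A →+* A} {I : Ideal A} {P x y : A}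

theorem tIdeal_I (e M : ℕ) : I ≤ tIdeal p I P x y e M := le_sup_left
theorem tIdeal_P (e M : ℕ) : (p : A) - P ^ p ^ e ∈ tIdeal p I P x y e M :=
  Ideal.mem_sup_right (Ideal.subset_span (by simp))
theorem tIdeal_x (e M : ℕ) : x ^ M ∈ tIdeal p I P x y e M :=
  Ideal.mem_sup_right (Ideal.subset_span (by simp))
theorem tIdeal_y (e M : ℕ) : y ^ M ∈ tIdeal p I P x y e M :=
  Ideal.mem_sup_right (Ideal.subset_span (by simp))

theorem tIdeal_map (hp : p.Prime) (hI : ∀ a ∈ I, Φ a ∈ I) (hP : Φ P = P ^ p) (hx : Φ x = x ^ p)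
    (hy : Φ y = y ^ p) (e M l : ℕ) {a : A} (ha : a ∈ tIdeal p I P x y e M) :
    (Φ ^ l) a ∈ tIdeal p I P x y (e + l) M := by
  have : tIdeal p I P x y e M ≤ (tIdeal p I P x y (e + l) M).comap (Φ ^ l) := by
    refine sup_le ?_ (Ideal.span_le.2 ?_)
    · intro a ha
      rw [Ideal.mem_comap]
      apply tIdeal_I
      induction l with
      | zero => simpa using ha
      | succ l ih => rw [ringEnd_pow_succ]; exact hI _ ih
    · have hpl : M ≤ M * p ^ l := Nat.le_mul_of_pos_right _ (pow_pos hp.pos _)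
      rintro z (rfl | rfl | rfl)
      · rw [SetLike.mem_coe, Ideal.mem_comap, map_sub, map_pow, map_natCast, ringEnd_pow_apply hP,
          ← pow_mul, ← pow_add, add_comm l e]
        exact tIdeal_P _ _
      · rw [SetLike.mem_coe, Ideal.mem_comap, map_pow, ringEnd_pow_apply hx, ← pow_mul,  mul_comm]
        exact Ideal.mem_of_dvd _ (pow_dvd_pow x hpl) (tIdeal_x _ _)
      · rw [SetLike.mem_coe, Ideal.mem_comap, map_pow, ringEnd_pow_apply hy, ← pow_mul,  mul_comm]
        exact Ideal.mem_of_dvd _ (pow_dvd_pow y hpl) (tIdeal_y _ _)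
  exact this ha

theorem iter_step (hp : p.Prime) (hΦ : IsFrobLift p Φ) (hI : ∀ a ∈ I, Φ a ∈ I) (hP : Φ P = P ^ p)
    (hx : Φ x = x ^ p) (hy : Φ y = y ^ p) (e M l : ℕ)
    (hnzd : Nzd P (tIdeal p I P x y (e + l) M)) (c : A)
    (hc : c ^ p ^ l ∈ tIdeal p I P x y e M) :
    ∃ c₁, c₁ ^ p ^ l ∈ tIdeal p I P x y (e + l) M ∧
      (Φ ^ l) c - P ^ p ^ e * c₁ ∈ tIdeal p I P x y (e + l) M := by
  set 𝔱 := tIdeal p I P x y (e + l) M with h𝔱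
  -- `p ≡ P^{p^(e+l)}`
  obtain ⟨h, hh⟩ := hΦ.pow l c
  have hdvd : P ^ p ^ e ∣ P ^ p ^ (e + l) :=
    pow_dvd_pow _ (Nat.pow_le_pow_right hp.pos (Nat.le_add_right _ _))
  have key : (Φ ^ l) c ∈ 𝔱 ⊔ Ideal.span {P ^ p ^ e} := by
    have hpm : (p : A) ∈ 𝔱 ⊔ Ideal.span {P ^ p ^ e} := by
      refine mem_of_sub_mem (b := P ^ p ^ (e + l)) (Ideal.mem_sup_left (tIdeal_P _ _)) ?_
      exact Ideal.mem_sup_right (Ideal.mem_span_singleton.2 hdvd)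
    have h1 : tIdeal p I P x y e M ≤ 𝔱 ⊔ Ideal.span {P ^ p ^ e} := by
      refine sup_le ((tIdeal_I _ _).trans le_sup_left) (Ideal.span_le.2 ?_)
      rintro z (rfl | rfl | rfl)
      · exact Ideal.sub_mem _ hpm (Ideal.mem_sup_right (Ideal.mem_span_singleton_self _))
      · exact Ideal.mem_sup_left (tIdeal_x _ _)
      · exact Ideal.mem_sup_left (tIdeal_y _ _)
    refine mem_of_sub_mem (b := c ^ p ^ l) ?_ (h1 hc)
    rw [hh]
    exact Ideal.mul_mem_right _ _ hpm
  obtain ⟨t, ht, z, hz, hsum⟩ := Submodule.mem_sup.1 key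
  obtain ⟨c₁, rfl⟩ := Ideal.mem_span_singleton'.1 hz
  have h2 : (Φ ^ l) c - P ^ p ^ e * c₁ ∈ 𝔱 := by
    have : (Φ ^ l) c - P ^ p ^ e * c₁ = t := by rw [← hsum]; ring
    rwa [this]
  refine ⟨c₁, ?_, h2⟩
  apply (hnzd.pow (p ^ e)).pow (p ^ l)
  rw [← mul_pow]
  have h3 := pow_sub_mem h2 (p ^ l)
  have h4 : (Φ ^ l) c ^ p ^ l ∈ 𝔱 := by
    rw [← map_pow]
    exact tIdeal_map hp hI hP hx hy e M l hc
  have := 𝔱.sub_mem h4 h3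
  simpa using this

theorem iter_all (hp : p.Prime) (hΦ : IsFrobLift p Φ) (hI : ∀ a ∈ I, Φ a ∈ I) (hP : Φ P = P ^ p)
    (hx : Φ x = x ^ p) (hy : Φ y = y ^ p) (e M l : ℕ)
    (hnzd : ∀ e, Nzd P (tIdeal p I P x y e M)) (b : A)
    (hb : b ^ p ^ l ∈ tIdeal p I P x y e M) (N : ℕ) :
    ∃ c, c ^ p ^ l ∈ tIdeal p I P x y (e + (N + 1) * l) M ∧
      (Φ ^ ((N + 1) * l)) b - P ^ ((N + 1) * p ^ (e + N * l)) * c ∈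
        tIdeal p I P x y (e + (N + 1) * l) M := by
  induction N with
  | zero =>
    obtain ⟨c, hc, h⟩ := iter_step hp hΦ hI hP hx hy e M l (hnzd _) b hb
    exact ⟨c, by simpa using hc, by simpa using h⟩
  | succ N ih =>
    obtain ⟨c, hc, h⟩ := ih
    obtain ⟨c', hc', h'⟩ := iter_step hp hΦ hI hP hx hy _ M l (hnzd _) c hc
    have e1 : e + (N + 1) * l + l = e + (N + 1 + 1) * l := by ring
    rw [e1] at hc' h'
    refine ⟨c', hc', ?_⟩
    have h2 := tIdeal_map hp hI hP hx hy _ M l h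
    rw [e1, map_sub, ← ringEnd_pow_add, map_mul, map_pow, ringEnd_pow_apply hP] at h2
    have e2 : l + (N + 1) * l = (N + 1 + 1) * l := by ring
    have e3 : (P ^ p ^ l) ^ ((N + 1) * p ^ (e + N * l)) = P ^ ((N + 1) * p ^ (e + (N + 1) * l)) := by
      rw [← pow_mul]; congr 1
      rw [show e + (N + 1) * l = (e + N * l) + l by ring, pow_add p (e + N * l) l]; ring
    rw [e2, e3] at h2
    have h3 := Ideal.mul_mem_left _ (P ^ ((N + 1) * p ^ (e + (N + 1) * l))) h'
    have := Ideal.add_mem _ h2 h3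
    convert this using 1
    rw [show (N + 1 + 1) * p ^ (e + (N + 1) * l) = (N + 1) * p ^ (e + (N + 1) * l) +
      p ^ (e + (N + 1) * l) by ring, pow_add]
    ring

theorem iter_main (hp : p.Prime) (hΦ : IsFrobLift p Φ) (hI : ∀ a ∈ I, Φ a ∈ I) (hP : Φ P = P ^ p)
    (hx : Φ x = x ^ p) (hy : Φ y = y ^ p) (hnzd : ∀ e M, Nzd P (tIdeal p I P x y e M))
    (w U a b : A) (n : ℕ) (hw : Φ w = w ^ p)
    (h : w * (p ^ n * U - x * a - y * b) ∈ I ⊔ Ideal.span {(p : A) - P}) (e : ℕ) :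
    ∃ L, w ^ p ^ L * U ^ p ^ (e + L) ∈
      tIdeal p I P x y (e + L) (p ^ (e + L)) ⊔ Ideal.span {P} := by
  set κ := (p : A) ^ n * U - x * a - y * b with hκ
  set N := (n + 1) * p ^ e with hN
  set L := (N + 1) * e with hL
  set E := e + L with hE
  set Q := p ^ E with hQ
  set 𝔱 := tIdeal p I P x y E Q with h𝔱
  set β := w * (Φ ^ e) κ with hβ
  have hβ1 : β ^ p ^ e ∈ tIdeal p I P x y e Q := by
    have h0 : w * κ ∈ tIdeal p I P x y 0 Q := by
      have : I ⊔ Ideal.span {(p : A) - P} ≤ tIdeal p I P x y 0 Q := by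
        refine sup_le (tIdeal_I _ _) (Ideal.span_le.2 ?_)
        rintro z rfl
        have := tIdeal_P (p := p) (I := I) (P := P) (x := x) (y := y) 0 Q
        simpa using this
      exact this h
    have h1 := tIdeal_map hp hI hP hx hy 0 Q e h0
    rw [zero_add, map_mul, ringEnd_pow_apply hw] at h1
    have hpe : 1 ≤ p ^ e := Nat.one_le_pow _ _ hp.pos
    rw [hβ, mul_pow]
    refine Ideal.mem_of_dvd _ ?_ h1
    exact mul_dvd_mul_left _ (dvd_pow_self _ (by omega))
  obtain ⟨c, -, hc⟩ := iter_all hp hΦ hI hP hx hy e Q e (fun e => hnzd e Q) β hβ1 N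
  rw [← hL, ← hE, ← h𝔱] at hc
  refine ⟨L, ?_⟩
  rw [← hE, ← hQ, ← h𝔱]
  -- compute `Φ^L β`
  have h1 : (Φ ^ L) β = w ^ p ^ L * (Φ ^ E) κ := by
    rw [hβ, map_mul, ringEnd_pow_apply hw, ← ringEnd_pow_add, hE, add_comm e L]
  have h2 : (Φ ^ E) κ = (p : A) ^ n * (Φ ^ E) U - x ^ Q * (Φ ^ E) a - y ^ Q * (Φ ^ E) b := by
    rw [hκ]; simp only [map_sub, map_mul, map_pow, map_natCast, ringEnd_pow_apply hx,
      ringEnd_pow_apply hy, hQ]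
  have hpP : (p : A) - P ^ Q ∈ 𝔱 := tIdeal_P _ _
  have hpn := pow_sub_mem hpP n
  rw [← pow_mul] at hpn
  have h3 : P ^ (Q * n) * (w ^ p ^ L * (Φ ^ E) U) - P ^ ((N + 1) * p ^ (e + N * e)) * c ∈ 𝔱 := by
    have hx' : x ^ Q ∈ 𝔱 := tIdeal_x _ _
    have hy' : y ^ Q ∈ 𝔱 := tIdeal_y _ _
    have e1 : P ^ (Q * n) * (w ^ p ^ L * (Φ ^ E) U) - P ^ ((N + 1) * p ^ (e + N * e)) * c =
      ((Φ ^ L) β - P ^ ((N + 1) * p ^ (e + N * e)) * c) - ((p : A) ^ n - P ^ (Q * n)) *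
        (w ^ p ^ L * (Φ ^ E) U) + x ^ Q * (w ^ p ^ L * (Φ ^ E) a) +
        y ^ Q * (w ^ p ^ L * (Φ ^ E) b) := by
      rw [h1, h2]; ring
    rw [e1]
    exact add_mem (add_mem (sub_mem hc (Ideal.mul_mem_right _ _ hpn)) (Ideal.mul_mem_right _ _ hx'))
      (Ideal.mul_mem_right _ _ hy')
  have hexp : Q * n + 1 ≤ (N + 1) * p ^ (e + N * e) := by
    have e2 : Q = p ^ e * p ^ (e + N * e) := by
      rw [hQ, hE, hL, ← pow_add]; congr 1; ring
    have h5 : 1 ≤ p ^ (e + N * e) := Nat.one_le_pow _ _ hp.pos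
    have h6 : 1 ≤ p ^ e := Nat.one_le_pow _ _ hp.pos
    rw [e2, hN]
    generalize p ^ (e + N * e) = X at *
    generalize p ^ e = Z at *
    have : ((n + 1) * Z + 1) * X = Z * X * n + Z * X + X := by ring
    omega
  obtain ⟨g, hg⟩ := Nat.exists_eq_add_of_le hexp
  rw [hg] at h3
  have h7 : w ^ p ^ L * (Φ ^ E) U - P * (P ^ g * c) ∈ 𝔱 := by
    apply (hnzd E Q).pow (Q * n)
    convert h3 using 1
    rw [pow_add, pow_add]; ring
  have hp' : (p : A) ∈ 𝔱 ⊔ Ideal.span {P} := by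
    refine mem_of_sub_mem (b := P ^ Q) (Ideal.mem_sup_left hpP) (Ideal.mem_sup_right ?_)
    rw [Ideal.mem_span_singleton]
    exact dvd_pow_self _ (pow_pos hp.pos _).ne'
  have h8 : w ^ p ^ L * (Φ ^ E) U ∈ 𝔱 ⊔ Ideal.span {P} := by
    refine mem_of_sub_mem (Ideal.mem_sup_left h7) (Ideal.mem_sup_right ?_)
    exact Ideal.mul_mem_right _ _ (Ideal.mem_span_singleton_self _)
  obtain ⟨r, hr⟩ := hΦ.pow E U
  have : w ^ p ^ L * U ^ Q = w ^ p ^ L * (Φ ^ E) U - p * (w ^ p ^ L * r) := by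
    rw [hQ, ← sub_sub_cancel ((Φ ^ E) U) (U ^ p ^ E), hr]; ring
  rw [this]
  exact sub_mem h8 (Ideal.mul_mem_right _ _ hp')

end iter

end P1dsec

section P1esec
theorem exists_finset_sup_span {A σ : Type*} [CommRing A] {𝔟 : Ideal A} {g : σ → A} {a : A}
    (h : a ∈ 𝔟 ⊔ Ideal.span (Set.range g)) : ∃ T : Finset σ, a ∈ 𝔟 ⊔ Ideal.span (g '' T) := by
  classical
  obtain ⟨β, hβ, z, hz, rfl⟩ := Submodule.mem_sup.1 h
  obtain ⟨T', hT', hz'⟩ := Submodule.mem_span_finite_of_mem_span hz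
  rw [← Set.image_univ] at hT'
  obtain ⟨T, -, rfl⟩ := Finset.subset_set_image_iff.1 hT'
  refine ⟨T, Submodule.add_mem_sup hβ ?_⟩
  rwa [Finset.coe_image] at hz'

theorem sup_span_congr {A σ : Type*} [CommRing A] {𝔟 : Ideal A} {g h : σ → A} {T : Set σ}
    (H : ∀ s ∈ T, g s - h s ∈ 𝔟) : 𝔟 ⊔ Ideal.span (g '' T) = 𝔟 ⊔ Ideal.span (h '' T) := by
  apply le_antisymm
  · refine sup_le le_sup_left (Ideal.span_le.2 ?_)
    rintro _ ⟨s, hs, rfl⟩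
    exact mem_of_sub_mem (Ideal.mem_sup_left (H s hs))
      (Ideal.mem_sup_right (Ideal.subset_span ⟨s, hs, rfl⟩))
  · refine sup_le le_sup_left (Ideal.span_le.2 ?_)
    rintro _ ⟨s, hs, rfl⟩
    refine mem_of_sub_mem (b := g s) (Ideal.mem_sup_left ?_)
      (Ideal.mem_sup_right (Ideal.subset_span ⟨s, hs, rfl⟩))
    have := 𝔟.neg_mem (H s hs)
    simpa using this

theorem poly_sharp {A : Type*} [CommRing A] (𝔠 : Ideal A) :
    𝔠.map Polynomial.C ⊔ Ideal.span {Polynomial.X} = 𝔠.comap Polynomial.constantCoeff := by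
  apply le_antisymm
  · refine sup_le (Ideal.map_le_iff_le_comap.2 ?_) (Ideal.span_le.2 ?_)
    · intro c hc; simpa using hc
    · rintro _ rfl; simp
  · intro f hf
    rw [← Polynomial.X_mul_divX_add f, add_comm]
    refine Submodule.add_mem_sup (Ideal.mem_map_of_mem _ hf) ?_
    exact Ideal.mul_mem_right _ _ (Ideal.mem_span_singleton_self _)

theorem polyS_data {Λ : Type*} [CommRing Λ] {p : ℕ} (hp : p.Prime)
    (hΛ : ∀ a : Λ, (p : Λ) * a = 0 → a = 0) (φ : Λ →+* Λ) (hφ : IsFrobLift p φ) :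
    ∃ (φS : Polynomial Λ →+* Polynomial Λ) (D ε : ℕ → Polynomial Λ),
      (∀ c, φS (Polynomial.C c) = Polynomial.C (φ c)) ∧ φS Polynomial.X = Polynomial.X ^ p ∧
      IsFrobLift p φS ∧ (∀ a : Polynomial Λ, (p : Polynomial Λ) * a = 0 → a = 0) ∧
      D 0 = (p : Polynomial Λ) - Polynomial.X ∧ (∀ k, φS (D k) = D (k + 1)) ∧
      (p : Polynomial Λ) ∈ (Ideal.span {(p : Λ)}).comap Polynomial.constantCoeff ∧
      (∀ k, D (k + 1) = D k ^ p + p * ε k) ∧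
      (∀ k, D k ∈ (Ideal.span {(p : Λ)}).comap Polynomial.constantCoeff) ∧
      (∀ k, ε k - 1 ∈ (Ideal.span {(p : Λ)}).comap Polynomial.constantCoeff) := by
  -- the base ring `(Polynomial Λ) = Λ[P]`
  obtain ⟨φS, hφSC, hφSX⟩ : ∃ φS : (Polynomial Λ) →+* (Polynomial Λ), (∀ c, φS (Polynomial.C c) = Polynomial.C (φ c)) ∧
      φS Polynomial.X = Polynomial.X ^ p :=
    ⟨Polynomial.eval₂RingHom (Polynomial.C.comp φ) (Polynomial.X ^ p), by simp, by simp⟩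
  have hφS : IsFrobLift p φS := by
    intro f
    have key : (p : (Polynomial Λ)) ∣ φS f - (RingHom.id _ f) ^ p := by
      induction f using Polynomial.induction_on with
      | C c =>
        obtain ⟨r, hr⟩ := hφ c
        refine ⟨Polynomial.C r, ?_⟩
        rw [hφSC, RingHom.id_apply, ← Polynomial.C_pow, ← Polynomial.C_sub, hr, Polynomial.C_mul]
        simp
      | add f g hf hg => exact frobLift_add hp hf hg
      | monomial k c h =>
        rw [pow_succ, ← mul_assoc]
        exact frobLift_mul h (by rw [hφSX]; simp)
    exact key
  have hS : ∀ a : (Polynomial Λ), (p : (Polynomial Λ)) * a = 0 → a = 0 := by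
    intro f hf
    ext k
    rw [Polynomial.coeff_zero]
    apply hΛ
    have := congrArg (fun g => Polynomial.coeff g k) hf
    simpa using this
  let D : ℕ → (Polynomial Λ) := fun k => (p : (Polynomial Λ)) - Polynomial.X ^ p ^ k
  have hD : ∀ k, φS (D k) = D (k + 1) := by
    intro k
    simp only [D, map_sub, map_natCast, map_pow, hφSX]
    rw [← pow_mul, ← pow_succ']
  let 𝔷 : Ideal (Polynomial Λ) := (Ideal.span {(p : Λ)}).comap Polynomial.constantCoeff
  have hp𝔷 : (p : (Polynomial Λ)) ∈ 𝔷 := by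
    simp only [𝔷, Ideal.mem_comap, map_natCast]; exact Ideal.mem_span_singleton_self _
  have hX𝔷 : ∀ k, (Polynomial.X : (Polynomial Λ)) ^ p ^ k ∈ 𝔷 := by
    intro k
    apply Ideal.pow_mem_of_mem _ _ _ (pow_pos hp.pos _)
    simp [𝔷]
  have hD𝔷 : ∀ k, D k ∈ 𝔷 := fun k => sub_mem hp𝔷 (hX𝔷 k)
  have hex : ∀ k, ∃ ε : (Polynomial Λ), D (k + 1) = D k ^ p + p * ε ∧ ε - 1 ∈ 𝔷 := by
    intro k
    obtain ⟨r, hr⟩ := exists_add_pow_prime_eq hp (p : (Polynomial Λ)) (-Polynomial.X ^ p ^ k)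
    have hθ : ∃ θ : (Polynomial Λ), (-Polynomial.X ^ p ^ k) ^ p = -(Polynomial.X : (Polynomial Λ)) ^ p ^ (k + 1) +
        (p : (Polynomial Λ)) * (θ * Polynomial.X ^ p ^ (k + 1)) := by
      rcases hp.eq_two_or_odd' with h2 | h2
      · refine ⟨1, ?_⟩
        rw [neg_pow, h2, ← pow_mul, ← pow_succ]; push_cast; ring
      · refine ⟨0, ?_⟩
        rw [h2.neg_pow, ← pow_mul, ← pow_succ]; ring
    obtain ⟨θ, hθ⟩ := hθ
    obtain ⟨p', hp'⟩ : ∃ p', p = p' + 2 := Nat.exists_eq_add_of_le' hp.two_le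
    refine ⟨1 - (p : (Polynomial Λ)) ^ (p' + 1) - θ * Polynomial.X ^ p ^ (k + 1) + (p : (Polynomial Λ)) * (Polynomial.X ^ p ^ k * r),
      ?_, ?_⟩
    · simp only [D]
      rw [sub_eq_add_neg (p : (Polynomial Λ)) (Polynomial.X ^ p ^ k), hr, hθ]
      have : (p : (Polynomial Λ)) ^ p = (p : (Polynomial Λ)) * (p : (Polynomial Λ)) ^ (p' + 1) := by
        conv_lhs => rw [hp']
        conv_rhs => rw [← pow_succ', hp']
      rw [this]
      ring
    · have : (1 - (p : (Polynomial Λ)) ^ (p' + 1) - θ * Polynomial.X ^ p ^ (k + 1) +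
        (p : (Polynomial Λ)) * (Polynomial.X ^ p ^ k * r)) - 1 =
        -(p : (Polynomial Λ)) * (p : (Polynomial Λ)) ^ p' - θ * Polynomial.X ^ p ^ (k + 1) + (p : (Polynomial Λ)) * (Polynomial.X ^ p ^ k * r) := by
        ring
      rw [this]
      exact add_mem (sub_mem (Ideal.mul_mem_right _ _ (neg_mem hp𝔷))
        (Ideal.mul_mem_left _ _ (hX𝔷 _))) (Ideal.mul_mem_right _ _ hp𝔷)
  choose ε hDε hε using hex
  exact ⟨φS, D, ε, hφSC, hφSX, hφS, hS, by simp [D], hD, hp𝔷, hDε, hD𝔷, hε⟩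

theorem exists_seq {ι A : Type*} (g0 : ι → A) (δ : A → A) :
    ∃ G : ι → ℕ → A, (∀ i, G i 0 = g0 i) ∧ ∀ i k, G i (k + 1) = δ (G i k) :=
  ⟨fun i k => Nat.rec (g0 i) (fun _ g => δ g) k, fun _ => rfl, fun _ _ => rfl⟩

open MvPolynomial in
theorem env_data {S : Type*} [CommRing S] {p : ℕ} (hp : p.Prime)
    (hS : ∀ a : S, (p : S) * a = 0 → a = 0) {φ : S →+* S} (hφ : IsFrobLift p φ)
    (𝔷 : Ideal S) (hp𝔷 : (p : S) ∈ 𝔷) (D ε : ℕ → S) (hD : ∀ k, φ (D k) = D (k + 1))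
    (hDε : ∀ k, D (k + 1) = D k ^ p + p * ε k) (hD𝔷 : ∀ k, D k ∈ 𝔷) (hε : ∀ k, ε k - 1 ∈ 𝔷)
    {m : ℕ} (F : Fin m → S) :
    ∃ (Φ : MvPolynomial (Fin m × ℕ) S →+* MvPolynomial (Fin m × ℕ) S)
      (G : Fin m → ℕ → MvPolynomial (Fin m × ℕ) S) (α β : Fin m × ℕ → MvPolynomial (Fin m × ℕ) S),
      IsFrobLift p Φ ∧ (∀ s, Φ (C s) = C (φ s)) ∧
      (∀ i, G i 0 = C (F i) + C (D 0) * X (i, 0)) ∧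
      (∀ i k, Φ (G i k) = G i k ^ p + p * G i (k + 1)) ∧
      (∀ s, α s ∈ supported S {t : Fin m × ℕ | t.2 < s.2}) ∧
      (∀ s, β s ∈ supported S {t : Fin m × ℕ | t.2 < s.2}) ∧
      (∀ s, G s.1 (s.2 + 1) - (X s ^ p + (β s * X s + α s)) ∈ 𝔷.map C) := by
  have hΦ : IsFrobLift p (envPhi (Fin m) p φ) := envPhi_isFrobLift (Fin m) hp hφ
  obtain ⟨δ, hδ⟩ := hΦ.delta
  obtain ⟨G, hG0, hG1⟩ := exists_seq (fun i : Fin m =>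
    (C (F i) + C (D 0) * X (i, 0) : MvPolynomial (Fin m × ℕ) S)) δ
  have hG : ∀ i k, envPhi (Fin m) p φ (G i k) = G i k ^ p + (p : MvPolynomial (Fin m × ℕ) S) * G i (k + 1) := by
    intro i k
    rw [hG1]; exact hδ _
  have key : ∀ s : Fin m × ℕ, ∃ a ∈ supported S {t : Fin m × ℕ | t.2 < s.2},
      ∃ b ∈ supported S {t : Fin m × ℕ | t.2 < s.2},
      G s.1 (s.2 + 1) - (X s ^ p + (b * X s + a)) ∈ 𝔷.map C := by
    rintro ⟨i, k⟩
    exact env_structure hp hS hφ 𝔷 hp𝔷 D ε hD hDε hD𝔷 hε i (F i) (G i) (hG0 i) (hG i) k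
  choose α hα β hβ hαβ using key
  have hC : ∀ s, envPhi (Fin m) p φ (C s) = C (φ s) := fun s => by simp [envPhi]
  refine ⟨envPhi (Fin m) p φ, G, α, β, hΦ, hC, hG0, hG, ?_, ?_, ?_⟩
  · exact hα
  · exact hβ
  · exact hαβ



/-- The extension of an ideal `𝔠` of `Λ` together with the variable `P`. -/
noncomputable def sharpI {Λ : Type*} [CommRing Λ] (σ : Type*) (𝔠 : Ideal Λ) :
    Ideal (MvPolynomial σ (Polynomial Λ)) :=
  (𝔠.comap Polynomial.constantCoeff).map MvPolynomial.C

theorem sharpI_eq {Λ : Type*} [CommRing Λ] (σ : Type*) (𝔠 : Ideal Λ) :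
    𝔠.map ((MvPolynomial.C (σ := σ)).comp (Polynomial.C (R := Λ))) ⊔
      Ideal.span {MvPolynomial.C Polynomial.X} = sharpI σ 𝔠 := by
  rw [sharpI, ← poly_sharp, Ideal.map_sup, Ideal.map_map, Ideal.map_span, Set.image_singleton]

theorem sharpI_nzd {Λ : Type*} [CommRing Λ] (σ : Type*) (𝔠 : Ideal Λ) (s : Polynomial Λ)
    (h : Nzd (Polynomial.constantCoeff s) 𝔠) : Nzd (MvPolynomial.C s) (sharpI σ 𝔠) :=
  (Nzd.comap (Polynomial.constantCoeff (R := Λ)) h).mvC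

end P1esec

section P1fsec
theorem ideal_sup_aux {A : Type*} [CommRing A] (a b c d e : Ideal A) :
    a ⊔ b ⊔ (c ⊔ (d ⊔ e)) = d ⊔ e ⊔ c ⊔ a ⊔ b := by
  apply le_antisymm
  · refine sup_le (sup_le ?_ ?_) (sup_le ?_ (sup_le ?_ ?_))
    · exact le_sup_right.trans le_sup_left
    · exact le_sup_right
    · exact (le_sup_right.trans le_sup_left).trans le_sup_left
    · exact ((le_sup_left.trans le_sup_left).trans le_sup_left).trans le_sup_left
    · exact ((le_sup_right.trans le_sup_left).trans le_sup_left).trans le_sup_left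
  · refine sup_le (sup_le (sup_le (sup_le ?_ ?_) ?_) ?_) ?_
    · exact (le_sup_left.trans le_sup_right).trans le_sup_right
    · exact (le_sup_right.trans le_sup_right).trans le_sup_right
    · exact le_sup_left.trans le_sup_right
    · exact le_sup_left.trans le_sup_left
    · exact le_sup_right.trans le_sup_left

set_option maxHeartbeats 1600000 in
open MvPolynomial in
theorem core {Λ : Type*} [CommRing Λ] {p : ℕ} (hp : p.Prime)
    (hΛ : ∀ a : Λ, (p : Λ) * a = 0 → a = 0) (φ : Λ →+* Λ) (hφ : IsFrobLift p φ)
    (x y w : Λ) (hx : φ x = x ^ p) (hy : φ y = y ^ p) (hw : φ w = w ^ p) {m : ℕ} (F : Fin m → Λ)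
    (U a b : Λ) (n : ℕ) (hκ : w * (p ^ n * U - x * a - y * b) ∈ Ideal.span (Set.range F))
    (hpxy : ∀ M, Nzd (p : Λ) (Ideal.span {x ^ M, y ^ M}))
    (hF : ∀ M i, Nzd (F i) (Ideal.span {(p : Λ), x ^ M, y ^ M} ⊔ Ideal.span (F '' {j | j < i})))
    (e : ℕ) :
    ∃ L, w ^ p ^ L * U ^ p ^ (e + L) ∈
      Ideal.span {(p : Λ), x ^ p ^ (e + L), y ^ p ^ (e + L)} ⊔ Ideal.span (Set.range F) := by
  classical
  obtain ⟨φS, D, ε, hφSC, hφSX, hφS, hS, hD0, hD, hp𝔷, hDε, hD𝔷, hε⟩ := polyS_data hp hΛ φ hφ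
  obtain ⟨𝔷, h𝔷⟩ : ∃ 𝔷, 𝔷 = (Ideal.span {(p : Λ)}).comap Polynomial.constantCoeff := ⟨_, rfl⟩
  rw [← h𝔷] at hp𝔷
  simp only [← h𝔷] at hD𝔷 hε
  obtain ⟨Φ, G, α, β, hΦ, hΦC, hG0, hG, hα, hβ, hαβ⟩ := env_data hp hS hφS 𝔷 hp𝔷 D ε hD hDε hD𝔷 hε
    (fun i => Polynomial.C (F i))
  let E : Fin m × ℕ → MvPolynomial (Fin m × ℕ) (Polynomial Λ) := fun s => X s ^ p + (β s * X s + α s)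
  let G' : Fin m × ℕ → MvPolynomial (Fin m × ℕ) (Polynomial Λ) := fun s => G s.1 (s.2 + 1)
  let I : Ideal (MvPolynomial (Fin m × ℕ) (Polynomial Λ)) :=
    Ideal.span (Set.range (fun i => G i 0)) ⊔ Ideal.span (Set.range G')
  have hGI : ∀ i k, G i k ∈ I := by
    intro i k
    cases k with
    | zero => exact Ideal.mem_sup_left (Ideal.subset_span ⟨i, rfl⟩)
    | succ k => exact Ideal.mem_sup_right (Ideal.subset_span ⟨(i, k), rfl⟩)
  have hI : ∀ a ∈ I, Φ a ∈ I := by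
    have : I ≤ I.comap Φ := by
      have h1 : ∀ i k, Φ (G i k) ∈ I := by
        intro i k
        rw [hG]
        exact add_mem (Ideal.pow_mem_of_mem _ (hGI i k) _ hp.pos) (Ideal.mul_mem_left _ _ (hGI i _))
      refine sup_le (Ideal.span_le.2 ?_) (Ideal.span_le.2 ?_)
      · rintro _ ⟨i, rfl⟩; exact h1 i 0
      · rintro _ ⟨s, rfl⟩; exact h1 s.1 _
    exact this
  let c : Λ →+* MvPolynomial (Fin m × ℕ) (Polynomial Λ) := C.comp Polynomial.C
  let P : MvPolynomial (Fin m × ℕ) (Polynomial Λ) := C Polynomial.X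
  have hΦc : ∀ z, Φ (c z) = c (φ z) := fun z => by
    simp only [c, RingHom.comp_apply]; rw [hΦC, hφSC]
  have hP : Φ P = P ^ p := by simp only [P]; rw [hΦC, hφSX, C_pow]
  have hsharp : ∀ 𝔠 : Ideal Λ, 𝔠.map c ⊔ Ideal.span {P} = sharpI (Fin m × ℕ) 𝔠 :=
    fun 𝔠 => sharpI_eq _ 𝔠
  have hsharpN : ∀ (𝔠 : Ideal Λ) (s : (Polynomial Λ)), Nzd (Polynomial.constantCoeff s) 𝔠 →
      Nzd (C s) (sharpI (Fin m × ℕ) 𝔠) := fun 𝔠 s h => sharpI_nzd _ 𝔠 s h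
  have h𝔷sharp : ∀ 𝔠 : Ideal Λ, (p : Λ) ∈ 𝔠 → 𝔷.map C ≤ sharpI (Fin m × ℕ) 𝔠 := by
    intro 𝔠 h
    rw [h𝔷]
    apply Ideal.map_mono
    apply Ideal.comap_mono
    rwa [Ideal.span_singleton_le_iff_mem]
  have hG0' : ∀ i, G i 0 - c (F i) ∈ 𝔷.map C := by
    intro i
    rw [hG0]
    simp only [c, RingHom.comp_apply, add_sub_cancel_left]
    exact Ideal.mul_mem_right _ _ (Ideal.mem_map_of_mem _ (hD𝔷 0))
  have hcp : c p = p := map_natCast c p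
  -- the ideals
  let 𝔟1 : ℕ → ℕ → Ideal (MvPolynomial (Fin m × ℕ) (Polynomial Λ)) := fun e M =>
    (Ideal.span {x ^ M, y ^ M}).map c ⊔ Ideal.span {(p : MvPolynomial (Fin m × ℕ) (Polynomial Λ)) - P ^ p ^ e}
  have hN1 : ∀ e M, Nzd P (𝔟1 e M) := by
    intro e M
    apply Nzd.step
    · have := (Nzd.polyX (𝔟 := Ideal.span {x ^ M, y ^ M})).mvC (σ := Fin m × ℕ)
      rwa [Ideal.map_map] at this
    · rw [hsharp]
      have h1 := hsharpN (Ideal.span {x ^ M, y ^ M}) ((p : Polynomial Λ) - Polynomial.X ^ p ^ e) (by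
        have := hpxy M
        have hne : p ^ e ≠ 0 := (pow_pos hp.pos _).ne'
        simpa [hne.symm, Polynomial.coeff_X_pow] using this)
      simpa [P] using h1
  have hpt : ∀ (e : ℕ) (𝔠 : Ideal (MvPolynomial (Fin m × ℕ) (Polynomial Λ))), P ∈ 𝔠 →
      (p : MvPolynomial (Fin m × ℕ) (Polynomial Λ)) - P ^ p ^ e ∈ 𝔠 →
      (p : MvPolynomial (Fin m × ℕ) (Polynomial Λ)) ∈ 𝔠 := by
    intro e 𝔠 h1 h2
    exact mem_of_sub_mem h2 (Ideal.pow_mem_of_mem _ h1 _ (pow_pos hp.pos _))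
  have heq1 : ∀ e M, 𝔟1 e M ⊔ Ideal.span {P} = sharpI (Fin m × ℕ) (Ideal.span {(p : Λ), x ^ M, y ^ M}) := by
    intro e M
    rw [← hsharp]
    apply le_antisymm
    · refine sup_le (sup_le ?_ ?_) le_sup_right
      · refine le_trans (Ideal.map_mono (Ideal.span_mono ?_)) le_sup_left
        exact Set.subset_insert _ _
      · rw [Ideal.span_singleton_le_iff_mem]
        refine sub_mem (Ideal.mem_sup_left ?_) (Ideal.mem_sup_right ?_)
        · rw [← hcp]; exact Ideal.mem_map_of_mem _ (Ideal.subset_span (by simp))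
        · exact Ideal.pow_mem_of_mem _ (Ideal.mem_span_singleton_self _) _ (pow_pos hp.pos _)
    · refine sup_le ?_ le_sup_right
      rw [Ideal.map_span, Ideal.span_le]
      rintro _ ⟨z, (rfl | hz), rfl⟩
      · rw [hcp]
        exact hpt e _ (Ideal.mem_sup_right (Ideal.mem_span_singleton_self _))
          (Ideal.mem_sup_left (Ideal.mem_sup_right (Ideal.mem_span_singleton_self _)))
      · exact Ideal.mem_sup_left (Ideal.mem_sup_left (Ideal.mem_map_of_mem _ (Ideal.subset_span hz)))
  have heq2 : ∀ e M (T : Set (Fin m)), (𝔟1 e M ⊔ Ideal.span ((fun i => G i 0) '' T)) ⊔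
      Ideal.span {P} = sharpI (Fin m × ℕ) (Ideal.span {(p : Λ), x ^ M, y ^ M} ⊔ Ideal.span (F '' T)) := by
    intro e M T
    have hpm : (p : Λ) ∈ Ideal.span {(p : Λ), x ^ M, y ^ M} := Ideal.subset_span (by simp)
    rw [sup_right_comm, heq1, sup_span_congr (h := fun i => c (F i))
      (fun s _ => h𝔷sharp _ hpm (hG0' s)), ← hsharp, ← hsharp, Ideal.map_sup, sup_right_comm,
      Ideal.map_span c (F '' T), Set.image_image]
  have hN2 : ∀ e M (k : ℕ), k ≤ m →
      Nzd P (𝔟1 e M ⊔ Ideal.span ((fun i => G i 0) '' {j : Fin m | j.1 < k})) := by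
    intro e M k
    induction k with
    | zero => intro _; simpa using hN1 e M
    | succ k ih =>
      intro hk
      have hset : {j : Fin m | j.1 < k + 1} = insert ⟨k, hk⟩ {j : Fin m | j.1 < k} := by
        ext j; simp [Fin.ext_iff]; omega
      rw [hset, Set.image_insert_eq, Ideal.span_insert, ← sup_assoc, sup_right_comm]
      apply Nzd.step (ih (by omega))
      rw [heq2]
      have hpm : (p : Λ) ∈ Ideal.span {(p : Λ), x ^ M, y ^ M} ⊔
          Ideal.span (F '' {j : Fin m | j.1 < k}) :=
        Ideal.mem_sup_left (Ideal.subset_span (by simp))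
      apply Nzd.congr (h𝔷sharp _ hpm (hG0' ⟨k, hk⟩))
      apply hsharpN
      rw [Polynomial.constantCoeff_apply, Polynomial.coeff_C_zero]
      exact hF M ⟨k, hk⟩
  let 𝔟2 : ℕ → ℕ → Ideal (MvPolynomial (Fin m × ℕ) (Polynomial Λ)) := fun e M =>
    𝔟1 e M ⊔ Ideal.span (Set.range (fun i => G i 0))
  have hunivT : {j : Fin m | j.1 < m} = Set.univ := by ext j; simp
  have heq3 : ∀ e M (T : Set (Fin m × ℕ)), (𝔟2 e M ⊔ Ideal.span (G' '' T)) ⊔ Ideal.span {P} =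
      sharpI (Fin m × ℕ) (Ideal.span {(p : Λ), x ^ M, y ^ M} ⊔ Ideal.span (Set.range F)) ⊔
        Ideal.span (E '' T) := by
    intro e M T
    have hpm : (p : Λ) ∈ Ideal.span {(p : Λ), x ^ M, y ^ M} ⊔ Ideal.span (Set.range F) :=
      Ideal.mem_sup_left (Ideal.subset_span (by simp))
    have := heq2 e M Set.univ
    rw [Set.image_univ, Set.image_univ] at this
    rw [sup_right_comm, this]
    exact sup_span_congr (fun s _ => h𝔷sharp _ hpm (hαβ s))
  have hN3 : ∀ e M (T : Finset (Fin m × ℕ)), Nzd P (𝔟2 e M ⊔ Ideal.span (G' '' T)) := by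
    intro e M T
    induction T using Finset.induction_on_max_value (fun s : Fin m × ℕ => s.2) with
    | empty =>
      have := hN2 e M m le_rfl
      rw [hunivT, Set.image_univ] at this
      simpa [𝔟2] using this
    | insert s T hs hT ih =>
      rw [Finset.coe_insert, Set.image_insert_eq, Ideal.span_insert,
        sup_comm (Ideal.span {G' s}), ← sup_assoc]
      apply Nzd.step ih
      rw [heq3]
      have hpm : (p : Λ) ∈ Ideal.span {(p : Λ), x ^ M, y ^ M} ⊔ Ideal.span (Set.range F) :=
        Ideal.mem_sup_left (Ideal.subset_span (by simp))
      apply Nzd.congr (b := E s) (Ideal.mem_sup_left (h𝔷sharp _ hpm (hαβ s)))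
      exact (triangular (fun s : Fin m × ℕ => s.2) hp.two_le α β hα hβ _ T).1 s hs hT
  have htI : ∀ e M, tIdeal p I P (c x) (c y) e M = 𝔟2 e M ⊔ Ideal.span (Set.range G') := by
    intro e M
    have h0 : (Ideal.span {x ^ M, y ^ M}).map c =
        Ideal.span {c x ^ M} ⊔ Ideal.span {c y ^ M} := by
      rw [Ideal.map_span, Set.image_insert_eq, Set.image_singleton, Ideal.span_insert, map_pow,
        map_pow]
    simp only [tIdeal, I, 𝔟2, 𝔟1]
    rw [h0]
    rw [Ideal.span_insert, Ideal.span_insert]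
    exact ideal_sup_aux _ _ _ _ _
  have hnzd : ∀ e M, Nzd P (tIdeal p I P (c x) (c y) e M) := by
    intro e M t ht
    rw [htI] at ht ⊢
    obtain ⟨T, hT⟩ := exists_finset_sup_span ht
    have := hN3 e M T t hT
    have hle : 𝔟2 e M ⊔ Ideal.span (G' '' T) ≤ 𝔟2 e M ⊔ Ideal.span (Set.range G') :=
      sup_le_sup le_rfl (Ideal.span_mono (Set.image_subset_range _ _))
    exact hle this
  have hκ' : c w * ((p : MvPolynomial (Fin m × ℕ) (Polynomial Λ)) ^ n * c U - c x * c a - c y * c b) ∈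
      I ⊔ Ideal.span {(p : MvPolynomial (Fin m × ℕ) (Polynomial Λ)) - P} := by
    have h1 := Ideal.mem_map_of_mem c hκ
    simp only [map_mul, map_sub, map_pow, hcp] at h1
    have h2 : (Ideal.span (Set.range F)).map c ≤
        I ⊔ Ideal.span {(p : MvPolynomial (Fin m × ℕ) (Polynomial Λ)) - P} := by
      rw [Ideal.map_span, Ideal.span_le]
      rintro _ ⟨_, ⟨i, rfl⟩, rfl⟩
      have h3 : c (F i) = G i 0 - ((p : MvPolynomial (Fin m × ℕ) (Polynomial Λ)) - P) * X (i, 0) := by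
        rw [hG0, hD0]; simp [c, P]
      rw [h3]
      exact sub_mem (Ideal.mem_sup_left (hGI i 0))
        (Ideal.mem_sup_right (Ideal.mul_mem_right _ _ (Ideal.mem_span_singleton_self _)))
    exact h2 h1
  obtain ⟨L, hL⟩ := iter_main hp hΦ hI hP (by rw [hΦc, hx, map_pow]) (by rw [hΦc, hy, map_pow])
    hnzd (c w) (c U) (c a) (c b) n (by rw [hΦc, hw, map_pow]) hκ' e
  refine ⟨L, ?_⟩
  rw [htI, sup_right_comm] at hL
  obtain ⟨T, hT⟩ := exists_finset_sup_span hL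
  rw [sup_right_comm, heq3] at hT
  rw [← map_pow, ← map_pow, ← map_mul] at hT
  have := (triangular (fun s : Fin m × ℕ => s.2) hp.two_le α β hα hβ _ T).2 _ hT
  simpa only [Ideal.mem_comap, Polynomial.constantCoeff_apply, Polynomial.coeff_C_zero] using this

end P1fsec

section P3asec
theorem pow_mem_span_range {K L : Type*} [CommRing K] [CommRing L] [Algebra K L] {p : ℕ} [Fact p.Prime]
    [CharP L p] {ι : Type*} (f : ι → L) (l : ℕ) {z : L}
    (hz : z ∈ Submodule.span K (Set.range f)) :
    z ^ p ^ l ∈ Submodule.span K (Set.range fun i => f i ^ p ^ l) := by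
  induction hz using Submodule.span_induction with
  | mem x hx => obtain ⟨i, rfl⟩ := hx; exact Submodule.subset_span ⟨i, rfl⟩
  | zero => rw [zero_pow (pow_pos (Fact.out : p.Prime).pos _).ne']; exact zero_mem _
  | add x y _ _ hx hy => rw [add_pow_char_pow]; exact add_mem hx hy
  | smul a x _ hx => rw [smul_pow]; exact Submodule.smul_mem _ _ hx

theorem frob_basis (K L T : Type*) [Field K] [Field L] [Algebra K L] [CommRing T] [Algebra T L]
    (p : ℕ) [Fact p.Prime] [CharP L p]
    (hfin : (Submodule.span K (Set.range (algebraMap T L))).FG) :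
    ∃ (s : ℕ) (r : ℕ) (e : Fin r → T),
      (∀ l, LinearIndependent K (fun i => (algebraMap T L (e i) ^ p ^ s) ^ p ^ l)) ∧
      (∀ l z, algebraMap T L z ^ p ^ s ∈
        Submodule.span K (Set.range fun i => (algebraMap T L (e i) ^ p ^ s) ^ p ^ l)) := by
  classical
  let M : ℕ → Submodule K L := fun s => Submodule.span K (Set.range fun z : T => algebraMap T L z ^ p ^ s)
  have hM : ∀ s l, M (s + l) ≤ M s := by
    intro s l
    rw [Submodule.span_le]
    rintro _ ⟨z, rfl⟩
    refine Submodule.subset_span ⟨z ^ p ^ l, ?_⟩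
    simp only [map_pow]
    rw [← pow_mul, ← pow_add, add_comm]
  have hM0 : M 0 = Submodule.span K (Set.range (algebraMap T L)) := by simp [M]
  have hfd : ∀ s, FiniteDimensional K (M s) := by
    intro s
    have h0 : FiniteDimensional K (M 0) := by
      rw [hM0]; exact Module.Finite.iff_fg.2 hfin
    have := hM 0 s
    rw [zero_add] at this
    exact Submodule.finiteDimensional_of_le this
  obtain ⟨s, hs⟩ : ∃ s, ∀ s', Module.finrank K (M s) ≤ Module.finrank K (M s') :=
    ⟨Function.argmin (fun s => Module.finrank K (M s)), fun s' => Function.argmin_le (fun s => Module.finrank K (M s)) s'⟩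
  have hMs : ∀ l, M (s + l) = M s := by
    intro l
    have := hfd s
    exact Submodule.eq_of_le_of_finrank_le (hM s l) (hs _)
  obtain ⟨κ, a, ha, hspan, hli⟩ := exists_linearIndependent' K (fun z : T => algebraMap T L z ^ p ^ s)
  have hfd' : FiniteDimensional K (Submodule.span K (Set.range ((fun z : T => algebraMap T L z ^ p ^ s) ∘ a))) := by
    rw [hspan]; exact hfd s
  have hκ : Finite κ := by
    have := (Module.Basis.span hli)
    exact Module.Finite.finite_basis this
  cases nonempty_fintype κ
  let ee := Fintype.equivFin κ
  have hspan' : ∀ l, M s ≤ Submodule.span K (Set.range fun i : Fin (Fintype.card κ) =>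
      (algebraMap T L (a (ee.symm i)) ^ p ^ s) ^ p ^ l) := by
    intro l
    rw [← hMs l, Submodule.span_le]
    rintro _ ⟨z, rfl⟩
    have h1 : algebraMap T L z ^ p ^ s ∈ Submodule.span K (Set.range fun i : Fin (Fintype.card κ) =>
      (algebraMap T L (a (ee.symm i)) ^ p ^ s)) := by
      have h2 : algebraMap T L z ^ p ^ s ∈
          Submodule.span K (Set.range ((fun z : T => algebraMap T L z ^ p ^ s) ∘ a)) := by
        rw [hspan]; exact Submodule.subset_span ⟨z, rfl⟩
      refine Submodule.span_mono ?_ h2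
      rintro _ ⟨k, rfl⟩
      exact ⟨ee k, by simp⟩
    have := pow_mem_span_range _ l h1
    simp only [SetLike.mem_coe]
    rwa [pow_add, pow_mul]
  have hle : ∀ l, Submodule.span K (Set.range fun i : Fin (Fintype.card κ) =>
      (algebraMap T L (a (ee.symm i)) ^ p ^ s) ^ p ^ l) = M s := by
    intro l
    apply le_antisymm _ (hspan' l)
    rw [Submodule.span_le]
    rintro _ ⟨i, rfl⟩
    rw [← hMs l]
    refine Submodule.subset_span ⟨a (ee.symm i), ?_⟩
    simp only
    rw [← pow_mul, pow_add]
  refine ⟨s, Fintype.card κ, fun i => a (ee.symm i), fun l => ?_, fun l z => ?_⟩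
  · rw [linearIndependent_iff_card_le_finrank_span, Set.finrank, hle l, Fintype.card_fin]
    have h1 : Submodule.span K (Set.range ((fun z : T => algebraMap T L z ^ p ^ s) ∘ a)) = M s := hspan
    rw [← h1, finrank_span_eq_card hli]
  · exact hspan' l (Submodule.subset_span ⟨z, rfl⟩)

end P3asec

section P3bsec
theorem clear_denom {A K L : Type*} [CommRing A] [IsDomain A] [Field K] [Algebra A K] [IsFractionRing A K]
    [Field L] [Algebra K L] [Algebra A L] [IsScalarTower A K L] {r : ℕ} {ι : Type*} [Finite ι]
    (f : Fin r → L) (g : ι → L) (h : ∀ j, g j ∈ Submodule.span K (Set.range f)) :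
    ∃ c : A, c ≠ 0 ∧ ∀ j, c • g j ∈ Submodule.span A (Set.range f) := by
  simp only [Submodule.mem_span_range_iff_exists_fun] at h ⊢
  choose k hk using h
  obtain ⟨b, hb⟩ := IsLocalization.exist_integer_multiples_of_finite (nonZeroDivisors A)
    (fun z : ι × Fin r => k z.1 z.2)
  choose a ha using hb
  refine ⟨b, nonZeroDivisors.coe_ne_zero b, fun j => ⟨fun i => a (j, i), ?_⟩⟩
  rw [← hk j, Finset.smul_sum]
  refine Finset.sum_congr rfl fun i _ => ?_
  rw [← smul_assoc, ← ha (j, i), algebraMap_smul]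

/-- iterating `c e_i ∈ Σ A e_j^p` -/
theorem frob_iter {A L : Type*} [CommRing A] [CommRing L] [Algebra A L] {p : ℕ} [Fact p.Prime]
    [CharP L p] {r : ℕ} (f : Fin r → L) (c : A)
    (h : ∀ i, c • f i ∈ Submodule.span A (Set.range fun i => f i ^ p)) (l : ℕ) {z : L}
    (hz : z ∈ Submodule.span A (Set.range f)) :
    c ^ p ^ l • z ∈ Submodule.span A (Set.range fun i => f i ^ p ^ l) := by
  have key : ∀ l, ∃ N ≤ p ^ l, ∀ i, c ^ N • f i ∈ Submodule.span A (Set.range fun i => f i ^ p ^ l) := by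
    intro l
    induction l with
    | zero =>
      exact ⟨0, by simp, fun i => by
        simpa using (Submodule.subset_span (Set.mem_range_self i) : f i ∈ Submodule.span A (Set.range f))⟩
    | succ l ih =>
      obtain ⟨N, hN, hi⟩ := ih
      have h2 : ∀ i, c ^ p ^ l • f i ^ p ^ l ∈ Submodule.span A (Set.range fun i => f i ^ p ^ (l+1)) := by
        intro i
        have := pow_mem_span_range _ l (h i)
        rw [smul_pow] at this
        simpa only [pow_succ', pow_mul] using this
      have h3 : ∀ z ∈ Submodule.span A (Set.range fun i => f i ^ p ^ l),
          c ^ p ^ l • z ∈ Submodule.span A (Set.range fun i => f i ^ p ^ (l+1)) := by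
        intro z hz
        induction hz using Submodule.span_induction with
        | mem x hx => obtain ⟨i, rfl⟩ := hx; exact h2 i
        | zero => simp
        | add x y _ _ hx hy => rw [smul_add]; exact add_mem hx hy
        | smul a x _ hx => rw [smul_comm]; exact Submodule.smul_mem _ _ hx
      refine ⟨N + p ^ l, ?_, fun i => ?_⟩
      · have := (Fact.out : p.Prime).two_le
        rw [pow_succ]; nlinarith
      · rw [add_comm N, pow_add c, mul_smul]; exact h3 _ (hi i)
  obtain ⟨N, hN, hi⟩ := key l
  have hi' : ∀ i, c ^ p ^ l • f i ∈ Submodule.span A (Set.range fun i => f i ^ p ^ l) := by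
    intro i
    have : c ^ p ^ l = c ^ (p ^ l - N) * c ^ N := by rw [← pow_add]; congr 1; omega
    rw [this, mul_smul]; exact Submodule.smul_mem _ _ (hi i)
  induction hz using Submodule.span_induction with
  | mem x hx => obtain ⟨i, rfl⟩ := hx; exact hi' i
  | zero => simp
  | add x y _ _ hx hy => rw [smul_add]; exact add_mem hx hy
  | smul a x _ hx => rw [smul_comm]; exact Submodule.smul_mem _ _ hx

theorem frob_closure_aux {A T : Type*} (K L : Type*) [CommRing A] [IsDomain A] [CommRing T] [IsDomain T] [Algebra A T]
    [Module.Finite A T] [Field K] [Field L] [Algebra A K] [IsFractionRing A K] [Algebra T L]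
    [IsFractionRing T L] [Algebra K L] [Algebra A L] [IsScalarTower A K L] [IsScalarTower A T L]
    (p : ℕ) [Fact p.Prime] [CharP L p] (x y : A)
    (hxy : ∀ (a : A) (N l : ℕ), a ^ p ^ l ∈ Ideal.span {x ^ (N * p ^ l), y ^ (N * p ^ l)} →
      a ∈ Ideal.span {x ^ N, y ^ N}) :
    ∃ (s : ℕ) (c : A), c ≠ 0 ∧ ∀ (v : T) (N l : ℕ) (b b' : T),
      (v ^ p ^ s) ^ p ^ l = algebraMap A T x ^ (N * p ^ l) * b ^ p ^ s +
        algebraMap A T y ^ (N * p ^ l) * b' ^ p ^ s →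
      algebraMap A T c * v ^ p ^ s ∈ Ideal.span {algebraMap A T x ^ N, algebraMap A T y ^ N} := by
  classical
  obtain ⟨d, t, ht⟩ := Module.Finite.exists_fin (R := A) (M := T)
  have hT : ∀ z : T, algebraMap T L z ∈ Submodule.span A (Set.range fun j => algebraMap T L (t j)) := by
    intro z
    have : z ∈ Submodule.span A (Set.range t) := by rw [ht]; trivial
    have h2 := Submodule.mem_map_of_mem (f := (IsScalarTower.toAlgHom A T L).toLinearMap) this
    rw [Submodule.map_span, ← Set.range_comp] at h2
    exact h2
  have hKA : ∀ {ι : Type} (f : ι → L) z, z ∈ Submodule.span A (Set.range f) → z ∈ Submodule.span K (Set.range f) := by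
    intro ι f z hz
    exact Submodule.span_le_restrictScalars A K _ hz
  have hfin : (Submodule.span K (Set.range (algebraMap T L))).FG := by
    have : Submodule.span K (Set.range (algebraMap T L)) =
        Submodule.span K (Set.range fun j => algebraMap T L (t j)) := by
      apply le_antisymm
      · rw [Submodule.span_le]
        rintro _ ⟨z, rfl⟩
        exact hKA _ _ (hT z)
      · apply Submodule.span_mono
        rintro _ ⟨j, rfl⟩; exact ⟨_, rfl⟩
    rw [this]
    exact Submodule.fg_span (Set.finite_range _)
  obtain ⟨s, r, e, hli, hsp⟩ := frob_basis K L T p hfin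
  obtain ⟨f, hf⟩ : ∃ f : Fin r → L, f = fun i => algebraMap T L (e i) ^ p ^ s := ⟨_, rfl⟩
  have hfi : ∀ i, f i = algebraMap T L (e i) ^ p ^ s := fun i => by rw [hf]
  simp only [← hfi] at hli hsp
  -- constants
  obtain ⟨c0, hc0, hc0'⟩ := clear_denom (A := A) (K := K) f (fun j => algebraMap T L (t j) ^ p ^ s)
    (fun j => by simpa using hsp 0 (t j))
  obtain ⟨c1, hc1, hc1'⟩ := clear_denom (A := A) (K := K) (fun i => f i ^ p) f
    (fun j => by rw [hfi]; simpa using hsp 1 (e j))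
  have hc0T : ∀ z : T, c0 • (algebraMap T L z ^ p ^ s) ∈ Submodule.span A (Set.range f) := by
    intro z
    have h1 := pow_mem_span_range _ s (hT z)
    have h3 : ∀ z ∈ Submodule.span A (Set.range fun i => (algebraMap T L (t i)) ^ p ^ s),
          c0 • z ∈ Submodule.span A (Set.range f) := by
      intro z hz
      induction hz using Submodule.span_induction with
      | mem x hx => obtain ⟨i, rfl⟩ := hx; exact hc0' i
      | zero => simp
      | add x y _ _ hx hy => rw [smul_add]; exact add_mem hx hy
      | smul a x _ hx => rw [smul_comm]; exact Submodule.smul_mem _ _ hx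
    exact h3 _ h1
  have hcT : ∀ (l : ℕ) (z : T), (c0 * c1) ^ p ^ l • (algebraMap T L z ^ p ^ s) ∈
      Submodule.span A (Set.range fun i => f i ^ p ^ l) := by
    intro l z
    have h1 := frob_iter f c1 hc1' l (hc0T z)
    have h2 : (c0 * c1) ^ p ^ l = c0 ^ (p ^ l - 1) * (c1 ^ p ^ l * c0) := by
      have h3 : c0 ^ p ^ l = c0 ^ (p ^ l - 1) * c0 := by
        rw [← pow_succ]
        have := pow_pos (Fact.out : p.Prime).pos l
        congr 1; omega
      rw [mul_pow, h3]; ring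
    rw [h2, mul_smul, mul_smul]
    exact Submodule.smul_mem _ _ h1
  have hinjTL : Function.Injective (algebraMap T L) := IsFractionRing.injective T L
  refine ⟨s, c0 * c1, mul_ne_zero hc0 hc1, fun v N l b b' hv => ?_⟩
  obtain ⟨ν, hν⟩ := (Submodule.mem_span_range_iff_exists_fun A).1 (hc0T v)
  obtain ⟨β, hβ⟩ := (Submodule.mem_span_range_iff_exists_fun A).1 (hcT l b)
  obtain ⟨β', hβ'⟩ := (Submodule.mem_span_range_iff_exists_fun A).1 (hcT l b')
  have hν' : ∑ i, (c1 * ν i) • f i = (c0 * c1) • algebraMap T L v ^ p ^ s := by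
    rw [mul_comm c0 c1, mul_smul, ← hν, Finset.smul_sum]
    simp only [mul_smul]
  have hpow : ∑ i, ((c1 * ν i) ^ p ^ l) • f i ^ p ^ l =
      ∑ i, (x ^ (N * p ^ l) * β i + y ^ (N * p ^ l) * β' i) • f i ^ p ^ l := by
    have h1 : (∑ i, (c1 * ν i) • f i) ^ p ^ l = ∑ i, ((c1 * ν i) ^ p ^ l) • f i ^ p ^ l := by
      rw [sum_pow_char_pow]
      simp only [smul_pow]
    rw [← h1, hν', smul_pow, ← map_pow, ← map_pow, hv]
    simp only [add_smul, mul_smul, Finset.sum_add_distrib, ← Finset.smul_sum, hβ, hβ']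
    simp only [map_add, map_mul, map_pow, smul_add]
    rw [smul_comm, smul_comm (y ^ (N * p ^ l))]
    simp only [Algebra.smul_def, IsScalarTower.algebraMap_apply A T L, map_pow]
  have hcoef : ∀ i, (c1 * ν i) ^ p ^ l = x ^ (N * p ^ l) * β i + y ^ (N * p ^ l) * β' i := by
    have hliA : LinearIndependent A (fun i => f i ^ p ^ l) := by
      refine (hli l).restrict_scalars ?_
      intro a b hab
      have : algebraMap A K a = algebraMap A K b := by simpa [Algebra.smul_def] using hab
      exact IsFractionRing.injective A K this
    have h0 : ∑ i, ((c1 * ν i) ^ p ^ l - (x ^ (N * p ^ l) * β i + y ^ (N * p ^ l) * β' i)) • f i ^ p ^ l = 0 := by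
      simp only [sub_smul, Finset.sum_sub_distrib]
      rw [hpow, sub_self]
    intro i
    exact sub_eq_zero.1 (Fintype.linearIndependent_iff.1 hliA _ h0 i)
  have hmem : ∀ i, c1 * ν i ∈ Ideal.span {x ^ N, y ^ N} := by
    intro i
    apply hxy _ N l
    rw [hcoef]
    exact add_mem (Ideal.mul_mem_right _ _ (Ideal.subset_span (by simp)))
      (Ideal.mul_mem_right _ _ (Ideal.subset_span (by simp)))
  have hfinal : algebraMap A T (c0 * c1) * v ^ p ^ s = ∑ i, algebraMap A T (c1 * ν i) * e i ^ p ^ s := by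
    apply hinjTL
    rw [map_mul, map_sum, ← IsScalarTower.algebraMap_apply, ← Algebra.smul_def, map_pow, ← hν']
    refine Finset.sum_congr rfl fun i _ => ?_
    rw [map_mul, ← IsScalarTower.algebraMap_apply, ← Algebra.smul_def, map_pow, hfi]
  rw [hfinal]
  refine sum_mem fun i _ => Ideal.mul_mem_right _ _ ?_
  have := Ideal.mem_map_of_mem (algebraMap A T) (hmem i)
  rwa [Ideal.map_span, Set.image_insert_eq, Set.image_singleton, map_pow, map_pow] at this

theorem frob_closure {A T : Type*} [CommRing A] [IsDomain A] [CommRing T] [IsDomain T] [Algebra A T]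
    [Module.Finite A T] (hinj : Function.Injective (algebraMap A T))
    (p : ℕ) [hp : Fact p.Prime] [CharP T p] (x y : A) (hx0 : x ≠ 0)
    (hxy : ∀ (a : A) (N l : ℕ), a ^ p ^ l ∈ Ideal.span {x ^ (N * p ^ l), y ^ (N * p ^ l)} →
      a ∈ Ideal.span {x ^ N, y ^ N}) (g u : T) (hg : g ≠ 0)
    (h : ∀ e, ∃ l, g ^ p ^ l * u ^ p ^ (e + l) ∈
      Ideal.span {algebraMap A T x ^ p ^ (e + l), algebraMap A T y ^ p ^ (e + l)}) :
    ∃ c : T, c ≠ 0 ∧ ∀ e, c * u ^ p ^ e ∈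
      Ideal.span {algebraMap A T x ^ p ^ e, algebraMap A T y ^ p ^ e} := by
  have : FaithfulSMul A T := (faithfulSMul_iff_algebraMap_injective A T).2 hinj
  let K := FractionRing A
  let L := FractionRing T
  have : FaithfulSMul A L := by
    rw [faithfulSMul_iff_algebraMap_injective, IsScalarTower.algebraMap_eq A T L]
    exact (IsFractionRing.injective T L).comp hinj
  letI : Algebra K L := FractionRing.liftAlgebra A L
  have : CharP L p := charP_of_injective_algebraMap (IsFractionRing.injective T L) p
  obtain ⟨s, c, hc, H⟩ := frob_closure_aux (A := A) (T := T) K L p x y hxy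
  have hcT : algebraMap A T c ≠ 0 := fun h => hc (hinj (by rw [h, map_zero]))
  have hxT : algebraMap A T x ≠ 0 := fun h => hx0 (hinj (by rw [h, map_zero]))
  refine ⟨algebraMap A T c * g ^ p ^ s * algebraMap A T x ^ p ^ s,
    mul_ne_zero (mul_ne_zero hcT (pow_ne_zero _ hg)) (pow_ne_zero _ hxT), fun e => ?_⟩
  rcases Nat.lt_or_ge e s with hes | hes
  · have h1 : algebraMap A T x ^ p ^ s ∈
        Ideal.span {algebraMap A T x ^ p ^ e, algebraMap A T y ^ p ^ e} := by
      refine Ideal.mem_of_dvd _ (pow_dvd_pow _ (Nat.pow_le_pow_right hp.out.pos hes.le)) ?_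
      exact Ideal.subset_span (by simp)
    exact Ideal.mul_mem_right _ _ (Ideal.mul_mem_left _ _ h1)
  · obtain ⟨e, rfl⟩ := Nat.exists_eq_add_of_le hes
    obtain ⟨l, hl⟩ := h e
    obtain ⟨b, b', hb⟩ := Ideal.mem_span_pair.1 hl
    have h2 := H (g * u ^ p ^ e) (p ^ (s + e)) l b b' (by
      have h3 : ((g * u ^ p ^ e) ^ p ^ s) ^ p ^ l = (g ^ p ^ l * u ^ p ^ (e + l)) ^ p ^ s := by
        ring
      rw [h3, ← hb, add_pow_char_pow]
      ring)
    have h4 : algebraMap A T c * g ^ p ^ s * algebraMap A T x ^ p ^ s * u ^ p ^ (s + e) =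
        algebraMap A T x ^ p ^ s * (algebraMap A T c * (g * u ^ p ^ e) ^ p ^ s) := by
      ring
    rw [h4]
    exact Ideal.mul_mem_left _ _ h2

/-- descent along a finite extension of domains -/
theorem descend_finite {A T : Type*} [CommRing A] [IsDomain A] [CommRing T] [IsDomain T] [Algebra A T]
    [Module.Finite A T] (hinj : Function.Injective (algebraMap A T)) (x y u : A) (p : ℕ)
    (h : ∃ c : T, c ≠ 0 ∧ ∀ e, c * algebraMap A T u ^ p ^ e ∈
      Ideal.span {algebraMap A T x ^ p ^ e, algebraMap A T y ^ p ^ e}) :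
    ∃ c : A, c ≠ 0 ∧ ∀ e, c * u ^ p ^ e ∈ Ideal.span {x ^ p ^ e, y ^ p ^ e} := by
  obtain ⟨c, hc, H⟩ := h
  have : FaithfulSMul A T := (faithfulSMul_iff_algebraMap_injective A T).2 hinj
  -- a multiple in A
  obtain ⟨d, hd, hcd⟩ : ∃ d : A, d ≠ 0 ∧ algebraMap A T d ∈ Ideal.span {c} := by
    have h1 := Ideal.comap_ne_bot_of_integral_mem (R := A) hc (Ideal.mem_span_singleton_self c)
      (Algebra.IsIntegral.isIntegral c)
    obtain ⟨d, hd, hd0⟩ := Submodule.exists_mem_ne_zero_of_ne_bot h1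
    exact ⟨d, hd0, hd⟩
  -- a functional
  obtain ⟨f, hf⟩ : ∃ f : T →ₗ[A] A, f 1 ≠ 0 := by
    let K := FractionRing A
    let L := FractionRing T
    have : FaithfulSMul A L := by
      rw [faithfulSMul_iff_algebraMap_injective, IsScalarTower.algebraMap_eq A T L]
      exact (IsFractionRing.injective T L).comp hinj
    letI : Algebra K L := FractionRing.liftAlgebra A L
    obtain ⟨F, hF⟩ : ∃ F : L →ₗ[K] K, F 1 = 1 := by
      obtain ⟨F, hF⟩ := LinearMap.exists_leftInverse_of_injective (LinearMap.toSpanSingleton K L 1)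
        (LinearMap.ker_eq_bot.2 (by
          intro a b hab
          simpa [Algebra.smul_def] using hab))
      refine ⟨F, ?_⟩
      have := LinearMap.congr_fun hF 1
      simpa using this
    obtain ⟨n, t, ht⟩ := Module.Finite.exists_fin (R := A) (M := T)
    obtain ⟨b, hb⟩ := IsLocalization.exist_integer_multiples_of_finite (nonZeroDivisors A)
      (fun i => F (algebraMap T L (t i)))
    let F' : T →ₗ[A] K := (b : A) • (F.restrictScalars A).comp (IsScalarTower.toAlgHom A T L).toLinearMap
    have hF' : ∀ z, F' z ∈ LinearMap.range (Algebra.linearMap A K) := by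
      intro z
      have hz : z ∈ Submodule.span A (Set.range t) := by rw [ht]; trivial
      induction hz using Submodule.span_induction with
      | mem x hx => obtain ⟨i, rfl⟩ := hx; obtain ⟨a, ha⟩ := hb i; exact ⟨a, ha⟩
      | zero => rw [map_zero]; exact zero_mem _
      | add x y _ _ hx hy => rw [map_add]; exact add_mem hx hy
      | smul a x _ hx => rw [map_smul]; exact Submodule.smul_mem _ _ hx
    have hinjK : Function.Injective (Algebra.linearMap A K) := IsFractionRing.injective A K
    let E := LinearEquiv.ofInjective (Algebra.linearMap A K) hinjK
    refine ⟨E.symm.toLinearMap.comp (F'.codRestrict _ hF'), ?_⟩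
    intro h0
    have h1 : F' 1 = 0 := by
      have h2 : E.symm (F'.codRestrict _ hF' 1) = 0 := h0
      rw [LinearEquiv.map_eq_zero_iff] at h2
      exact congrArg Subtype.val h2
    have h3 : F' 1 = algebraMap A K b := by
      simp [F', hF, Algebra.smul_def]
    rw [h3] at h1
    exact nonZeroDivisors.coe_ne_zero b (hinjK (by simpa using h1))
  refine ⟨d * f 1, mul_ne_zero hd hf, fun e => ?_⟩
  have h1 : algebraMap A T (d * u ^ p ^ e) ∈ Ideal.span {algebraMap A T x ^ p ^ e, algebraMap A T y ^ p ^ e} := by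
    obtain ⟨z, hz⟩ := Ideal.mem_span_singleton'.1 hcd
    rw [map_mul, ← hz, map_pow, mul_assoc]
    exact Ideal.mul_mem_left _ _ (H e)
  obtain ⟨a, b, hab⟩ := Ideal.mem_span_pair.1 h1
  have h2 : (d * u ^ p ^ e) • (1 : T) = x ^ p ^ e • a + y ^ p ^ e • b := by
    simp only [Algebra.smul_def, mul_one, ← hab, map_pow]; ring
  have h3 := congrArg f h2
  rw [map_smul, map_add, map_smul, map_smul, smul_eq_mul, smul_eq_mul, smul_eq_mul] at h3
  have h4 : d * f 1 * u ^ p ^ e = x ^ p ^ e * f a + y ^ p ^ e * f b := by rw [← h3]; ring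
  rw [h4]
  exact add_mem (Ideal.mul_mem_right _ _ (Ideal.subset_span (by simp)))
      (Ideal.mul_mem_right _ _ (Ideal.subset_span (by simp)))

end P3bsec

section P2asec
open IsLocalRing in
theorem exists_gens_mod_sq {N : Type*} [CommRing N] [IsLocalRing N] [IsNoetherianRing N] {m : ℕ}
    (hm : (maximalIdeal N).spanFinrank ≤ m + 1) (J : Set N) (hJ0 : (0 : N) ∈ J)
    (hJ : J ⊆ maximalIdeal N)
    (hne : ¬ maximalIdeal N ≤ Ideal.span J ⊔ maximalIdeal N ^ 2) :
    ∃ h : Fin m → N, (∀ i, h i ∈ J) ∧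
      Ideal.span J ≤ Ideal.span (Set.range h) ⊔ maximalIdeal N ^ 2 := by
  classical
  let s : Set (CotangentSpace N) := {c | ∃ (j : N) (hj : j ∈ J), c = (maximalIdeal N).toCotangent ⟨j, hJ hj⟩}
  -- membership
  have key : ∀ (J' : Set N) (hJ' : J' ⊆ maximalIdeal N) (z : maximalIdeal N),
      (maximalIdeal N).toCotangent z ∈ Submodule.span (ResidueField N)
        {c | ∃ (j : N) (hj : j ∈ J'), c = (maximalIdeal N).toCotangent ⟨j, hJ' hj⟩} →
      (z : N) ∈ Ideal.span J' ⊔ maximalIdeal N ^ 2 := by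
    intro J' hJ' z hz
    have h1 : (maximalIdeal N).toCotangent z ∈ Submodule.span N
        {c | ∃ (j : N) (hj : j ∈ J'), c = (maximalIdeal N).toCotangent ⟨j, hJ' hj⟩} := by
      rw [← Submodule.restrictScalars_span N (ResidueField N) IsLocalRing.residue_surjective]
      exact hz
    have h2 : {c | ∃ (j : N) (hj : j ∈ J'), c = (maximalIdeal N).toCotangent ⟨j, hJ' hj⟩} =
        (maximalIdeal N).toCotangent '' {z | (z : N) ∈ J'} := by
      ext c
      constructor
      · rintro ⟨j, hj, rfl⟩; exact ⟨⟨j, hJ' hj⟩, hj, rfl⟩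
      · rintro ⟨z, hz, rfl⟩; exact ⟨z, hz, rfl⟩
    rw [h2, ← Submodule.map_span] at h1
    obtain ⟨w, hw, hwz⟩ := h1
    rw [Ideal.toCotangent_eq] at hwz
    have hw' : (w : N) ∈ Ideal.span J' := by
      have h3 := Submodule.mem_map_of_mem (f := (maximalIdeal N).subtype) hw
      rw [Submodule.map_span] at h3
      refine Submodule.span_mono ?_ h3
      rintro _ ⟨z, hz, rfl⟩; exact hz
    have : (z : N) = w - (w - z) := by ring
    rw [this]
    exact sub_mem (Ideal.mem_sup_left hw') (Ideal.mem_sup_right hwz)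
  have hW : Submodule.span (ResidueField N) s ≠ ⊤ := by
    intro htop
    apply hne
    intro z hz
    exact key J hJ ⟨z, hz⟩ (by
      change _ ∈ Submodule.span (ResidueField N) s
      rw [htop]; trivial)
  have hdim : Module.finrank (ResidueField N) (Submodule.span (ResidueField N) s) ≤ m := by
    have h1 := Submodule.finrank_lt hW
    rw [← spanFinrank_maximalIdeal_eq_finrank_cotangentSpace] at h1
    omega
  obtain ⟨f, hfs, hfspan, -⟩ := Submodule.exists_fun_fin_finrank_span_eq (ResidueField N) s
  choose j hj hjf using hfs
  let h : Fin m → N := fun i => if hi : i.1 < Module.finrank (ResidueField N)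
    (Submodule.span (ResidueField N) s) then j ⟨i, hi⟩ else 0
  have hh : ∀ i, h i ∈ J := by
    intro i
    simp only [h]
    split_ifs with hi
    · exact hj _
    · exact hJ0
  refine ⟨h, hh, ?_⟩
  rw [Ideal.span_le]
  intro z hz
  have hhJ : Set.range h ⊆ maximalIdeal N := by rintro _ ⟨i, rfl⟩; exact hJ (hh i)
  refine key (Set.range h) hhJ ⟨z, hJ hz⟩ ?_
  have h1 : (maximalIdeal N).toCotangent ⟨z, hJ hz⟩ ∈ Submodule.span (ResidueField N) s :=
    Submodule.subset_span ⟨z, hz, rfl⟩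
  rw [← hfspan] at h1
  refine Submodule.span_mono ?_ h1
  rintro _ ⟨i, rfl⟩
  refine ⟨j i, ⟨⟨i, i.2.trans_le hdim⟩, ?_⟩, hjf i⟩
  simp [h]

open IsLocalRing in
theorem ker_eq_span {N O : Type*} [CommRing N] [IsLocalRing N] [IsNoetherianRing N] [CommRing O]
    [IsDomain O] [IsDiscreteValuationRing O] (θ : N →+* O) (hθ : Function.Surjective θ)
    (I : Ideal N) (hI : I ≤ RingHom.ker θ) (hker : RingHom.ker θ ≤ I ⊔ maximalIdeal N ^ 2) :
    RingHom.ker θ ≤ I := by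
  have hloc : IsLocalHom θ := hθ.isLocalHom
  obtain ⟨ϖ, hϖ⟩ := IsDiscreteValuationRing.exists_irreducible O
  obtain ⟨w, rfl⟩ := hθ ϖ
  have hmax : ∀ z ∈ maximalIdeal N, ∃ t, z - w * t ∈ RingHom.ker θ := by
    intro z hz
    have h1 : θ z ∈ maximalIdeal O := by
      rw [mem_maximalIdeal, mem_nonunits_iff] at hz ⊢
      exact fun h => hz (isUnit_of_map_unit θ z h)
    rw [hϖ.maximalIdeal_eq, Ideal.mem_span_singleton'] at h1
    obtain ⟨a, ha⟩ := h1
    obtain ⟨t, rfl⟩ := hθ a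
    exact ⟨t, by rw [RingHom.mem_ker, map_sub, map_mul, ← ha]; ring⟩
  have hw : w ∈ maximalIdeal N := by
    rw [mem_maximalIdeal, mem_nonunits_iff]
    exact fun h => hϖ.not_isUnit (h.map θ)
  have hjac : maximalIdeal N ≤ Ideal.jacobson ⊥ := (IsLocalRing.jacobson_eq_maximalIdeal ⊥ bot_ne_top).ge
  have h𝔫 : maximalIdeal N ≤ I ⊔ Ideal.span {w} := by
    apply Submodule.le_of_le_smul_of_le_jacobson_bot (IsNoetherian.noetherian _) hjac
    intro z hz
    obtain ⟨t, ht⟩ := hmax z hz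
    have h1 := hker ht
    rw [pow_two] at h1
    have h2 : I ⊔ maximalIdeal N * maximalIdeal N ≤ I ⊔ Ideal.span {w} ⊔ maximalIdeal N • maximalIdeal N :=
      sup_le_sup le_sup_left le_rfl
    have : z = (z - w * t) + w * t := by ring
    rw [this]
    exact add_mem (h2 h1) (Ideal.mem_sup_left (Ideal.mem_sup_right
      (Ideal.mul_mem_right _ _ (Ideal.mem_span_singleton_self w))))
  apply Submodule.le_of_le_smul_of_le_jacobson_bot (IsNoetherian.noetherian _) hjac
  intro z hz
  have hz𝔫 : z ∈ maximalIdeal N := by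
    rw [mem_maximalIdeal, mem_nonunits_iff]
    intro h
    have := h.map θ
    rw [RingHom.mem_ker.1 hz] at this
    exact not_isUnit_zero this
  obtain ⟨i, hi, t', ht', rfl⟩ := Submodule.mem_sup.1 (h𝔫 hz𝔫)
  obtain ⟨t, rfl⟩ := Ideal.mem_span_singleton'.1 ht'
  have h0 : θ t = 0 := by
    have h1 := RingHom.mem_ker.1 hz
    rw [map_add, RingHom.mem_ker.1 (hI hi), zero_add, map_mul] at h1
    exact (mul_eq_zero.1 h1).resolve_right hϖ.ne_zero
  refine add_mem (Ideal.mem_sup_left hi) (Ideal.mem_sup_right ?_)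
  rw [mul_comm]
  exact Submodule.smul_mem_smul hw h0

open IsLocalRing in
/-- local selection of a complete intersection -/
theorem local_lci {N O : Type*} [CommRing N] [IsLocalRing N] [IsNoetherianRing N] [CommRing O]
    [IsDomain O] [IsDiscreteValuationRing O] (θ : N →+* O) (hθ : Function.Surjective θ)
    {m : ℕ} (hm : (maximalIdeal N).spanFinrank ≤ m + 1) (J : Set N) (hJ0 : (0 : N) ∈ J)
    (hJ : Ideal.span J = RingHom.ker θ) (x : N) (hx : IsUnit x) (f : Fin m → N)
    (hf : ∀ i, f i ∈ RingHom.ker θ) :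
    ∃ h : Fin m → N, (∀ i, h i ∈ J) ∧
      RingHom.ker θ ≤ Ideal.span (Set.range fun i => f i ^ 2 + x * h i) := by
  have hloc : IsLocalHom θ := hθ.isLocalHom
  have hker : RingHom.ker θ ≤ maximalIdeal N := IsLocalRing.le_maximalIdeal (RingHom.ker_ne_top θ)
  obtain ⟨h, hhJ, hh⟩ := exists_gens_mod_sq hm J hJ0
    (fun z hz => hker (hJ ▸ Ideal.subset_span hz)) (by
      intro hle
      obtain ⟨ϖ, hϖ⟩ := IsDiscreteValuationRing.exists_irreducible O
      obtain ⟨w, rfl⟩ := hθ ϖ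
      have hw : w ∈ maximalIdeal N := by
        rw [mem_maximalIdeal, mem_nonunits_iff]
        exact fun h => hϖ.not_isUnit (h.map θ)
      have h1 := hle hw
      rw [hJ] at h1
      obtain ⟨a, ha, b, hb, hab⟩ := Submodule.mem_sup.1 h1
      have h2 : θ b ∈ maximalIdeal O ^ 2 := by
        have h3 : (maximalIdeal N ^ 2).map θ ≤ maximalIdeal O ^ 2 := by
          rw [Ideal.map_pow]
          exact Ideal.pow_right_mono (((IsLocalRing.local_hom_TFAE θ).out 0 2).1 hloc) 2
        exact h3 (Ideal.mem_map_of_mem _ hb)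
      have h3 : θ w = θ b := by rw [← hab, map_add, RingHom.mem_ker.1 ha, zero_add]
      rw [← h3, hϖ.maximalIdeal_eq, Ideal.span_singleton_pow, Ideal.mem_span_singleton] at h2
      obtain ⟨t, ht⟩ := h2
      have h4 : θ w * (1 - θ w * t) = 0 := by rw [mul_sub, mul_one, ← mul_assoc, ← pow_two, ← ht, sub_self]
      have h5 := (mul_eq_zero.1 h4).resolve_left hϖ.ne_zero
      exact hϖ.not_isUnit (IsUnit.of_mul_eq_one t (sub_eq_zero.1 h5).symm))
  refine ⟨h, hhJ, ?_⟩
  have hhk : ∀ i, h i ∈ RingHom.ker θ := fun i => hJ ▸ Ideal.subset_span (hhJ i)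
  apply ker_eq_span θ hθ
  · rw [Ideal.span_le]
    rintro _ ⟨i, rfl⟩
    exact add_mem (Ideal.pow_mem_of_mem _ (hf i) _ two_pos) (Ideal.mul_mem_left _ _ (hhk i))
  · rw [← hJ]
    refine hh.trans (sup_le ?_ le_sup_right)
    rw [Ideal.span_le]
    rintro _ ⟨i, rfl⟩
    obtain ⟨v, hv⟩ := hx.exists_left_inv
    have : h i = v * (f i ^ 2 + x * h i) - v * f i ^ 2 := by
      have : v * (f i ^ 2 + x * h i) - v * f i ^ 2 = (v * x) * h i := by ring
      rw [this, hv, one_mul]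
    rw [this]
    exact sub_mem (Ideal.mem_sup_left (Ideal.mul_mem_left _ _ (Ideal.subset_span ⟨i, rfl⟩)))
      (Ideal.mem_sup_right (Ideal.mul_mem_left _ _ (Ideal.pow_mem_pow (hker (hf i)) 2)))

end P2asec

section P2bsec
open IsLocalRing

theorem dvr_atPrime_span {A : Type*} [CommRing A] [IsDomain A] [IsNoetherianRing A] {q : A}
    (hq : Prime q) (Q : Ideal A) [Q.IsPrime] (hQ : Q = Ideal.span {q}) :
    IsDiscreteValuationRing (Localization.AtPrime Q) := by
  have h1 : maximalIdeal (Localization.AtPrime Q) = Ideal.span {algebraMap A _ q} := by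
    rw [← Localization.AtPrime.map_eq_maximalIdeal]
    have : Q.map (algebraMap A (Localization.AtPrime Q)) =
        (Ideal.span {q}).map (algebraMap A (Localization.AtPrime Q)) := congrArg _ hQ
    rw [this, Ideal.map_span, Set.image_singleton]
  have hp : (maximalIdeal (Localization.AtPrime Q)).IsPrincipal := ⟨_, h1⟩
  have hne : maximalIdeal (Localization.AtPrime Q) ≠ ⊥ := by
    rw [h1, Ne, Ideal.span_singleton_eq_bot]
    intro h
    have := (IsLocalization.injective (Localization.AtPrime Q) Q.primeCompl_le_nonZeroDivisors)
      (h.trans (map_zero _).symm)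
    exact hq.ne_zero this
  have hf : ¬ IsField (Localization.AtPrime Q) := by
    intro h
    exact hne (IsLocalRing.isField_iff_maximalIdeal_eq.mp h)
  exact ((IsDiscreteValuationRing.TFAE (Localization.AtPrime Q) hf).out 0 4).mpr hp

attribute [local instance] MvPolynomial.algebraMvPolynomial in
theorem spanFinrank_atPrime {A : Type*} [CommRing A] [IsDomain A] [IsNoetherianRing A] {q : A}
    (hq : Prime q) {m : ℕ} (P : Ideal (MvPolynomial (Fin m) A)) [P.IsPrime]
    (hP : P.comap MvPolynomial.C = Ideal.span {q}) :
    (maximalIdeal (Localization.AtPrime P)).spanFinrank ≤ m + 1 := by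
  obtain ⟨Q, hQ⟩ : ∃ Q : Ideal A, Q = P.comap MvPolynomial.C := ⟨_, rfl⟩
  have hQp : Q.IsPrime := by rw [hQ]; infer_instance
  have := dvr_atPrime_span hq Q (hQ.trans hP)
  have disj : Disjoint ((Q.primeCompl.map (MvPolynomial.C (σ := Fin m)) :
      Submonoid (MvPolynomial (Fin m) A)) : Set _) (P : Set (MvPolynomial (Fin m) A)) := by
    rw [Set.disjoint_left]
    rintro _ ⟨a, ha, rfl⟩ h
    apply ha
    rw [hQ]; exact h
  have hloc := MvPolynomial.isLocalization (σ := Fin m) Q.primeCompl (Localization.AtPrime Q)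
  obtain ⟨pS, hpS⟩ : ∃ pS, pS = P.map (algebraMap (MvPolynomial (Fin m) A)
    (MvPolynomial (Fin m) (Localization.AtPrime Q))) := ⟨_, rfl⟩
  have h1 : pS.IsPrime := by
    rw [hpS]
    exact IsLocalization.isPrime_of_isPrime_disjoint _ _ _ ‹_› disj
  have h2 : IsLocalization.AtPrime (Localization.AtPrime pS) P := by
    convert IsLocalization.isLocalization_isLocalization_atPrime_isLocalization
      (Q.primeCompl.map (MvPolynomial.C (σ := Fin m))) (Localization.AtPrime pS) pS
    rw [hpS]
    exact (IsLocalization.under_map_of_isPrime_disjoint _ _ ‹_› disj).symm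
  have h3 : IsRegularLocalRing (Localization.AtPrime pS) := inferInstance
  have h4 : IsRegularLocalRing (Localization.AtPrime P) :=
    IsRegularLocalRing.of_ringEquiv (R := Localization.AtPrime pS) (IsLocalization.algEquiv P.primeCompl
    (Localization.AtPrime pS) (Localization.AtPrime P)).toRingEquiv
  have h5 := IsRegularLocalRing.spanFinrank_maximalIdeal (R := Localization.AtPrime P)
  have h6 : ringKrullDim (Localization.AtPrime P) = ringKrullDim (Localization.AtPrime pS) :=
    ringKrullDim_eq_of_ringEquiv (IsLocalization.algEquiv P.primeCompl
    (Localization.AtPrime P) (Localization.AtPrime pS)).toRingEquiv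
  have h8 := IsLocalization.AtPrime.ringKrullDim_eq_height pS (Localization.AtPrime pS)
  replace h5 := h5.trans (h6.trans h8)
  have h7 := Ideal.height_le_ringKrullDim_of_ne_top h1.ne_top
  rw [← h5, MvPolynomial.ringKrullDim_of_isNoetherianRing,
    IsDiscreteValuationRing.ringKrullDim_eq_one] at h7
  rw [Nat.card_eq_fintype_card, Fintype.card_fin] at h7
  rw [add_comm]
  exact_mod_cast h7

end P2bsec

section P2csec
open IsLocalRing MvPolynomial

theorem global_lci {A T : Type*} [CommRing A] [IsDomain A] [IsNoetherianRing A] {q : A}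
    (hq : Prime q) [CommRing T] [IsDomain T] [Algebra A T] {m : ℕ} (z : Fin m → T)
    (hz : Function.Surjective (aeval z : MvPolynomial (Fin m) A →ₐ[A] T))
    (Q : Ideal T) [Q.IsPrime] (hQ : Q.comap (algebraMap A T) = Ideal.span {q})
    (hdvr : IsDiscreteValuationRing (Localization.AtPrime Q))
    (x : A) (hx : x ∉ Ideal.span {q}) (f : Fin m → MvPolynomial (Fin m) A)
    (hf : ∀ i, aeval z (f i) = 0) :
    ∃ H : Fin m → MvPolynomial (Fin m) A, (∀ i, aeval z (H i) = 0) ∧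
      ∀ κ : MvPolynomial (Fin m) A, aeval z κ = 0 → ∃ g, aeval z g ∉ Q ∧
        g * κ ∈ Ideal.span (Set.range fun i => f i ^ 2 + C x * H i) := by
  obtain ⟨P, hP⟩ : ∃ P, P = Q.comap (aeval z : MvPolynomial (Fin m) A →ₐ[A] T).toRingHom := ⟨_, rfl⟩
  have hPp : P.IsPrime := by rw [hP]; infer_instance
  have hPq : P.comap (C : A →+* MvPolynomial (Fin m) A) = Ideal.span {q} := by
    rw [← hQ, hP, Ideal.comap_comap]
    congr 1
    ext a
    simp
  have hm := spanFinrank_atPrime hq P hPq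
  let θ := Localization.localRingHom P Q (aeval z : MvPolynomial (Fin m) A →ₐ[A] T).toRingHom hP
  have hθa : ∀ a, θ (algebraMap _ _ a) = algebraMap T _ (aeval z a) := fun a =>
    Localization.localRingHom_to_map _ _ _ _ _
  have hθ : Function.Surjective θ := by
    intro n
    obtain ⟨⟨a, s⟩, hs⟩ := IsLocalization.surj Q.primeCompl n
    obtain ⟨a', rfl⟩ := hz a
    obtain ⟨s', hs'⟩ := hz s
    have hsP : s' ∈ P.primeCompl := by
      intro h
      apply s.2
      rw [← hs']
      rw [hP] at h
      exact h
    refine ⟨IsLocalization.mk' _ a' ⟨s', hsP⟩, ?_⟩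
    have h1 : n * algebraMap _ _ (aeval z s') = algebraMap _ _ (aeval z a') := by
      rw [hs']; exact hs
    have h2 : θ (IsLocalization.mk' _ a' ⟨s', hsP⟩) * θ (algebraMap _ _ s') =
        θ (algebraMap _ _ a') := by
      rw [← map_mul]
      congr 1
      exact IsLocalization.mk'_spec _ a' ⟨s', hsP⟩
    rw [hθa, hθa, ← h1] at h2
    refine (IsUnit.mul_left_inj ?_).mp h2
    rw [hs']
    exact IsLocalization.map_units _ s
  have hinj := (IsLocalization.injective (Localization.AtPrime Q) Q.primeCompl_le_nonZeroDivisors)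
  have hker : ∀ a : MvPolynomial (Fin m) A, θ (algebraMap _ _ a) = 0 ↔ aeval z a = 0 := by
    intro a
    rw [hθa]
    constructor
    · intro h; exact hinj (h.trans (map_zero _).symm)
    · intro h; rw [h, map_zero]
  let J : Set (Localization.AtPrime P) := algebraMap _ _ '' {κ : MvPolynomial (Fin m) A | aeval z κ = 0}
  have hJ : Ideal.span J = RingHom.ker θ := by
    apply le_antisymm
    · rw [Ideal.span_le]
      rintro _ ⟨κ, hκ, rfl⟩
      exact (hker κ).mpr hκ
    · intro n hn
      obtain ⟨⟨a, s⟩, hs⟩ := IsLocalization.surj P.primeCompl n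
      have hs' : n * algebraMap _ _ (s : MvPolynomial (Fin m) A) = algebraMap _ _ a := hs
      have : algebraMap _ (Localization.AtPrime P) a ∈ Ideal.span J := by
        apply Ideal.subset_span
        refine ⟨a, ?_, rfl⟩
        apply (hker a).mp
        rw [← hs', map_mul, (RingHom.mem_ker).mp hn, zero_mul]
      rw [← hs'] at this
      exact (Ideal.mul_unit_mem_iff_mem _ (IsLocalization.map_units _ s)).mp this
  have hxu : IsUnit (algebraMap (MvPolynomial (Fin m) A) (Localization.AtPrime P) (C x)) := by
    apply IsLocalization.map_units _ (⟨C x, ?_⟩ : P.primeCompl)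
    intro h
    apply hx
    rw [← hPq]; exact h
  obtain ⟨h, hh, hle⟩ := local_lci θ hθ hm J ⟨0, by simp, by simp⟩ hJ _ hxu
    (fun i => algebraMap _ _ (f i)) (fun i => (hker _).mpr (hf i))
  choose H hH hHh using hh
  refine ⟨H, hH, fun κ hκ => ?_⟩
  have h1 : algebraMap _ (Localization.AtPrime P) κ ∈
      (Ideal.span (Set.range fun i => f i ^ 2 + C x * H i)).map (algebraMap _ _) := by
    rw [Ideal.map_span, ← Set.range_comp]
    have h2 := hle ((hker κ).mpr hκ)
    have h3 : (algebraMap _ (Localization.AtPrime P) ∘ fun i => f i ^ 2 + C x * H i) =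
        fun i => (algebraMap (MvPolynomial (Fin m) A) (Localization.AtPrime P) (f i)) ^ 2 +
          algebraMap (MvPolynomial (Fin m) A) (Localization.AtPrime P) (C x) * h i := by
      funext i
      rw [← hHh i]
      simp only [Function.comp, map_add, map_mul, map_pow]
    rw [h3]
    exact h2
  obtain ⟨g, hg, hgκ⟩ := (IsLocalization.algebraMap_mem_map_algebraMap_iff P.primeCompl _ _ _).mp h1
  refine ⟨g, fun h => hg ?_, hgκ⟩
  rw [hP]; exact h

end P2csec

section P2dsec
open MvPolynomial

theorem mvMonic2 {σ S : Type*} [CommRing S] (s : σ)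
    (h : Polynomial (MvPolynomial {t // t ≠ s} S)) (hh : h.Monic)
    (Γ : Set (MvPolynomial σ S)) (hΓ : ∀ γ ∈ Γ, γ ∈ supported S ({s}ᶜ : Set σ)) :
    Nzd (h.eval₂ (rename (R := S) (Subtype.val : {t // t ≠ s} → σ)).toRingHom (X s))
      (Ideal.span Γ) := by
  obtain ⟨e, heX, hed⟩ := exists_equiv_poly (S := S) s
  set ψ : MvPolynomial {t // t ≠ s} S →ₐ[S] MvPolynomial σ S := rename Subtype.val with hψ
  have hΓ' : Γ = ψ '' (ψ ⁻¹' Γ) := by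
    apply Set.Subset.antisymm
    · intro γ hγ
      obtain ⟨d, hd⟩ := supported_eq_rename s (hΓ γ hγ)
      exact ⟨d, by rw [Set.mem_preimage, hψ, hd]; exact hγ, hd⟩
    · exact Set.image_preimage_subset _ _
  set 𝔡 := Ideal.span (ψ ⁻¹' Γ) with h𝔡
  have hmap : (Ideal.span Γ).map e.toRingHom = 𝔡.map Polynomial.C := by
    rw [hΓ', Ideal.map_span, Ideal.map_span]
    congr 1
    ext z
    simp only [Set.mem_image, exists_exists_and_eq_and]
    constructor
    · rintro ⟨d, hd, rfl⟩; exact ⟨d, hd, (hed d).symm⟩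
    · rintro ⟨d, hd, rfl⟩; exact ⟨d, hd, (hed d)⟩
  have heG : e.toRingHom (h.eval₂ ψ.toRingHom (X s)) = h := by
    rw [Polynomial.hom_eval₂]
    have h1 : e.toRingHom.comp ψ.toRingHom = Polynomial.C := by
      exact RingHom.ext fun d => hed d
    have h2 : e.toRingHom (X s) = Polynomial.X := heX
    rw [h1, h2, Polynomial.eval₂_C_X]
  have h3 : Nzd (e.toRingHom (h.eval₂ ψ.toRingHom (X s))) (𝔡.map Polynomial.C) := by
    rw [heG]; exact Nzd.polyMonic hh 𝔡
  have h4 := Nzd.comap e.toRingHom h3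
  rw [← hmap] at h4
  have h5 : ((Ideal.span Γ).map e.toRingHom).comap e.toRingHom = Ideal.span Γ :=
    Ideal.comap_map_of_bijective _ e.bijective
  rwa [h5] at h4

section devissage
variable {Λ : Type*} [CommRing Λ] (x : Λ)

def DevB (𝔠 : Ideal Λ) : Prop :=
  ∀ b t, x * t ∈ 𝔠 ⊔ Ideal.span {x ^ (b + 1)} → t ∈ 𝔠 ⊔ Ideal.span {x ^ b}

theorem mem_sup_span_iff {𝔠 : Ideal Λ} {t a : Λ} :
    t ∈ 𝔠 ⊔ Ideal.span {a} ↔ ∃ c ∈ 𝔠, ∃ s, t = c + a * s := by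
  rw [Submodule.mem_sup]
  constructor
  · rintro ⟨c, hc, z, hz, rfl⟩
    obtain ⟨s, rfl⟩ := Ideal.mem_span_singleton.mp hz
    exact ⟨c, hc, s, rfl⟩
  · rintro ⟨c, hc, s, rfl⟩
    exact ⟨c, hc, _, Ideal.mem_span_singleton.mpr ⟨s, rfl⟩, rfl⟩

theorem DevB.base {𝔠 : Ideal Λ} (h : Nzd x 𝔠) : DevB x 𝔠 := by
  intro b t ht
  obtain ⟨c, hc, s, hs⟩ := mem_sup_span_iff.mp ht
  refine mem_sup_span_iff.mpr ⟨t - x ^ b * s, h _ ?_, s, by ring⟩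
  have : x * (t - x ^ b * s) = c := by rw [mul_sub, hs]; ring
  rwa [this]

theorem DevB.nzd {𝔠 : Ideal Λ} (h : DevB x 𝔠) {F : Λ} (hF : Nzd F (𝔠 ⊔ Ideal.span {x})) (b : ℕ) :
    Nzd F (𝔠 ⊔ Ideal.span {x ^ b}) := by
  induction b with
  | zero => intro t _; simp
  | succ b ih =>
    intro t ht
    have h1 : t ∈ 𝔠 ⊔ Ideal.span {x} := by
      apply hF
      refine (sup_le_sup_left ?_ 𝔠) ht
      rw [Ideal.span_singleton_le_span_singleton]
      exact dvd_pow_self _ (by omega)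
    obtain ⟨c, hc, s, rfl⟩ := mem_sup_span_iff.mp h1
    have h2 : x * (F * s) ∈ 𝔠 ⊔ Ideal.span {x ^ (b + 1)} := by
      have : x * (F * s) = F * (c + x * s) - F * c := by ring
      rw [this]
      exact Ideal.sub_mem _ ht (Ideal.mem_sup_left (Ideal.mul_mem_left _ _ hc))
    obtain ⟨c', hc', s', hs'⟩ := mem_sup_span_iff.mp (ih _ (h _ _ h2))
    refine mem_sup_span_iff.mpr ⟨c + x * c', 𝔠.add_mem hc (𝔠.mul_mem_left _ hc'), s', ?_⟩
    rw [hs']; ring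

theorem DevB.sup {𝔠 : Ideal Λ} (h : DevB x 𝔠) {F : Λ} (hF : Nzd F (𝔠 ⊔ Ideal.span {x})) :
    DevB x (𝔠 ⊔ Ideal.span {F}) := by
  intro b t ht
  obtain ⟨d, hd, s, hs⟩ := mem_sup_span_iff.mp ht
  obtain ⟨c, hc, r, rfl⟩ := mem_sup_span_iff.mp hd
  have h1 : r ∈ 𝔠 ⊔ Ideal.span {x} := by
    apply hF
    refine mem_sup_span_iff.mpr ⟨-c, 𝔠.neg_mem hc, t - x ^ b * s, ?_⟩
    linear_combination -hs
  obtain ⟨c', hc', r', rfl⟩ := mem_sup_span_iff.mp h1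
  have h2 : t - F * r' ∈ 𝔠 ⊔ Ideal.span {x ^ b} := by
    apply h
    refine mem_sup_span_iff.mpr ⟨c + F * c', 𝔠.add_mem hc (𝔠.mul_mem_left _ hc'), s, ?_⟩
    linear_combination hs
  obtain ⟨c'', hc'', s'', hs''⟩ := mem_sup_span_iff.mp h2
  refine mem_sup_span_iff.mpr ⟨c'' + F * r', ?_, s'', by linear_combination hs''⟩
  exact mem_sup_span_iff.mpr ⟨c'', hc'', r', rfl⟩

theorem devissage {𝔠 : Ideal Λ} (h : Nzd x 𝔠) {m : ℕ} (F : Fin m → Λ)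
    (hF : ∀ i, Nzd (F i) (𝔠 ⊔ Ideal.span (F '' {j | j < i}) ⊔ Ideal.span {x})) (b : ℕ) (i : Fin m) :
    Nzd (F i) (𝔠 ⊔ Ideal.span (F '' {j | j < i}) ⊔ Ideal.span {x ^ b}) := by
  have key : ∀ k : ℕ, k ≤ m → DevB x (𝔠 ⊔ Ideal.span (F '' {j | j.1 < k})) := by
    intro k
    induction k with
    | zero => intro _; simpa using DevB.base x h
    | succ k ih =>
      intro hk
      have h1 := DevB.sup x (ih (by omega)) (hF ⟨k, hk⟩)
      have h2 : F '' {j | j.1 < k + 1} = F '' {j | j.1 < k} ∪ {F ⟨k, hk⟩} := by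
        have : {j : Fin m | j.1 < k + 1} = {j | j.1 < k} ∪ {⟨k, hk⟩} := by
          ext j; simp [Fin.ext_iff]; omega
        rw [this, Set.image_union, Set.image_singleton]
      rwa [h2, Ideal.span_union, ← sup_assoc]
  exact DevB.nzd x (key i.1 i.2.le) (hF i) b

end devissage

/-- The system of equations. -/
noncomputable def sysF {A : Type*} [CommRing A] {m : ℕ} (E : Fin m → MvPolynomial (Fin m) A)
    (g : MvPolynomial (Fin m) A) : Fin (m + 1) → MvPolynomial (Fin (m + 1)) A :=
  Fin.snoc (α := fun _ => MvPolynomial (Fin (m + 1)) A)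
    (fun i => rename Fin.castSucc (E i)) (X (Fin.last m) - rename Fin.castSucc g)

theorem rename_mem_supported {A σ τ : Type*} [CommRing A] (f : σ → τ) (e : MvPolynomial σ A) :
    rename f e ∈ supported A (Set.range f) := by
  induction e using MvPolynomial.induction_on with
  | C a => rw [rename_C]; exact (supported A (Set.range f)).algebraMap_mem a
  | add a b ha hb => rw [map_add]; exact add_mem ha hb
  | mul_X a s ha =>
    rw [map_mul, rename_X]
    exact mul_mem ha (Algebra.subset_adjoin ⟨_, ⟨s, rfl⟩, rfl⟩)

theorem sysF_reg {A : Type*} [CommRing A] {m : ℕ} (f : Fin m → Polynomial A) (hf : ∀ i, (f i).Monic)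
    (x : A) (𝔞 : Ideal A) (hx : Nzd x 𝔞) (H : Fin m → MvPolynomial (Fin m) A)
    (g : MvPolynomial (Fin m) A) (b : ℕ) (i : Fin (m + 1)) :
    Nzd (sysF (fun i => (Polynomial.aeval (X i) (f i)) ^ 2 + C x * H i) g i)
      (𝔞.map C ⊔ Ideal.span ((sysF (fun i => (Polynomial.aeval (X i) (f i)) ^ 2 + C x * H i) g)
        '' {j | j < i}) ⊔ Ideal.span {(C x) ^ b}) := by
  refine devissage (C x) (Nzd.mvC hx) _ ?_ b i
  clear i b
  intro i
  set F := sysF (fun i => (Polynomial.aeval (X i) (f i)) ^ 2 + C x * H i) g with hF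
  set G : Fin (m + 1) → MvPolynomial (Fin (m + 1)) A :=
    sysF (fun i => (Polynomial.aeval (X i) (f i)) ^ 2) g with hG
  have hFG : ∀ j, F j - G j ∈ (𝔞.map C ⊔ Ideal.span {C x} : Ideal (MvPolynomial (Fin (m + 1)) A)) := by
    intro j
    refine Fin.lastCases ?_ (fun j => ?_) j
    · simp [hF, hG, sysF]
    · simp only [hF, hG, sysF, Fin.snoc_castSucc]
      rw [← map_sub, add_sub_cancel_left, map_mul, rename_C]
      exact Ideal.mem_sup_right (Ideal.mul_mem_right _ _ (Ideal.mem_span_singleton_self _))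
  have h1 : 𝔞.map C ⊔ Ideal.span (F '' {j | j < i}) ⊔ Ideal.span {C x} =
      𝔞.map C ⊔ Ideal.span {C x} ⊔ Ideal.span (G '' {j | j < i}) := by
    rw [sup_right_comm]
    exact sup_span_congr (fun j _ => hFG j)
  rw [h1]
  refine Nzd.congr (Ideal.mem_sup_left (hFG i)) ?_
  -- the monic polynomial
  have hC : ∀ (a : A), (C a : MvPolynomial (Fin (m + 1)) A) ∈ supported A ({i}ᶜ : Set (Fin (m + 1))) :=
    fun a => (supported A _).algebraMap_mem a
  have h2 : 𝔞.map C ⊔ Ideal.span {C x} ⊔ Ideal.span (G '' {j | j < i}) =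
      Ideal.span ((C '' (𝔞 : Set A)) ∪ {C x} ∪ (G '' {j | j < i})) := by
    rw [Ideal.span_union, Ideal.span_union]; rfl
  have hG1 : ∀ j : Fin m, G j.castSucc = Polynomial.aeval (X j.castSucc) (f j) ^ 2 := by
    intro j
    simp only [hG, sysF, Fin.snoc_castSucc]
    rw [map_pow, ← Polynomial.aeval_algHom_apply, rename_X]
  have hsup : ∀ γ ∈ ((C '' (𝔞 : Set A)) ∪ {C x} ∪ (G '' {j | j < i})),
      γ ∈ supported A ({i}ᶜ : Set (Fin (m + 1))) := by
    rintro γ ((⟨a, _, rfl⟩ | rfl) | ⟨j, hj, rfl⟩)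
    · exact hC a
    · exact hC x
    · obtain ⟨j, rfl⟩ : ∃ j', j = Fin.castSucc j' := by
        have hjl : j ≠ Fin.last m := ?_
        · exact ⟨j.castPred hjl, (Fin.castSucc_castPred j hjl).symm⟩
        rintro rfl
        exact absurd (Fin.le_last i) (not_le.mpr hj)
      rw [hG1]
      refine pow_mem ?_ 2
      have hX : (X j.castSucc : MvPolynomial (Fin (m + 1)) A) ∈
          supported A ({i}ᶜ : Set (Fin (m + 1))) :=
        Algebra.subset_adjoin ⟨_, (ne_of_lt hj), rfl⟩
      rw [Polynomial.aeval_eq_sum_range]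
      exact sum_mem fun k _ => Subalgebra.smul_mem _ (pow_mem hX k) _
  rw [h2]
  have hlast : ∃ h : Polynomial (MvPolynomial {t // t ≠ i} A), h.Monic ∧
    h.eval₂ (rename (R := A) (Subtype.val : {t // t ≠ i} → Fin (m + 1))).toRingHom (X i) = G i := by
    refine Fin.lastCases ?_ (fun j => ?_) i
    · obtain ⟨d, hd⟩ := supported_eq_rename (S := A) (Fin.last m) (f := rename Fin.castSucc g) (by
        refine supported_mono ?_ (rename_mem_supported _ g)
        rintro _ ⟨j, rfl⟩
        exact (Fin.castSucc_lt_last j).ne)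
      refine ⟨Polynomial.X - Polynomial.C d, Polynomial.monic_X_sub_C d, ?_⟩
      rw [Polynomial.eval₂_sub, Polynomial.eval₂_X, Polynomial.eval₂_C]
      simp only [hG, sysF, Fin.snoc_last]
      congr 1
    · refine ⟨((f j).map C) ^ 2, ((hf j).map C).pow 2, ?_⟩
      rw [Polynomial.eval₂_pow, hG1, Polynomial.eval₂_map]
      congr 2
      ext1 a
      simp
  obtain ⟨h, hh, hhG⟩ := hlast
  rw [← hhG]
  exact mvMonic2 i h hh _ hsup

end P2dsec

section P2esec
open MvPolynomial

theorem main_finite {A T : Type*} [CommRing A] [IsDomain A] [IsNoetherianRing A] {p : ℕ}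
    (hp : p.Prime) (hpA : Prime (p : A)) (φ : A →+* A) (hφ : IsFrobLift p φ) (x y : A)
    (hφx : φ x = x ^ p) (hφy : φ y = y ^ p) (hx : x ∉ Ideal.span {(p : A)})
    (hpxy : ∀ M, Nzd (p : A) (Ideal.span {x ^ M, y ^ M}))
    (hxpy : ∀ M, Nzd x (Ideal.span {(p : A), y ^ M}))
    [CommRing T] [IsDomain T] [Algebra A T] [Module.Finite A T]
    (Q : Ideal T) [Q.IsPrime] (hQ : Q.comap (algebraMap A T) = Ideal.span {(p : A)})
    (hdvr : IsDiscreteValuationRing (Localization.AtPrime Q)) (u a b : T) (n : ℕ)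
    (hu : (p : T) ^ n * u = algebraMap A T x * a + algebraMap A T y * b) :
    ∃ g ∉ Q, ∀ e, ∃ L, g ^ p ^ L * u ^ p ^ (e + L) ∈
      Ideal.span {(p : T), algebraMap A T x ^ p ^ (e + L), algebraMap A T y ^ p ^ (e + L)} := by
  obtain ⟨m, z', hz'⟩ := Module.Finite.exists_fin (R := A) (M := T)
  obtain ⟨z, hz⟩ : ∃ z : Fin m → T,
      Function.Surjective (aeval z : MvPolynomial (Fin m) A →ₐ[A] T) := by
    refine ⟨z', ?_⟩
    intro t
    have ht : t ∈ Submodule.span A (Set.range z') := hz' ▸ Submodule.mem_top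
    obtain ⟨c, hc⟩ := (Submodule.mem_span_range_iff_exists_fun A).mp ht
    refine ⟨∑ i, C (c i) * X i, ?_⟩
    rw [← hc]
    simp [Algebra.smul_def]
  have hintg : ∀ i, IsIntegral A (z i) := fun i => Algebra.IsIntegral.isIntegral _
  choose f hfm hf0 using hintg
  obtain ⟨H, hH0, hH⟩ := global_lci hpA z hz Q hQ hdvr x hx
    (fun i => Polynomial.aeval (X i) (f i)) (fun i => by
      rw [← Polynomial.aeval_algHom_apply, aeval_X]; exact hf0 i)
  obtain ⟨U, hU⟩ := hz u
  obtain ⟨a', ha'⟩ := hz a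
  obtain ⟨b', hb'⟩ := hz b
  obtain ⟨g, hgQ, hg⟩ := hH ((p : MvPolynomial (Fin m) A) ^ n * U - C x * a' - C y * b') (by
    simp only [map_sub, map_mul, map_pow, map_natCast, hU, ha', hb', aeval_C]
    rw [hu]; ring)
  refine ⟨aeval z g, hgQ, fun e => ?_⟩
  set E : Fin m → MvPolynomial (Fin m) A :=
    fun i => (Polynomial.aeval (X i) (f i)) ^ 2 + C x * H i with hE
  set ρ : MvPolynomial (Fin m) A →ₐ[A] MvPolynomial (Fin (m + 1)) A := rename Fin.castSucc with hρ
  obtain ⟨Φ, hΦC, hΦX⟩ : ∃ Φ : MvPolynomial (Fin (m + 1)) A →+* MvPolynomial (Fin (m + 1)) A,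
      (∀ a, Φ (C a) = C (φ a)) ∧ ∀ s, Φ (X s) = X s ^ p :=
    ⟨eval₂Hom (C.comp φ) (fun s => X s ^ p), fun a => by simp, fun s => by simp⟩
  have hcC : (p : MvPolynomial (Fin (m + 1)) A) = C (p : A) := by simp
  have hsysr : ∀ k, sysF E g k ∈ Ideal.span (Set.range (sysF E g)) :=
    fun k => Ideal.subset_span ⟨k, rfl⟩
  have hmapI : ∀ s : Set A, Ideal.span (C '' s) =
      (Ideal.span s).map (C : A →+* MvPolynomial (Fin (m + 1)) A) := fun s => by
    rw [Ideal.map_span]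
  have hreg := core (Λ := MvPolynomial (Fin (m + 1)) A) hp
    (mv_torsionfree fun a ha => (mul_eq_zero.mp ha).resolve_left hpA.ne_zero)
    Φ (isFrobLift_mv hp hφ Φ hΦC (fun s => by rw [hΦX, sub_self]; exact dvd_zero _))
    (C x) (C y) (X (Fin.last m)) (by rw [hΦC, hφx, C_pow]) (by rw [hΦC, hφy, C_pow]) (hΦX _)
    (sysF E g) (ρ U) (ρ a') (ρ b') n ?_ ?_ ?_ e
  · obtain ⟨L, hL⟩ := hreg
    refine ⟨L, ?_⟩
    set z2 : Fin (m + 1) → T := Fin.snoc (α := fun _ => T) z (aeval z g) with hz2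
    have hz2ρ : ∀ P : MvPolynomial (Fin m) A, aeval z2 (ρ P) = aeval z P := by
      intro P
      rw [hρ, aeval_rename]
      congr 2
      funext i
      simp [hz2]
    have h1 := Ideal.mem_map_of_mem (aeval z2 : MvPolynomial (Fin (m + 1)) A →ₐ[A] T) hL
    have h2 : (Ideal.span {(p : MvPolynomial (Fin (m + 1)) A), (C x) ^ p ^ (e + L),
        (C y) ^ p ^ (e + L)} ⊔ Ideal.span (Set.range (sysF E g))).map
          (aeval z2 : MvPolynomial (Fin (m + 1)) A →ₐ[A] T) ≤
        Ideal.span {(p : T), algebraMap A T x ^ p ^ (e + L), algebraMap A T y ^ p ^ (e + L)} := by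
      rw [Ideal.map_sup, Ideal.map_span, Ideal.map_span]
      refine sup_le (Ideal.span_mono ?_) ?_
      · rintro _ ⟨_, (rfl | rfl | rfl), rfl⟩ <;> simp
      · rw [Ideal.span_le]
        rintro _ ⟨_, ⟨k, rfl⟩, rfl⟩
        have : aeval z2 (sysF E g k) = 0 := by
          refine Fin.lastCases ?_ (fun j => ?_) k
          · simp only [sysF, Fin.snoc_last, map_sub, aeval_X]
            rw [← hρ, hz2ρ]
            simp [hz2]
          · simp only [sysF, Fin.snoc_castSucc]
            rw [← hρ, hz2ρ]
            simp only [hE, map_add, map_pow, map_mul, hH0, mul_zero, add_zero]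
            rw [← Polynomial.aeval_algHom_apply, aeval_X]
            have : Polynomial.aeval (z j) (f j) = 0 := hf0 j
            rw [this]; simp
        rw [this]
        exact Submodule.zero_mem _
    have h3 := h2 h1
    simp only [map_mul, map_pow, aeval_X, hz2ρ, hU] at h3
    have h4 : z2 (Fin.last m) = aeval z g := by simp [hz2]
    rwa [h4] at h3
  · have h1 := Ideal.mem_map_of_mem ρ hg
    have h2 : (Ideal.span (Set.range E)).map ρ ≤ Ideal.span (Set.range (sysF E g)) := by
      rw [Ideal.map_span, Ideal.span_le]
      rintro _ ⟨_, ⟨j, rfl⟩, rfl⟩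
      have := hsysr j.castSucc
      have e3 : sysF E g j.castSucc = ρ (E j) := by simp only [sysF, Fin.snoc_castSucc, hρ]
      rwa [e3] at this
    have h3 := h2 h1
    have h4 := hsysr (Fin.last m)
    have e4 : sysF E g (Fin.last m) = X (Fin.last m) - ρ g := by simp only [sysF, Fin.snoc_last, hρ]
    rw [e4] at h4
    have h5 := Ideal.add_mem _ (Ideal.mul_mem_right
      ((p : MvPolynomial (Fin (m + 1)) A) ^ n * ρ U - C x * ρ a' - C y * ρ b') _ h4) h3
    convert h5 using 1
    have e1 : ρ (C x) = C x := rename_C _ _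
    have e2 : ρ (C y) = C y := rename_C _ _
    rw [map_mul, map_sub, map_sub, map_mul, map_mul, map_mul, map_pow, map_natCast, e1, e2]
    ring
  · intro M
    have h1 := Nzd.mvC (σ := Fin (m + 1)) (hpxy M)
    rw [← hmapI, Set.image_pair] at h1
    rw [hcC, ← C_pow, ← C_pow]
    exact h1
  · intro M i
    have h1 := sysF_reg f hfm x _ (hxpy M) H g M i
    rw [← hmapI, Set.image_pair] at h1
    have h2 : Ideal.span {(p : MvPolynomial (Fin (m + 1)) A), C x ^ M, C y ^ M} ⊔
        Ideal.span (sysF E g '' {j | j < i}) =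
        Ideal.span {(C (p : A) : MvPolynomial (Fin (m + 1)) A), C (y ^ M)} ⊔
        Ideal.span (sysF E g '' {j | j < i}) ⊔ Ideal.span {C x ^ M} := by
      rw [sup_right_comm, hcC, C_pow]
      congr 1
      rw [← Ideal.span_union]
      congr 1
      ext t; simp; tauto
    rw [h2]
    exact h1

end P2esec

section P2fsec
open IsLocalRing Polynomial

theorem minpoly_scale {A R : Type*} [CommRing A] [IsDomain A] [IsIntegrallyClosed A] [CommRing R]
    [IsDomain R] [Algebra A R] [Module.IsTorsionFree A R] (h : A) (hh : h ≠ 0) (s : R)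
    (hs : IsIntegral A s) :
    minpoly A (algebraMap A R h * s) = (minpoly A s).scaleRoots h := by
  symm
  apply minpoly.IsIntegrallyClosed.unique_of_degree_le_degree_minpoly
  · exact (monic_scaleRoots_iff h).mpr (minpoly.monic hs)
  · exact scaleRoots_aeval_eq_zero (minpoly.aeval A s)
  · rw [degree_scaleRoots]
    have hintg : IsIntegral A (algebraMap A R h * s) := isIntegral_algebraMap.mul hs
    have h0 : (minpoly A (algebraMap A R h * s)).comp (C h * X) ≠ 0 := by
      intro h1
      have h2 := congrArg leadingCoeff h1
      rw [leadingCoeff_comp (by rw [natDegree_C_mul_X _ hh]; omega),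
        (minpoly.monic hintg).leadingCoeff, leadingCoeff_C_mul_X] at h2
      simp [hh] at h2
    refine (minpoly.IsIntegrallyClosed.degree_le_of_ne_zero (s := s) h0 ?_).trans ?_
    · rw [aeval_comp]
      simpa using minpoly.aeval A (algebraMap A R h * s)
    · rw [degree_eq_natDegree h0, degree_eq_natDegree (minpoly.ne_zero hintg), natDegree_comp,
        natDegree_C_mul_X _ hh, mul_one]

theorem contract_minimal {A R : Type*} [CommRing A] [IsDomain A] [IsIntegrallyClosed A] [CommRing R]
    [IsDomain R] [Algebra A R] [Module.IsTorsionFree A R] [Algebra.IsIntegral A R] {q : A}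
    (hq : Prime q) (P : Ideal R) (hP : P ∈ (Ideal.span {algebraMap A R q}).minimalPrimes) :
    P.comap (algebraMap A R) = Ideal.span {q} := by
  have hPp : P.IsPrime := hP.1.1
  have hqP : algebraMap A R q ∈ P := hP.1.2 (Ideal.mem_span_singleton_self _)
  apply le_antisymm
  · intro f hf
    by_contra hfq
    rw [Ideal.mem_span_singleton] at hfq
    have hf' : algebraMap A R f ∈ P := hf
    obtain ⟨s, hs, N, hN⟩ : ∃ s ∉ P, ∃ N, s * algebraMap A R f ^ N ∈
        Ideal.span {algebraMap A R q} := by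
      by_contra hcon
      push Not at hcon
      obtain ⟨S, hS⟩ : ∃ S : Submonoid R, S = P.primeCompl ⊔ Submonoid.powers (algebraMap A R f) :=
        ⟨_, rfl⟩
      have hdis : Disjoint ((Ideal.span {algebraMap A R q} : Ideal R) : Set R) (S : Set R) := by
        rw [Set.disjoint_left]
        intro z hz hzS
        rw [hS, SetLike.mem_coe, Submonoid.mem_sup] at hzS
        obtain ⟨s, hs, _, ⟨N, rfl⟩, rfl⟩ := hzS
        exact hcon s hs N hz
      obtain ⟨P', hP'p, hle, hd⟩ := Ideal.exists_le_prime_disjoint _ _ hdis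
      have hP'P : P' ≤ P := by
        intro z hz
        by_contra hzP
        exact Set.disjoint_left.mp hd hz
          (by rw [hS]; exact (le_sup_left : P.primeCompl ≤ _) hzP)
      have := hP.2 ⟨hP'p, hle⟩ hP'P hf'
      exact Set.disjoint_left.mp hd this
          (by rw [hS]; exact (le_sup_right : Submonoid.powers _ ≤ _) (Submonoid.mem_powers _))
    obtain ⟨r, hr⟩ := Ideal.mem_span_singleton.mp hN
    have hh : ¬ q ∣ f ^ N := fun h => hfq (hq.dvd_of_dvd_pow h)
    have hh0 : f ^ N ≠ 0 := fun h => hh (h ▸ dvd_zero _)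
    have h1 := minpoly_scale (R := R) (f ^ N) hh0 s (Algebra.IsIntegral.isIntegral s)
    have h2 := minpoly_scale (R := R) q hq.ne_zero r (Algebra.IsIntegral.isIntegral r)
    rw [map_pow, mul_comm, hr, h2] at h1
    have hdeg := congrArg natDegree h1
    rw [natDegree_scaleRoots, natDegree_scaleRoots] at hdeg
    have hc : ∀ i < (minpoly A s).natDegree, q ∣ (minpoly A s).coeff i := by
      intro i hi
      have h3 := congrArg (fun P => coeff P i) h1
      simp only [coeff_scaleRoots] at h3
      have h4 : q ∣ (minpoly A s).coeff i * (f ^ N) ^ ((minpoly A s).natDegree - i) := by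
        rw [← h3]
        exact Dvd.dvd.mul_left (dvd_pow_self _ (by omega)) _
      rcases hq.dvd_or_dvd h4 with h | h
      · exact h
      · exact absurd (hq.dvd_of_dvd_pow h) hh
    apply hs
    apply hPp.mem_of_pow_mem (minpoly A s).natDegree
    have h5 := minpoly.aeval A s
    rw [aeval_eq_sum_range, Finset.sum_range_succ] at h5
    have h6 : (minpoly A s).coeff (minpoly A s).natDegree = 1 :=
      (minpoly.monic (Algebra.IsIntegral.isIntegral s))
    rw [h6, one_smul] at h5
    rw [eq_neg_of_add_eq_zero_right h5]
    refine P.neg_mem (P.sum_mem fun i hi => ?_)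
    obtain ⟨c, hc'⟩ := hc i (Finset.mem_range.mp hi)
    rw [hc', Algebra.smul_def, map_mul]
    exact P.mul_mem_right _ (P.mul_mem_right _ hqP)
  · rw [Ideal.span_le, Set.singleton_subset_iff]
    exact hqP

theorem dvr_of_normal {A T : Type*} [CommRing A] [IsDomain A] [IsNoetherianRing A] [CommRing T]
    [IsDomain T] [IsNoetherianRing T] [IsIntegrallyClosed T] [Algebra A T] [Algebra.IsIntegral A T]
    {q : A} (hq : Prime q) (hqT : algebraMap A T q ≠ 0) (Q : Ideal T) [hQp : Q.IsPrime]
    (hQ : Q.comap (algebraMap A T) = Ideal.span {q}) :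
    IsDiscreteValuationRing (Localization.AtPrime Q) := by
  have hqQ : algebraMap A T q ∈ Q := by
    have : q ∈ Q.comap (algebraMap A T) := hQ ▸ Ideal.mem_span_singleton_self q
    exact this
  have hinj := (IsLocalization.injective (Localization.AtPrime Q) Q.primeCompl_le_nonZeroDivisors)
  have hne : maximalIdeal (Localization.AtPrime Q) ≠ ⊥ := by
    intro h
    have h1 : algebraMap T (Localization.AtPrime Q) (algebraMap A T q) ∈
        maximalIdeal (Localization.AtPrime Q) := by
      rw [← Localization.AtPrime.map_eq_maximalIdeal]
      exact Ideal.mem_map_of_mem _ hqQ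
    rw [h, Ideal.mem_bot] at h1
    exact hqT (hinj (h1.trans (map_zero _).symm))
  have hf : ¬ IsField (Localization.AtPrime Q) := by
    intro h
    exact hne (IsLocalRing.isField_iff_maximalIdeal_eq.mp h)
  have hic : IsIntegrallyClosed (Localization.AtPrime Q) :=
    isIntegrallyClosed_of_isLocalization _ Q.primeCompl Q.primeCompl_le_nonZeroDivisors
  have h03 : IsDiscreteValuationRing (Localization.AtPrime Q) ↔
      (IsIntegrallyClosed (Localization.AtPrime Q) ∧
        ∃! P : Ideal (Localization.AtPrime Q), P ≠ ⊥ ∧ P.IsPrime) :=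
    (IsDiscreteValuationRing.TFAE (Localization.AtPrime Q) hf).out 0 3
  refine h03.mpr ⟨hic, maximalIdeal _, ⟨hne, inferInstance⟩, ?_⟩
  rintro P ⟨hP0, hPp⟩
  have hle : P ≤ maximalIdeal _ := le_maximalIdeal hPp.ne_top
  obtain ⟨P', hP'⟩ : ∃ P', P' = P.comap (algebraMap T (Localization.AtPrime Q)) := ⟨_, rfl⟩
  have hmap : P'.map (algebraMap T (Localization.AtPrime Q)) = P := by
    rw [hP']
    exact IsLocalization.map_under Q.primeCompl _ P
  have hP'p : P'.IsPrime := by rw [hP']; infer_instance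
  have hP'Q : P' ≤ Q := by
    intro z hz
    by_contra hzQ
    have hz1 : algebraMap T (Localization.AtPrime Q) z ∈ P := by rw [hP'] at hz; exact hz
    exact hPp.ne_top (Ideal.eq_top_of_isUnit_mem _ hz1
      (IsLocalization.map_units (M := Q.primeCompl) (Localization.AtPrime Q) ⟨z, hzQ⟩))
  have hP'0 : P' ≠ ⊥ := by
    rintro rfl
    apply hP0
    rw [← hmap, Ideal.map_bot]
  have hI0 := Ideal.IsIntegral.comap_ne_bot A hP'0
  obtain ⟨a, ha, ha0⟩ := (Submodule.ne_bot_iff _).mp hI0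
  obtain ⟨n, b, hb, rfl⟩ := WfDvdMonoid.max_power_factor ha0 hq.irreducible
  have hIp : (P'.comap (algebraMap A T)).IsPrime := inferInstance
  have hIle : P'.comap (algebraMap A T) ≤ Ideal.span {q} := hQ ▸ Ideal.comap_mono hP'Q
  have hqI : q ∈ P'.comap (algebraMap A T) := by
    rcases hIp.mem_or_mem ha with h | h
    · exact hIp.mem_of_pow_mem _ h
    · exact absurd (Ideal.mem_span_singleton.mp (hIle h)) hb
  have hPQ : P' = Q := by
    by_contra hne'
    have := Ideal.IsIntegral.comap_lt_comap (R := A) (lt_of_le_of_ne hP'Q hne')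
    rw [hQ] at this
    exact absurd ((Ideal.span_singleton_le_iff_mem _).mpr hqI) (not_le_of_gt this)
  rw [← hmap, hPQ, Localization.AtPrime.map_eq_maximalIdeal]

end P2fsec

section P2gsec
theorem tight_of_tower {A R T : Type*} [CommRing A] [IsDomain A] [IsNoetherianRing A] {p : ℕ}
    (hp : p.Prime) (hpA : Prime (p : A)) (φ : A →+* A) (hφ : IsFrobLift p φ) (x y : A)
    (hφx : φ x = x ^ p) (hφy : φ y = y ^ p) (hx : x ∉ Ideal.span {(p : A)})
    (hpxy : ∀ M, Nzd (p : A) (Ideal.span {x ^ M, y ^ M}))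
    (hxpy : ∀ M, Nzd x (Ideal.span {(p : A), y ^ M}))
    (hfr : ∀ (a : A) (N l : ℕ), a ^ p ^ l ∈ Ideal.span {(p : A), x ^ (N * p ^ l), y ^ (N * p ^ l)} →
      a ∈ Ideal.span {(p : A), x ^ N, y ^ N})
    [CommRing R] [IsDomain R] [Algebra A R]
    [CommRing T] [IsDomain T] [Algebra A T] [Module.Finite A T] [Algebra R T] [IsScalarTower A R T]
    (P : Ideal R) [P.IsPrime]
    (Q : Ideal T) [Q.IsPrime] (hQ : Q.comap (algebraMap A T) = Ideal.span {(p : A)})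
    (hQP : Q.comap (algebraMap R T) = P)
    (hdvr : IsDiscreteValuationRing (Localization.AtPrime Q)) (u a b : R) (n : ℕ)
    (hu : (p : R) ^ n * u = algebraMap A R x * a + algebraMap A R y * b) :
    ∃ c : R ⧸ P, c ≠ 0 ∧ ∀ e, c * Ideal.Quotient.mk P u ^ p ^ e ∈
      Ideal.span {Ideal.Quotient.mk P (algebraMap A R x) ^ p ^ e,
        Ideal.Quotient.mk P (algebraMap A R y) ^ p ^ e} := by
  obtain ⟨g, hgQ, hg⟩ := main_finite hp hpA φ hφ x y hφx hφy hx hpxy hxpy Q hQ hdvr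
    (algebraMap R T u) (algebraMap R T a) (algebraMap R T b) n (by
      have := congrArg (algebraMap R T) hu
      simpa [← IsScalarTower.algebraMap_apply] using this)
  have hPQ : P ≤ Q.comap (algebraMap R T) := hQP.ge
  have hpQ : Ideal.span {(p : A)} ≤ Q.comap (algebraMap A T) := hQ.ge
  have hpQ' : (p : T) ∈ Q := by
    have : (p : A) ∈ Q.comap (algebraMap A T) := hpQ (Ideal.mem_span_singleton_self _)
    rw [Ideal.mem_comap, map_natCast] at this
    exact this
  haveI : (Ideal.span {(p : A)}).IsPrime := (Ideal.span_singleton_prime hpA.ne_zero).mpr hpA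
  letI : Algebra (R ⧸ P) (T ⧸ Q) := (Ideal.quotientMap Q (algebraMap R T) hPQ).toAlgebra
  letI : Algebra (A ⧸ Ideal.span {(p : A)}) (T ⧸ Q) :=
    (Ideal.quotientMap Q (algebraMap A T) hpQ).toAlgebra
  have hRm : ∀ r, algebraMap (R ⧸ P) (T ⧸ Q) (Ideal.Quotient.mk P r) =
      Ideal.Quotient.mk Q (algebraMap R T r) := fun r => Ideal.quotientMap_mk
  have hAm : ∀ r, algebraMap (A ⧸ Ideal.span {(p : A)}) (T ⧸ Q) (Ideal.Quotient.mk _ r) =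
      Ideal.Quotient.mk Q (algebraMap A T r) := fun r => Ideal.quotientMap_mk
  have hfinA : Module.Finite (A ⧸ Ideal.span {(p : A)}) (T ⧸ Q) := by
    haveI : IsScalarTower A (A ⧸ Ideal.span {(p : A)}) (T ⧸ Q) := IsScalarTower.of_algebraMap_eq
      (fun r => by rw [Ideal.Quotient.algebraMap_eq, hAm]; rfl)
    exact Module.Finite.of_restrictScalars_finite A _ _
  have hfinR : Module.Finite (R ⧸ P) (T ⧸ Q) := by
    haveI : IsScalarTower R (R ⧸ P) (T ⧸ Q) := IsScalarTower.of_algebraMap_eq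
      (fun r => by rw [Ideal.Quotient.algebraMap_eq, hRm]; rfl)
    haveI : Module.Finite R T := Module.Finite.of_restrictScalars_finite A _ _
    exact Module.Finite.of_restrictScalars_finite R _ _
  have hinjR : Function.Injective (algebraMap (R ⧸ P) (T ⧸ Q)) :=
    Ideal.quotientMap_injective' hQP.le
  have hinjA : Function.Injective (algebraMap (A ⧸ Ideal.span {(p : A)}) (T ⧸ Q)) :=
    Ideal.quotientMap_injective' hQ.le
  haveI : Fact p.Prime := ⟨hp⟩
  haveI : CharP (T ⧸ Q) p := by
    rw [CharP.charP_iff_prime_eq_zero hp]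
    rw [← map_natCast (Ideal.Quotient.mk Q), Ideal.Quotient.eq_zero_iff_mem]
    exact hpQ'
  apply descend_finite hinjR
  rw [hRm, hRm, hRm, ← IsScalarTower.algebraMap_apply, ← IsScalarTower.algebraMap_apply, ← hAm,
    ← hAm]
  have key : ∀ (B : Type _) [CommRing B] (f : A →+* B) (hf : f p = 0) (s t : A) (w : A),
      w ∈ Ideal.span {(p : A), s, t} → f w ∈ Ideal.span {f s, f t} := by
    intro B _ f hf s t w hw
    have h1 := Ideal.mem_map_of_mem f hw
    rw [Ideal.map_span] at h1
    refine (Ideal.span_le.mpr ?_) h1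
    rintro _ ⟨z, hz, rfl⟩
    rcases hz with rfl | rfl | rfl
    · rw [hf]; exact zero_mem _
    · exact Ideal.subset_span (by simp)
    · exact Ideal.subset_span (by simp)
  have hmem : ∀ (s t w : A), Ideal.Quotient.mk (Ideal.span {(p : A)}) w ∈
      Ideal.span {Ideal.Quotient.mk (Ideal.span {(p : A)}) s, Ideal.Quotient.mk _ t} ↔
      w ∈ Ideal.span {(p : A), s, t} := by
    intro s t w
    constructor
    · intro h
      obtain ⟨c, d, hcd⟩ := Ideal.mem_span_pair.mp h
      obtain ⟨c, rfl⟩ := Ideal.Quotient.mk_surjective c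
      obtain ⟨d, rfl⟩ := Ideal.Quotient.mk_surjective d
      rw [← map_mul, ← map_mul, ← map_add, Ideal.Quotient.eq, Ideal.mem_span_singleton] at hcd
      obtain ⟨e, he⟩ := hcd
      have : w = c * s + d * t - p * e := by rw [← he]; ring
      rw [this]
      refine sub_mem (add_mem ?_ ?_) ?_
      · exact Ideal.mul_mem_left _ _ (Ideal.subset_span (by simp))
      · exact Ideal.mul_mem_left _ _ (Ideal.subset_span (by simp))
      · exact Ideal.mul_mem_right _ _ (Ideal.subset_span (by simp))
    · intro h
      exact key _ _ (by rw [Ideal.Quotient.eq_zero_iff_mem]; exact Ideal.mem_span_singleton_self _)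
        _ _ _ h
  refine frob_closure hinjA p _ _ ?_ ?_ (Ideal.Quotient.mk Q g) _ ?_ ?_
  · rw [Ne, Ideal.Quotient.eq_zero_iff_mem]; exact hx
  · intro a N l h
    obtain ⟨a, rfl⟩ := Ideal.Quotient.mk_surjective a
    rw [← map_pow, ← map_pow, ← map_pow, hmem] at h
    rw [← map_pow, ← map_pow, hmem]
    exact hfr a N l h
  · rw [Ne, Ideal.Quotient.eq_zero_iff_mem]; exact hgQ
  · intro e
    obtain ⟨l, hl⟩ := hg e
    refine ⟨l, ?_⟩
    have h1 := Ideal.mem_map_of_mem (Ideal.Quotient.mk Q) hl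
    rw [Ideal.map_span] at h1
    rw [map_mul, map_pow, map_pow] at h1
    rw [hAm, hAm]
    refine (Ideal.span_le.mpr ?_) h1
    rintro _ ⟨z, hz, rfl⟩
    rcases hz with rfl | rfl | rfl
    · rw [Ideal.Quotient.eq_zero_iff_mem.mpr hpQ']; exact zero_mem _
    · rw [map_pow]; exact Ideal.subset_span (by simp)
    · rw [map_pow]; exact Ideal.subset_span (by simp)

theorem tight_of_base {A R : Type*} [CommRing A] [IsDomain A] [IsNoetherianRing A]
    [IsIntegrallyClosed A] [CharZero A] {p : ℕ}
    (hp : p.Prime) (hpA : Prime (p : A)) (φ : A →+* A) (hφ : IsFrobLift p φ) (x y : A)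
    (hφx : φ x = x ^ p) (hφy : φ y = y ^ p) (hx : x ∉ Ideal.span {(p : A)})
    (hpxy : ∀ M, Nzd (p : A) (Ideal.span {x ^ M, y ^ M}))
    (hxpy : ∀ M, Nzd x (Ideal.span {(p : A), y ^ M}))
    (hfr : ∀ (a : A) (N l : ℕ), a ^ p ^ l ∈ Ideal.span {(p : A), x ^ (N * p ^ l), y ^ (N * p ^ l)} →
      a ∈ Ideal.span {(p : A), x ^ N, y ^ N})
    [CommRing R] [IsDomain R] [Algebra A R] [Module.Finite A R]
    (hinj : Function.Injective (algebraMap A R))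
    (P : Ideal R) (hP : P ∈ (Ideal.span {(p : R)}).minimalPrimes) (u a b : R) (n : ℕ)
    (hu : (p : R) ^ n * u = algebraMap A R x * a + algebraMap A R y * b) :
    ∃ c : R ⧸ P, c ≠ 0 ∧ ∀ e, c * Ideal.Quotient.mk P u ^ p ^ e ∈
      Ideal.span {Ideal.Quotient.mk P (algebraMap A R x) ^ p ^ e,
        Ideal.Quotient.mk P (algebraMap A R y) ^ p ^ e} := by
  haveI hPp : P.IsPrime := hP.1.1
  haveI : FaithfulSMul A R := (faithfulSMul_iff_algebraMap_injective A R).2 hinj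
  haveI : Module.IsTorsionFree A R := inferInstance
  have hcon : P.comap (algebraMap A R) = Ideal.span {(p : A)} :=
    contract_minimal hpA P (by rw [map_natCast]; exact hP)
  have hinjL : Function.Injective (algebraMap A (FractionRing R)) := by
    rw [IsScalarTower.algebraMap_eq A R (FractionRing R)]
    exact (IsFractionRing.injective R _).comp hinj
  haveI : FaithfulSMul A (FractionRing R) := (faithfulSMul_iff_algebraMap_injective _ _).2 hinjL
  letI : Algebra (FractionRing A) (FractionRing R) := FractionRing.liftAlgebra A (FractionRing R)
  haveI : CharZero (FractionRing A) := inferInstance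
  haveI : Algebra.IsIntegral A R := inferInstance
  haveI : FiniteDimensional (FractionRing A) (FractionRing R) := by
    obtain ⟨d, t, ht⟩ := Module.Finite.exists_fin (R := A) (M := R)
    refine ⟨Submodule.fg_def.mpr
      ⟨Set.range (fun i => algebraMap R (FractionRing R) (t i)), Set.finite_range _, ?_⟩⟩
    rw [eq_top_iff]
    have hR : ∀ r : R, algebraMap R (FractionRing R) r ∈ Submodule.span (FractionRing A)
        (Set.range (fun i => algebraMap R (FractionRing R) (t i))) := by
      intro r
      have hr : r ∈ Submodule.span A (Set.range t) := ht ▸ Submodule.mem_top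
      obtain ⟨c, hc⟩ := (Submodule.mem_span_range_iff_exists_fun A).mp hr
      rw [← hc, map_sum]
      refine Submodule.sum_mem _ fun i _ => ?_
      rw [Algebra.smul_def, map_mul, ← IsScalarTower.algebraMap_apply A R (FractionRing R),
        IsScalarTower.algebraMap_apply A (FractionRing A) (FractionRing R), ← Algebra.smul_def]
      exact Submodule.smul_mem _ _ (Submodule.subset_span ⟨i, rfl⟩)
    rintro z -
    obtain ⟨r, s, hs, rfl⟩ := IsFractionRing.div_surjective (A := R) z
    have hs0 : s ≠ 0 := nonZeroDivisors.ne_zero hs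
    have h1 := Ideal.comap_ne_bot_of_integral_mem (R := A) hs0 (Ideal.mem_span_singleton_self s)
      (Algebra.IsIntegral.isIntegral s)
    obtain ⟨d, hd, hd0⟩ := Submodule.exists_mem_ne_zero_of_ne_bot h1
    obtain ⟨s', hs'⟩ := Ideal.mem_span_singleton.mp (show algebraMap A R d ∈ Ideal.span {s} from hd)
    have hdL : algebraMap A (FractionRing R) d ≠ 0 :=
      fun h => hd0 (hinjL (h.trans (map_zero _).symm))
    have hsL : algebraMap R (FractionRing R) s ≠ 0 :=
      fun h => hs0 (IsFractionRing.injective R _ (h.trans (map_zero _).symm))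
    have h2 : algebraMap R (FractionRing R) r / algebraMap R (FractionRing R) s =
        (algebraMap A (FractionRing A) d)⁻¹ • algebraMap R (FractionRing R) (r * s') := by
      rw [Algebra.smul_def, map_inv₀, ← IsScalarTower.algebraMap_apply A (FractionRing A)]
      rw [div_eq_iff hsL, mul_assoc, eq_inv_mul_iff_mul_eq₀ hdL,
        IsScalarTower.algebraMap_apply A R (FractionRing R), hs']
      simp only [map_mul]
      ring
    rw [h2]
    exact Submodule.smul_mem _ _ (hR _)
  obtain ⟨T, hT⟩ : ∃ T : Subalgebra A (FractionRing R), T = integralClosure A (FractionRing R) :=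
    ⟨_, rfl⟩
  haveI : IsIntegralClosure T A (FractionRing R) := hT ▸ inferInstance
  haveI : IsIntegrallyClosed T := hT ▸
    integralClosure.isIntegrallyClosedOfFiniteExtension (FractionRing A)
  haveI : Module.Finite A T := IsIntegralClosure.finite A (FractionRing A) (FractionRing R) _
  haveI : IsNoetherianRing T := IsNoetherianRing.of_finite A T
  have hRT : ∀ r : R, algebraMap R (FractionRing R) r ∈ T := fun r => by
    rw [hT]
    exact (Algebra.IsIntegral.isIntegral (R := A) r).algebraMap
  letI : Algebra R T := ((algebraMap R (FractionRing R)).codRestrict T hRT).toAlgebra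
  haveI : IsScalarTower A R T := IsScalarTower.of_algebraMap_eq fun a => by
    apply Subtype.ext
    change algebraMap A (FractionRing R) a = algebraMap R (FractionRing R) (algebraMap A R a)
    exact IsScalarTower.algebraMap_apply _ _ _ _
  have hinjRT : Function.Injective (algebraMap R T) := fun a b h =>
    IsFractionRing.injective R (FractionRing R) (congrArg Subtype.val h)
  haveI : Algebra.IsIntegral R T := Algebra.IsIntegral.tower_top (R := A)
  obtain ⟨Q, hQp, hQP⟩ := Ideal.exists_ideal_over_prime_of_isIntegral_of_isDomain (S := T) P
    (by rw [(RingHom.injective_iff_ker_eq_bot _).mp hinjRT]; exact bot_le)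
  have hQA : Q.comap (algebraMap A T) = Ideal.span {(p : A)} := by
    rw [IsScalarTower.algebraMap_eq A R T, ← Ideal.comap_comap, hQP, hcon]
  have hpT : algebraMap A T (p : A) ≠ 0 := by
    rw [IsScalarTower.algebraMap_apply A R T]
    exact fun h => hpA.ne_zero (hinj ((hinjRT (h.trans (map_zero _).symm)).trans (map_zero _).symm))
  exact tight_of_tower hp hpA φ hφ x y hφx hφy hx hpxy hxpy hfr P Q hQA hQP
    (dvr_of_normal hpA hpT Q hQA) u a b n hu

end P2gsec

section P4asec
section pbasis

/-- powers of an element outside a subfield containing all `p`-th powers -/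
theorem pow_indep {k : Type*} [Field k] {p : ℕ} (hp : p.Prime) [CharP k p] (L : Subfield k)
    (hL : ∀ a : k, a ^ p ∈ L) (b : k) (hb : b ∉ L) (q : Polynomial L) (hq : q.natDegree < p)
    (h : Polynomial.aeval b q = 0) : q = 0 := by
  haveI : Fact p.Prime := ⟨hp⟩
  have hirr : Irreducible (Polynomial.X ^ p - Polynomial.C (⟨b ^ p, hL b⟩ : L)) := by
    apply X_pow_sub_C_irreducible_of_prime hp
    intro c hc
    have h1 : (c : k) ^ p = b ^ p := congrArg Subtype.val hc
    have h2 : (c : k) = b := by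
      apply frobenius_inj k p
      simpa [frobenius_def] using h1
    exact hb (h2 ▸ c.2)
  have hmin := minpoly.eq_of_irreducible_of_monic (x := b) hirr (by
    simp only [map_sub, map_pow, Polynomial.aeval_X, Polynomial.aeval_C]
    exact sub_self _) (Polynomial.monic_X_pow_sub_C _ hp.ne_zero)
  by_contra hq0
  have h3 := minpoly.degree_le_of_ne_zero L b hq0 h
  rw [← hmin, Polynomial.degree_X_pow_sub_C hp.pos, Polynomial.degree_eq_natDegree hq0] at h3
  have : p ≤ q.natDegree := by exact_mod_cast h3
  omega

theorem ind_fin {k : Type*} [Field k] {p : ℕ} (hp : p.Prime) [CharP k p] [ExpChar k p] (n : ℕ) :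
    ∀ (b : Fin n → k)
    (_ : ∀ i, b i ∉ Subfield.closure (Set.range (fun a : k => a ^ p) ∪ b '' {j | i < j}))
    (P : MvPolynomial (Fin n) k) (_ : ∀ i, P.degreeOf i < p)
    (_ : MvPolynomial.eval₂Hom (frobenius k p) b P = 0), P = 0 := by
  induction n with
  | zero =>
    intro b _ P _ h
    obtain ⟨c, rfl⟩ := MvPolynomial.C_surjective (Fin 0) P
    rw [MvPolynomial.coe_eval₂Hom, MvPolynomial.eval₂_C] at h
    rw [(map_eq_zero _).mp h, map_zero]
  | succ n ih =>
    intro b hb P hd h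
    obtain ⟨L, hLdef⟩ : ∃ L : Subfield k, L = Subfield.closure
        (Set.range (fun a : k => a ^ p) ∪ b '' {j | (0 : Fin (n + 1)) < j}) := ⟨_, rfl⟩
    have hL : ∀ a : k, a ^ p ∈ L := fun a => by
      rw [hLdef]; exact Subfield.subset_closure (Or.inl ⟨a, rfl⟩)
    have hbL : ∀ j : Fin n, b j.succ ∈ L := fun j => by
      rw [hLdef]; exact Subfield.subset_closure (Or.inr ⟨j.succ, Fin.succ_pos j, rfl⟩)
    obtain ⟨g, hg⟩ : ∃ g : MvPolynomial (Fin n) k →+* L,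
        g = MvPolynomial.eval₂Hom ((frobenius k p).codRestrict L hL)
          (fun j => (⟨b j.succ, hbL j⟩ : L)) := ⟨_, rfl⟩
    have hg' : (algebraMap L k).comp g =
        MvPolynomial.eval₂Hom (frobenius k p) (fun j => b j.succ) := by
      rw [hg]
      apply MvPolynomial.ringHom_ext
      · intro a; simp; rfl
      · intro i; simp; rfl
    have hcomp : ((Polynomial.eval₂RingHom (algebraMap L k) (b 0)).comp (Polynomial.mapRingHom g)).comp
        (MvPolynomial.finSuccEquiv k n).toAlgHom.toRingHom = MvPolynomial.eval₂Hom (frobenius k p) b := by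
      have e1 : (Polynomial.eval₂RingHom (algebraMap L k) (b 0)).comp (Polynomial.mapRingHom g) =
        Polynomial.eval₂RingHom ((algebraMap L k).comp g) (b 0) := by
        ext <;> simp
      rw [e1, hg']
      apply MvPolynomial.ringHom_ext
      · intro a; simp [MvPolynomial.finSuccEquiv_comp_C_eq_C, MvPolynomial.finSuccEquiv_apply]
      · intro i
        refine Fin.cases ?_ (fun j => ?_) i
        · simp [MvPolynomial.finSuccEquiv_X_zero]
        · simp [MvPolynomial.finSuccEquiv_X_succ]
    have h0 : ((MvPolynomial.finSuccEquiv k n) P).map g = 0 := by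
      refine pow_indep hp L hL (b 0) (by rw [hLdef]; exact hb 0) _ ?_ ?_
      · refine lt_of_le_of_lt Polynomial.natDegree_map_le ?_
        rw [MvPolynomial.natDegree_finSuccEquiv]
        exact hd 0
      · rw [← hcomp] at h
        exact h
    have h1 : (MvPolynomial.finSuccEquiv k n) P = 0 := by
      ext1 i
      rw [Polynomial.coeff_zero]
      apply ih (fun j => b j.succ)
      · intro i hi
        apply hb i.succ
        refine Subfield.closure_mono ?_ hi
        refine Set.union_subset_union_right _ ?_
        rintro _ ⟨j, hj, rfl⟩
        exact ⟨j.succ, Fin.succ_lt_succ_iff.mpr hj, rfl⟩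
      · intro j
        exact lt_of_le_of_lt (MvPolynomial.degreeOf_coeff_finSuccEquiv P j i) (hd j.succ)
      · rw [← hg']
        have := congrArg (fun q => Polynomial.coeff q i) h0
        simp only [Polynomial.coeff_map, Polynomial.coeff_zero] at this
        rw [RingHom.comp_apply, this, map_zero]
    exact (map_eq_zero_iff _ (MvPolynomial.finSuccEquiv k n).injective).mp h1

/-- monomial -/
noncomputable def pmon {k : Type*} [CommMonoid k] {B : Type*} (b : B → k) (γ : B →₀ ℕ) : k :=
  γ.prod fun i n => b i ^ n

theorem pmon_add {k : Type*} [CommMonoid k] {B : Type*} (b : B → k) (γ δ : B →₀ ℕ) :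
    pmon b (γ + δ) = pmon b γ * pmon b δ :=
  Finsupp.prod_add_index' (fun _ => pow_zero _) (fun _ _ _ => pow_add _ _ _)

theorem pmon_nsmul {k : Type*} [CommMonoid k] {B : Type*} (b : B → k) (γ : B →₀ ℕ) (n : ℕ) :
    pmon b (n • γ) = pmon b γ ^ n := by
  induction n with
  | zero => simp [pmon]
  | succ n ih => rw [succ_nsmul, pmon_add, ih, pow_succ]

theorem exists_pbasis (k : Type*) [Field k] (p : ℕ) (hp : p.Prime) [CharP k p] :
    ∃ B : Set k, (∀ s : ℕ, Subring.closure (Set.range (fun a : k => a ^ p ^ s) ∪ B) = ⊤) ∧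
      ∀ (s : ℕ) (F : Finset (B →₀ ℕ)) (c : (B →₀ ℕ) → k), (∀ γ ∈ F, ∀ b, γ b < p ^ s) →
        ∑ γ ∈ F, c γ ^ p ^ s * pmon (fun b : B => (b : k)) γ = 0 → ∀ γ ∈ F, c γ = 0 := by
  classical
  haveI : Fact p.Prime := ⟨hp⟩
  haveI : ExpChar k p := ExpChar.prime hp
  obtain ⟨r, hr⟩ : ∃ r : LinearOrder k, WellFoundedLT k :=
    ⟨linearOrderOfSTO WellOrderingRel, ⟨(IsWellFounded.wf : WellFounded (WellOrderingRel (α := k)))⟩⟩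
  obtain ⟨B, hB⟩ : ∃ B : Set k, B = {a | a ∉ Subfield.closure
    (Set.range (fun a : k => a ^ p) ∪ {a' | a' < a})} := ⟨_, rfl⟩
  have hfield : Subfield.closure (Set.range (fun a : k => a ^ p) ∪ B) = ⊤ := by
    rw [eq_top_iff]
    rintro a -
    induction a using WellFoundedLT.induction with
    | ind a ih =>
    by_cases ha : a ∈ B
    · exact Subfield.subset_closure (Or.inr ha)
    · rw [hB, Set.mem_setOf_eq, not_not] at ha
      refine Subfield.closure_le.mpr ?_ ha
      rintro z (hz | hz)
      · exact Subfield.subset_closure (Or.inl hz)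
      · exact ih z hz
  have hring1 : Subring.closure (Set.range (fun a : k => a ^ p) ∪ B) = ⊤ := by
    obtain ⟨S, hS⟩ : ∃ S : Subfield k, S.toSubring =
        Subring.closure (Set.range (fun a : k => a ^ p) ∪ B) := by
      refine ⟨{ Subring.closure (Set.range (fun a : k => a ^ p) ∪ B) with inv_mem' := ?_ }, rfl⟩
      intro z hz
      have : z⁻¹ = z ^ (p - 1) * (z⁻¹) ^ p := by
        by_cases h0 : z = 0
        · simp [h0, hp.ne_zero]
        · obtain ⟨q, rfl⟩ : ∃ q, p = q + 1 := ⟨p - 1, (Nat.sub_add_cancel hp.one_le).symm⟩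
          rw [inv_pow, Nat.add_sub_cancel, pow_succ]
          field_simp
      rw [this]
      have hz' : z ∈ Subring.closure (Set.range (fun a : k => a ^ p) ∪ B) := hz
      have hz2 : (z⁻¹) ^ p ∈ Subring.closure (Set.range (fun a : k => a ^ p) ∪ B) :=
        Subring.subset_closure (Or.inl ⟨_, rfl⟩)
      exact mul_mem (pow_mem hz' _) hz2
    have h1 : (⊤ : Subfield k) ≤ S := by
      rw [← hfield, Subfield.closure_le]
      intro z hz
      change z ∈ S.toSubring
      rw [hS]
      exact Subring.subset_closure hz
    rw [← hS, eq_top_iff]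
    intro z _
    exact h1 (show z ∈ (⊤ : Subfield k) from trivial)
  refine ⟨B, ?_, ?_⟩
  · intro s
    induction s with
    | zero =>
      rw [eq_top_iff]
      intro z _
      exact Subring.subset_closure (Or.inl ⟨z, by simp⟩)
    | succ s ih =>
      rw [← hring1]
      apply le_antisymm
      · rw [hring1]; exact le_top
      · rw [Subring.closure_le]
        rintro z (⟨a, rfl⟩ | hz)
        · have ha : a ∈ Subring.closure (Set.range (fun a : k => a ^ p ^ s) ∪ B) := by
            rw [ih]; trivial
          have h2 : frobenius k p a ∈ (Subring.closure
              (Set.range (fun a : k => a ^ p ^ s) ∪ B)).map (frobenius k p) := ⟨a, ha, rfl⟩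
          rw [RingHom.map_closure] at h2
          refine Subring.closure_le.mpr ?_ h2
          rintro _ ⟨w, (⟨w', rfl⟩ | hw), rfl⟩
          · refine Subring.subset_closure (Or.inl ⟨w', ?_⟩)
            simp only [frobenius_def]
            rw [← pow_mul, pow_succ]
          · rw [frobenius_def]
            have hw' : w ∈ Subring.closure (Set.range (fun a : k => a ^ p ^ (s + 1)) ∪ B) :=
              Subring.subset_closure (Or.inr hw)
            exact pow_mem hw' _
        · exact Subring.subset_closure (Or.inr hz)
  · -- independence, exponent one
    have hone : ∀ (F : Finset (B →₀ ℕ)) (c : (B →₀ ℕ) → k), (∀ γ ∈ F, ∀ b, γ b < p) →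
        ∑ γ ∈ F, c γ ^ p * pmon (fun b : B => (b : k)) γ = 0 → ∀ γ ∈ F, c γ = 0 := by
      intro F c hF h
      obtain ⟨P, hP⟩ : ∃ P : MvPolynomial B k, P = ∑ γ ∈ F, MvPolynomial.monomial γ (c γ) := ⟨_, rfl⟩
      have hcoef : ∀ γ, P.coeff γ = if γ ∈ F then c γ else 0 := by
        intro γ
        rw [hP, MvPolynomial.coeff_sum]
        simp only [MvPolynomial.coeff_monomial]
        rw [Finset.sum_ite_eq' F γ]
      have hdeg : ∀ b, P.degreeOf b < p := by
        intro b
        rw [MvPolynomial.degreeOf_lt_iff hp.pos]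
        intro m hm
        rw [MvPolynomial.mem_support_iff, hcoef] at hm
        by_cases hmF : m ∈ F
        · exact hF m hmF b
        · simp [hmF] at hm
      have hev : MvPolynomial.eval₂Hom (frobenius k p) (fun b : B => (b : k)) P = 0 := by
        rw [hP, map_sum, ← h]
        refine Finset.sum_congr rfl fun γ _ => ?_
        rw [MvPolynomial.coe_eval₂Hom, MvPolynomial.eval₂_monomial]
        rfl
      have hP0 : P = 0 := by
        obtain ⟨N, e, he⟩ : ∃ (N : ℕ) (e : Fin N ↪o B), Set.range e = P.vars :=
          ⟨_, P.vars.orderEmbOfFin rfl, by simp⟩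
        obtain ⟨Q, rfl⟩ := MvPolynomial.exists_rename_eq_of_vars_subset_range P
          (fun i => e (Fin.rev i)) (e.injective.comp Fin.rev_injective) (by
            rw [← he]
            rintro _ ⟨i, rfl⟩
            exact ⟨Fin.rev i, by simp⟩)
        have hinj : Function.Injective (fun i => e (Fin.rev i)) :=
          e.injective.comp Fin.rev_injective
        rw [ind_fin hp N (fun i => (e (Fin.rev i) : k)) ?_ Q ?_ ?_, map_zero]
        · intro i hi
          have h1 : (e (Fin.rev i) : k) ∈ B := (e (Fin.rev i)).2
          have hB' : ∀ z ∈ B, z ∉ Subfield.closure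
              (Set.range (fun a : k => a ^ p) ∪ {a' | a' < z}) := by
            intro z hz
            rw [hB] at hz
            exact hz
          apply hB' _ h1
          refine Subfield.closure_mono ?_ hi
          refine Set.union_subset_union_right _ ?_
          rintro _ ⟨j, hj, rfl⟩
          have : e (Fin.rev j) < e (Fin.rev i) := e.lt_iff_lt.mpr (Fin.rev_lt_rev.mpr hj)
          exact this
        · intro i
          rw [← MvPolynomial.degreeOf_rename_of_injective hinj]
          exact hdeg _
        · rw [MvPolynomial.coe_eval₂Hom, MvPolynomial.eval₂_rename] at hev
          exact hev
      intro γ hγ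
      have := hcoef γ
      rw [hP0, if_pos hγ] at this
      simpa using this.symm
    intro s
    induction s with
    | zero =>
      intro F c hF h γ hγ
      have h0 : ∀ δ ∈ F, δ = 0 := fun δ hδ => Finsupp.ext fun b => by
        have := hF δ hδ b
        simpa using this
      have hF0 : F = {0} := by
        ext δ
        constructor
        · intro hδ; rw [h0 δ hδ]; simp
        · intro hδ
          rw [Finset.mem_singleton] at hδ
          rw [hδ, ← h0 γ hγ]; exact hγ
      rw [hF0] at h
      rw [h0 γ hγ]
      simpa [pmon] using h
    | succ s ih =>
      -- version with an injective index
      have ih' : ∀ (G : Finset (B →₀ ℕ)) (f : (B →₀ ℕ) → (B →₀ ℕ)) (c : (B →₀ ℕ) → k),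
          Set.InjOn f G → (∀ γ ∈ G, ∀ b, f γ b < p ^ s) →
          ∑ γ ∈ G, c γ ^ p ^ s * pmon (fun b : B => (b : k)) (f γ) = 0 → ∀ γ ∈ G, c γ = 0 := by
        intro G f c hf hG h γ hγ
        have hc : ∀ δ ∈ G, c (Function.invFunOn f G (f δ)) = c δ := fun δ hδ => by
          rw [hf.leftInvOn_invFunOn hδ]
        rw [← hc γ hγ]
        refine ih (G.image f) (fun δ => c (Function.invFunOn f G δ)) ?_ ?_ (f γ)
          (Finset.mem_image_of_mem f hγ)
        · intro δ hδ
          obtain ⟨ε, hε, rfl⟩ := Finset.mem_image.mp hδ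
          exact hG ε hε
        · rw [Finset.sum_image hf, ← h]
          exact Finset.sum_congr rfl fun δ hδ => by rw [hc δ hδ]
      intro F c hF h
      obtain ⟨rd, hrd⟩ : ∃ rd : (B →₀ ℕ) → (B →₀ ℕ), ∀ γ b, rd γ b = γ b % p :=
        ⟨fun γ => γ.mapRange (· % p) (by simp), fun γ b => rfl⟩
      obtain ⟨dv, hdv⟩ : ∃ dv : (B →₀ ℕ) → (B →₀ ℕ), ∀ γ b, dv γ b = γ b / p :=
        ⟨fun γ => γ.mapRange (· / p) (by simp), fun γ b => rfl⟩
      have hsplit : ∀ γ, γ = p • dv γ + rd γ := fun γ => Finsupp.ext fun b => by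
        simp only [Finsupp.add_apply, Finsupp.smul_apply, hrd, hdv, smul_eq_mul]
        exact (Nat.div_add_mod _ _).symm
      have h2 : ∑ ε ∈ F.image rd, (∑ γ ∈ F with rd γ = ε,
          c γ ^ p ^ s * pmon (fun b : B => (b : k)) (dv γ)) ^ p *
            pmon (fun b : B => (b : k)) ε = 0 := by
        have e := Finset.sum_fiberwise_of_maps_to (s := F) (t := F.image rd) (g := rd)
          (fun γ hγ => Finset.mem_image_of_mem rd hγ)
          (fun γ => c γ ^ p ^ (s + 1) * pmon (fun b : B => (b : k)) γ)
        rw [h] at e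
        rw [← e]
        refine Finset.sum_congr rfl fun ε _ => ?_
        rw [← frobenius_def, map_sum, Finset.sum_mul]
        refine Finset.sum_congr rfl fun γ hγ => ?_
        have hγε : rd γ = ε := (Finset.mem_filter.mp hγ).2
        rw [frobenius_def, mul_pow, ← pow_mul, ← pow_succ, ← pmon_nsmul, mul_assoc, ← pmon_add,
          ← hγε, ← hsplit]
      have h3 := hone _ _ (by
        intro ε hε b
        obtain ⟨γ, _, rfl⟩ := Finset.mem_image.mp hε
        rw [hrd]
        exact Nat.mod_lt _ hp.pos) h2
      intro γ hγ
      have h4 := h3 (rd γ) (Finset.mem_image_of_mem rd hγ)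
      refine ih' _ dv c ?_ ?_ h4 γ (by simp [hγ])
      · intro δ hδ δ' hδ' hdd
        have e1 := (Finset.mem_filter.mp hδ).2
        have e2 := (Finset.mem_filter.mp hδ').2
        rw [hsplit δ, hsplit δ', e1, e2, hdd]
      · intro δ hδ b
        rw [hdv]
        have := hF δ (Finset.mem_filter.mp hδ).1 b
        rw [pow_succ] at this
        exact Nat.div_lt_of_lt_mul (by rw [mul_comm]; exact this)

end pbasis

end P4asec

section P4bsec
section cohen

structure CohenData (p : ℕ) (O k B : Type*) [CommRing O] [Field k] where
  N : ℕ → Ideal O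
  M : ℕ → Ideal O
  res : O →+* k
  β : B → O
  prime : p.Prime
  res_surj : Function.Surjective res
  N0 : N 0 = ⊤
  Nmul : ∀ i j a b, a ∈ N i → b ∈ N j → a * b ∈ N (i + j)
  Nanti : Antitone N
  res_iff : ∀ a, res a = 0 ↔ a ∈ N 1
  p_mem : (p : O) ∈ N 1
  complete : ∀ v : ℕ → O, (∀ s, v (s + 1) - v s ∈ N (s + 1)) → ∃ w, ∀ s, w - v s ∈ N (s + 1)
  sep : ∀ a, (∀ t, a ∈ N t) → a = 0
  NM : ∀ t, N t ≤ M t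
  M1 : M 1 ≤ N 1
  pM : ∀ t w, (p : O) * w ∈ M (t + 1) → w ∈ M t
  gen : ∀ s : ℕ, Subring.closure (Set.range (fun a : k => a ^ p ^ s) ∪
    Set.range (fun b => res (β b))) = ⊤
  indep : ∀ (s : ℕ) (F : Finset (B →₀ ℕ)) (c : (B →₀ ℕ) → k), (∀ γ ∈ F, ∀ b, γ b < p ^ s) →
    ∑ γ ∈ F, c γ ^ p ^ s * pmon (fun b => res (β b)) γ = 0 → ∀ γ ∈ F, c γ = 0

namespace CohenData

variable {p : ℕ} {O k B : Type*} [CommRing O] [Field k] (D : CohenData p O k B)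

def Vs (s : ℕ) : Subring O :=
  Subring.closure (Set.range (fun o : O => o ^ p ^ s) ∪ Set.range D.β ∪ (D.N (s + 1) : Set O))

def V : Subring O := ⨅ s, D.Vs s

theorem mem_V {v : O} : v ∈ D.V ↔ ∀ s, v ∈ D.Vs s := Subring.mem_iInf

theorem N_pow {a : O} (ha : a ∈ D.N 1) (i : ℕ) : a ^ i ∈ D.N i := by
  induction i with
  | zero => rw [D.N0]; trivial
  | succ i ih => rw [pow_succ]; exact D.Nmul _ _ _ _ ih ha

theorem p_pow_mul {a : O} {t : ℕ} (ha : a ∈ D.N t) (i : ℕ) : (p : O) ^ i * a ∈ D.N (i + t) :=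
  D.Nmul _ _ _ _ (D.N_pow D.p_mem i) ha

theorem pow_mem_Vs (s : ℕ) (o : O) : o ^ p ^ s ∈ D.Vs s :=
  Subring.subset_closure (Or.inl (Or.inl ⟨o, rfl⟩))

theorem β_mem_Vs (s : ℕ) (b : B) : D.β b ∈ D.Vs s :=
  Subring.subset_closure (Or.inl (Or.inr ⟨b, rfl⟩))

theorem N_le_Vs {s : ℕ} {a : O} (h : a ∈ D.N (s + 1)) : a ∈ D.Vs s :=
  Subring.subset_closure (Or.inr h)

theorem Vs_succ (s : ℕ) : D.Vs (s + 1) ≤ D.Vs s := by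
  unfold Vs
  rw [Subring.closure_le]
  rintro z ((⟨o, rfl⟩ | ⟨b, rfl⟩) | h)
  · have := D.pow_mem_Vs s (o ^ p)
    rw [← pow_mul, ← pow_succ'] at this
    exact this
  · exact D.β_mem_Vs s b
  · exact D.N_le_Vs (D.Nanti (by omega) h)

theorem Vs_anti : Antitone D.Vs := antitone_nat_of_succ_le D.Vs_succ

theorem exists_approx (s : ℕ) (o : O) : ∃ P ∈ D.Vs s, o - P ∈ D.N 1 := by
  have h : D.res o ∈ (D.Vs s).map D.res := by
    have h1 : (⊤ : Subring k) ≤ (D.Vs s).map D.res := by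
      rw [← D.gen s, Subring.closure_le]
      rintro z (⟨a, rfl⟩ | ⟨b, rfl⟩)
      · obtain ⟨o, rfl⟩ := D.res_surj a
        exact ⟨o ^ p ^ s, D.pow_mem_Vs s o, map_pow _ _ _⟩
      · exact ⟨D.β b, D.β_mem_Vs s b, rfl⟩
    exact h1 trivial
  obtain ⟨P, hP, hPo⟩ := h
  exact ⟨P, hP, by rw [← D.res_iff, map_sub, hPo, sub_self]⟩

theorem pow_congr {a b : O} (h : a - b ∈ D.N 1) (t : ℕ) : a ^ p ^ t - b ^ p ^ t ∈ D.N (t + 1) := by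
  induction t with
  | zero => simpa using h
  | succ t ih =>
    obtain ⟨a', ha'⟩ : ∃ a', a' = a ^ p ^ t := ⟨_, rfl⟩
    obtain ⟨b', hb'⟩ : ∃ b', b' = b ^ p ^ t := ⟨_, rfl⟩
    rw [pow_succ, pow_mul, pow_mul, ← ha', ← hb', ← geom_sum₂_mul, mul_comm]
    rw [← ha', ← hb'] at ih
    refine D.Nmul _ _ _ _ ih ?_
    rw [← D.res_iff]
    have h1 : D.res a' = D.res b' := by
      rw [← sub_eq_zero, ← map_sub, D.res_iff]
      exact D.Nanti (by omega) ih
    rw [map_sum]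
    have h2 : ∀ i ∈ Finset.range p, D.res (a' ^ i * b' ^ (p - 1 - i)) = D.res b' ^ (p - 1) := by
      intro i hi
      rw [map_mul, map_pow, map_pow, h1, ← pow_add]
      congr 1
      have := Finset.mem_range.mp hi
      omega
    rw [Finset.sum_congr rfl h2, Finset.sum_const, Finset.card_range, nsmul_eq_mul]
    have h3 : ((p : ℕ) : k) = 0 := by
      rw [← map_natCast D.res, D.res_iff]
      exact D.p_mem
    rw [h3, zero_mul]

theorem W (j t : ℕ) (o : O) : (p : O) ^ j * o ^ p ^ t ∈ D.Vs (j + t) := by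
  obtain ⟨P, hP, hoP⟩ := D.exists_approx (j + t) o
  have h1 := D.p_pow_mul (D.pow_congr hoP t) j
  have h2 : (p : O) ^ j * o ^ p ^ t = (p : O) ^ j * P ^ p ^ t +
      (p : O) ^ j * (o ^ p ^ t - P ^ p ^ t) := by ring
  rw [h2]
  refine add_mem (mul_mem (pow_mem (natCast_mem _ _) _) (pow_mem hP _)) (D.N_le_Vs ?_)
  rw [add_assoc]; exact h1

theorem Vs_step {s : ℕ} {v : O} (hv : v ∈ D.Vs s) : ∃ v' ∈ D.Vs (s + 1), v - v' ∈ D.N (s + 1) := by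
  unfold Vs at hv
  induction hv using Subring.closure_induction with
  | mem z hz =>
    rcases hz with (⟨o, rfl⟩ | ⟨b, rfl⟩) | h
    · obtain ⟨P, hP, hoP⟩ := D.exists_approx (s + 1) o
      exact ⟨P ^ p ^ s, pow_mem hP _, D.pow_congr hoP s⟩
    · exact ⟨D.β b, D.β_mem_Vs _ b, by simp⟩
    · exact ⟨0, zero_mem _, by simpa using h⟩
  | zero => exact ⟨0, zero_mem _, by simp⟩
  | one => exact ⟨1, one_mem _, by simp⟩
  | add x y _ _ hx hy =>
    obtain ⟨x', hx', hx⟩ := hx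
    obtain ⟨y', hy', hy⟩ := hy
    exact ⟨x' + y', add_mem hx' hy', by
      have := add_mem hx hy
      rwa [← add_sub_add_comm] at this⟩
  | neg x _ hx =>
    obtain ⟨x', hx', hx⟩ := hx
    exact ⟨-x', neg_mem hx', by
      have := neg_mem hx
      rwa [neg_sub', ] at this⟩
  | mul x y _ _ hx hy =>
    obtain ⟨x', hx', hx⟩ := hx
    obtain ⟨y', hy', hy⟩ := hy
    refine ⟨x' * y', mul_mem hx' hy', ?_⟩
    have h : x * y - x' * y' = x * (y - y') + (x - x') * y' := by ring
    rw [h]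
    exact add_mem (Ideal.mul_mem_left _ _ hy) (Ideal.mul_mem_right _ _ hx)

theorem complete' (s : ℕ) (u : ℕ → O) (h : ∀ i, u (i + 1) - u i ∈ D.N (s + i + 1)) :
    ∃ w, ∀ i, w - u i ∈ D.N (s + i + 1) := by
  obtain ⟨w, hw⟩ := D.complete (fun j => u (j - s)) (by
    intro j
    rcases Nat.lt_or_ge j s with hj | hj
    · rw [show j + 1 - s = 0 by omega, show j - s = 0 by omega, sub_self]
      exact zero_mem _
    · obtain ⟨i, rfl⟩ := Nat.exists_eq_add_of_le hj
      rw [show s + i + 1 - s = i + 1 by omega, show s + i - s = i by omega]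
      exact h i)
  refine ⟨w, fun i => ?_⟩
  have := hw (s + i)
  rwa [show s + i - s = i by omega] at this

theorem mem_V_of_approx (s : ℕ) (u : ℕ → O) (w : O) (hu : ∀ i, u i ∈ D.Vs (s + i))
    (hw : ∀ i, w - u i ∈ D.N (s + i + 1)) : w ∈ D.V := by
  rw [mem_V]
  intro i
  apply D.Vs_anti (show i ≤ s + i by omega)
  have h : w = u i + (w - u i) := by ring
  rw [h]
  exact add_mem (hu i) (D.N_le_Vs (hw i))

theorem exists_seq (s : ℕ) (v : O) (hv : v ∈ D.Vs s) : ∃ u : ℕ → O, u 0 = v ∧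
    (∀ i, u i ∈ D.Vs (s + i)) ∧ ∀ i, u (i + 1) - u i ∈ D.N (s + i + 1) := by
  have hstep : ∀ (i : ℕ) (z : D.Vs (s + i)), ∃ z' : D.Vs (s + (i + 1)),
      (z' : O) - z ∈ D.N (s + i + 1) := by
    intro i z
    obtain ⟨v', hv', h⟩ := D.Vs_step z.2
    refine ⟨⟨v', hv'⟩, ?_⟩
    have := neg_mem h
    rwa [neg_sub] at this
  choose f hf using hstep
  refine ⟨fun i => ((Nat.rec ⟨v, hv⟩ (fun i z => f i z) i : D.Vs (s + i)) : O), rfl,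
    fun i => Subtype.property _, fun i => hf i _⟩

theorem exists_V {s : ℕ} {v : O} (hv : v ∈ D.Vs s) : ∃ v' ∈ D.V, v - v' ∈ D.N (s + 1) := by
  obtain ⟨u, hu0, hu, hd⟩ := D.exists_seq s v hv
  obtain ⟨w, hw⟩ := D.complete' s u hd
  refine ⟨w, D.mem_V_of_approx s u w hu hw, ?_⟩
  have := neg_mem (hw 0)
  rwa [hu0, neg_sub, add_zero] at this

theorem V_surj (a : k) : ∃ v ∈ D.V, D.res v = a := by
  obtain ⟨o, rfl⟩ := D.res_surj a
  obtain ⟨v, hv, h⟩ := D.exists_V (s := 0) (v := o) (by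
    have := D.pow_mem_Vs 0 o
    simpa using this)
  refine ⟨v, hv, ?_⟩
  rw [← D.res_iff, map_sub, sub_eq_zero] at h
  exact h.symm

theorem choose_dvd {p : ℕ} (hp : p.Prime) (s i : ℕ) (hi0 : i ≠ 0) (hi : i < p ^ s) :
    ∃ v i' c, v < s ∧ i = p ^ v * i' ∧ (p ^ s).choose i = p ^ (s - v) * c := by
  obtain ⟨v, i', hi', rfl⟩ := Nat.exists_eq_pow_mul_and_not_dvd hi0 p hp.ne_one
  have hv : v < s := by
    by_contra hcon
    have h1 : p ^ s ≤ p ^ v := Nat.pow_le_pow_right hp.pos (by omega)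
    have h2 : 1 ≤ i' := Nat.one_le_iff_ne_zero.mpr (by rintro rfl; simp at hi0)
    have h3 := Nat.mul_le_mul_left (p ^ v) h2
    rw [mul_one] at h3
    exact absurd (h1.trans h3) (not_le.mpr hi)
  have hdvd : p ^ (s - v) ∣ (p ^ s).choose (p ^ v * i') := by
    have h1 : (p ^ v * i') * (p ^ s).choose (p ^ v * i') =
        p ^ s * (p ^ s - 1).choose (p ^ v * i' - 1) := by
      have h := Nat.add_one_mul_choose_eq (p ^ s - 1) (p ^ v * i' - 1)
      have e1 : p ^ s - 1 + 1 = p ^ s := Nat.sub_add_cancel (Nat.one_le_pow _ _ hp.pos)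
      have e2 : p ^ v * i' - 1 + 1 = p ^ v * i' := Nat.sub_add_cancel (Nat.one_le_iff_ne_zero.mpr hi0)
      simp only [e1, e2] at h
      rw [h, mul_comm]
    have h2 : i' * (p ^ s).choose (p ^ v * i') =
        p ^ (s - v) * (p ^ s - 1).choose (p ^ v * i' - 1) := by
      have h3 : p ^ s = p ^ v * p ^ (s - v) := by rw [← pow_add]; congr 1; omega
      apply Nat.eq_of_mul_eq_mul_left (pow_pos hp.pos v)
      rw [← mul_assoc, h1, ← mul_assoc, ← h3]
    refine Nat.Coprime.dvd_of_dvd_mul_left (m := i') ?_ ⟨_, h2⟩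
    exact Nat.Coprime.pow_left _ ((Nat.Prime.coprime_iff_not_dvd hp).mpr hi')
  obtain ⟨c, hc⟩ := hdvd
  exact ⟨v, i', c, hv, rfl, hc⟩

theorem add_pow_V (s : ℕ) (a b : O) : ∃ w ∈ D.Vs s,
    (a + b) ^ p ^ (s + 1) = a ^ p ^ (s + 1) + b ^ p ^ (s + 1) + p * w := by
  have hp := D.prime
  have hterm : ∀ i ∈ (Finset.range (p ^ (s + 1))).erase 0, ∃ w ∈ D.Vs s,
      a ^ i * b ^ (p ^ (s + 1) - i) * ((p ^ (s + 1)).choose i : O) = p * w := by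
    intro i hi
    rw [Finset.mem_erase, Finset.mem_range] at hi
    obtain ⟨v, i', c, hv, hi', hc⟩ := choose_dvd hp (s + 1) i hi.1 hi.2
    have hsv : s + 1 - v = (s - v) + 1 := by omega
    have e : p ^ (s + 1) - i = p ^ v * (p ^ (s + 1 - v) - i') := by
      rw [Nat.mul_sub, ← pow_add, ← hi']; congr 2; omega
    refine ⟨(p : O) ^ (s - v) * (a ^ i' * b ^ (p ^ (s + 1 - v) - i')) ^ p ^ v * c,
      mul_mem ?_ (natCast_mem _ _), ?_⟩
    · have := D.W (s - v) v (a ^ i' * b ^ (p ^ (s + 1 - v) - i'))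
      rwa [show s - v + v = s by omega] at this
    · rw [hc, e, hi', pow_mul', pow_mul', hsv]
      push_cast
      ring
  choose! f hf1 hf2 using hterm
  refine ⟨∑ i ∈ (Finset.range (p ^ (s + 1))).erase 0, f i, sum_mem hf1, ?_⟩
  rw [add_pow, Finset.sum_range_succ, Finset.mul_sum, ← Finset.sum_congr rfl hf2,
    ← Finset.add_sum_erase _ _ (Finset.mem_range.mpr (pow_pos hp.pos (s + 1)))]
  simp only [pow_zero, one_mul, Nat.sub_zero, Nat.choose_zero_right, Nat.cast_one, mul_one,
    Nat.sub_self, Nat.choose_self]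
  ring

end CohenData

end cohen

end P4bsec

section P4csec
section cohen2

namespace CohenData

variable {p : ℕ} {O k B : Type*} [CommRing O] [Field k] (D : CohenData p O k B)

def II (s : ℕ) : AddSubgroup O where
  carrier := {z | ∃ w ∈ D.Vs s, z - p * w ∈ D.N (s + 2)}
  zero_mem' := ⟨0, zero_mem _, by simp⟩
  add_mem' := by
    rintro a b ⟨w, hw, h⟩ ⟨w', hw', h'⟩
    refine ⟨w + w', add_mem hw hw', ?_⟩
    have := add_mem h h'
    rwa [show a - p * w + (b - p * w') = a + b - p * (w + w') by ring] at this
  neg_mem' := by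
    rintro a ⟨w, hw, h⟩
    refine ⟨-w, neg_mem hw, ?_⟩
    have := neg_mem h
    rwa [show -(a - p * w) = -a - p * (-w) by ring] at this

theorem II_mul {s : ℕ} {m z : O} (hm : m ∈ D.Vs s) (hz : z ∈ D.II s) : m * z ∈ D.II s := by
  obtain ⟨w, hw, h⟩ := hz
  refine ⟨m * w, mul_mem hm hw, ?_⟩
  have := Ideal.mul_mem_left _ m h
  rwa [show m * (z - p * w) = m * z - p * (m * w) by ring] at this

theorem II_N {s : ℕ} {z : O} (hz : z ∈ D.N (s + 2)) : z ∈ D.II s :=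
  ⟨0, zero_mem _, by simpa using hz⟩

theorem II_p {s : ℕ} {w : O} (hw : w ∈ D.Vs s) : (p : O) * w ∈ D.II s :=
  ⟨w, hw, by simp⟩

theorem pmon_mem (s : ℕ) (γ : B →₀ ℕ) : pmon D.β γ ∈ D.Vs s :=
  prod_mem fun b _ => pow_mem (D.β_mem_Vs s b) _

def Rep (s : ℕ) (z : O) : Prop := ∃ (F : Finset (B →₀ ℕ)) (f : (B →₀ ℕ) → O),
  (∀ γ ∈ F, ∀ b, γ b < p ^ (s + 1)) ∧ (∀ γ, γ ∉ F → f γ = 0) ∧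
  z - ∑ γ ∈ F, f γ ^ p ^ (s + 1) * pmon D.β γ ∈ D.II s

theorem Rep_add {s : ℕ} {z z' : O} (h : D.Rep s z) (h' : D.Rep s z') : D.Rep s (z + z') := by
  classical
  obtain ⟨F, f, hF, hf, hz⟩ := h
  obtain ⟨F', f', hF', hf', hz'⟩ := h'
  have hq : p ^ (s + 1) ≠ 0 := pow_ne_zero _ D.prime.ne_zero
  refine ⟨F ∪ F', fun γ => f γ + f' γ, ?_, ?_, ?_⟩
  · intro γ hγ
    rcases Finset.mem_union.mp hγ with h | h
    · exact hF γ h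
    · exact hF' γ h
  · intro γ hγ
    rw [Finset.mem_union, not_or] at hγ
    simp only [hf γ hγ.1, hf' γ hγ.2, add_zero]
  · have e1 : ∑ γ ∈ F, f γ ^ p ^ (s + 1) * pmon D.β γ =
        ∑ γ ∈ F ∪ F', f γ ^ p ^ (s + 1) * pmon D.β γ :=
      Finset.sum_subset Finset.subset_union_left fun γ _ h => by rw [hf γ h, zero_pow hq, zero_mul]
    have e2 : ∑ γ ∈ F', f' γ ^ p ^ (s + 1) * pmon D.β γ =
        ∑ γ ∈ F ∪ F', f' γ ^ p ^ (s + 1) * pmon D.β γ :=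
      Finset.sum_subset Finset.subset_union_right
        fun γ _ h => by rw [hf' γ h, zero_pow hq, zero_mul]
    rw [e1] at hz
    rw [e2] at hz'
    have h3 : ∑ γ ∈ F ∪ F', ((f γ + f' γ) ^ p ^ (s + 1) * pmon D.β γ -
        f γ ^ p ^ (s + 1) * pmon D.β γ - f' γ ^ p ^ (s + 1) * pmon D.β γ) ∈ D.II s := by
      refine sum_mem fun γ _ => ?_
      obtain ⟨w, hw, h⟩ := D.add_pow_V s (f γ) (f' γ)
      rw [h]
      have := D.II_mul (D.pmon_mem s γ) (D.II_p hw)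
      convert this using 1
      ring
    rw [Finset.sum_sub_distrib, Finset.sum_sub_distrib] at h3
    have := sub_mem (add_mem hz hz') h3
    convert this using 1
    ring

theorem Rep_of_II {s : ℕ} {z : O} (h : z ∈ D.II s) : D.Rep s z :=
  ⟨∅, 0, by simp, by simp, by simpa using h⟩

theorem Rep_mon (s : ℕ) (o : O) (γ : B →₀ ℕ) : D.Rep s (o ^ p ^ (s + 1) * pmon D.β γ) := by
  classical
  have hq : 0 < p ^ (s + 1) := pow_pos D.prime.pos _
  obtain ⟨δ, hδ⟩ : ∃ δ : B →₀ ℕ, ∀ b, δ b = γ b / p ^ (s + 1) :=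
    ⟨γ.mapRange (· / p ^ (s + 1)) (by simp), fun b => by simp⟩
  obtain ⟨ε, hε⟩ : ∃ ε : B →₀ ℕ, ∀ b, ε b = γ b % p ^ (s + 1) :=
    ⟨γ.mapRange (· % p ^ (s + 1)) (Nat.zero_mod _), fun b => Finsupp.mapRange_apply ..⟩
  have hγ : γ = p ^ (s + 1) • δ + ε := by
    ext b
    simp [hδ, hε, Nat.div_add_mod]
  refine ⟨{ε}, fun γ => if γ = ε then o * pmon D.β δ else 0, ?_, ?_, ?_⟩
  · intro γ' hγ' b
    rw [Finset.mem_singleton] at hγ'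
    rw [hγ', hε]
    exact Nat.mod_lt _ hq
  · intro γ' hγ'
    rw [Finset.mem_singleton] at hγ'
    simp [hγ']
  · rw [Finset.sum_singleton, hγ, pmon_add, pmon_nsmul]
    simp only [if_true]
    convert zero_mem (D.II s) using 1
    ring

theorem Rep_neg {s : ℕ} {z : O} (h : D.Rep s z) : D.Rep s (-z) := by
  obtain ⟨F, f, hF, hf, hz⟩ := h
  refine ⟨F, fun γ => -f γ, hF, fun γ hγ => by simp [hf γ hγ], ?_⟩
  have hq : p ^ (s + 1) ≠ 0 := pow_ne_zero _ D.prime.ne_zero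
  have h3 : ∑ γ ∈ F, ((-f γ) ^ p ^ (s + 1) * pmon D.β γ +
        f γ ^ p ^ (s + 1) * pmon D.β γ) ∈ D.II s := by
    refine sum_mem fun γ _ => ?_
    obtain ⟨w, hw, h⟩ := D.add_pow_V s (-f γ) (f γ)
    rw [neg_add_cancel, zero_pow hq] at h
    have := neg_mem (D.II_mul (D.pmon_mem s γ) (D.II_p hw))
    convert this using 1
    linear_combination pmon D.β γ * (-h)
  rw [Finset.sum_add_distrib] at h3
  have := neg_mem (add_mem hz h3)
  convert this using 1
  ring

theorem Rep_Vs {s : ℕ} {z : O} (h : z ∈ D.Vs (s + 1)) : D.Rep s z := by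
  unfold Vs at h
  rw [Subring.mem_closure_iff] at h
  induction h using AddSubgroup.closure_induction with
  | zero => exact D.Rep_of_II (zero_mem _)
  | add x y _ _ hx hy => exact D.Rep_add hx hy
  | neg x _ hx => exact D.Rep_neg hx
  | mem z hz =>
    have : z ∈ D.N (s + 2) ∨ ∃ (o : O) (γ : B →₀ ℕ), z = o ^ p ^ (s + 1) * pmon D.β γ := by
      change z ∈ Submonoid.closure _ at hz
      induction hz using Submonoid.closure_induction with
      | mem z hz =>
        rcases hz with (⟨o, rfl⟩ | ⟨b, rfl⟩) | h
        · exact Or.inr ⟨o, 0, by simp [pmon]⟩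
        · exact Or.inr ⟨1, Finsupp.single b 1, by simp [pmon]⟩
        · exact Or.inl h
      | one => exact Or.inr ⟨1, 0, by simp [pmon]⟩
      | mul x y _ _ hx hy =>
        rcases hx with hx | ⟨o, γ, rfl⟩
        · exact Or.inl (Ideal.mul_mem_right _ _ hx)
        · rcases hy with hy | ⟨o', γ', rfl⟩
          · exact Or.inl (Ideal.mul_mem_left _ _ hy)
          · exact Or.inr ⟨o * o', γ + γ', by rw [pmon_add]; ring⟩
    rcases this with h | ⟨o, γ, rfl⟩
    · exact D.Rep_of_II (D.II_N h)
    · exact D.Rep_mon s o γ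

theorem L10 {s : ℕ} {v : O} (hv : v ∈ D.Vs (s + 1)) (h1 : v ∈ D.N 1) :
    ∃ w ∈ D.Vs s, v - p * w ∈ D.N (s + 2) := by
  obtain ⟨F, f, hF, hf, w, hw, hz⟩ := D.Rep_Vs hv
  have hres : D.res (∑ γ ∈ F, f γ ^ p ^ (s + 1) * pmon D.β γ) = 0 := by
    rw [← D.res_iff] at h1
    have h2 := (D.res_iff _).mpr (D.Nanti (show 1 ≤ s + 2 by omega) hz)
    have h3 : D.res (p : O) = 0 := (D.res_iff _).mpr D.p_mem
    rw [map_sub, map_sub, map_mul, h1, h3] at h2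
    simpa using h2
  have h0 := D.indep (s + 1) F (fun γ => D.res (f γ)) hF (by
    rw [← hres, map_sum]
    refine Finset.sum_congr rfl fun γ _ => ?_
    rw [map_mul, map_pow]
    congr 1
    simp only [pmon, Finsupp.prod, map_prod, map_pow])
  have hs : ∑ γ ∈ F, f γ ^ p ^ (s + 1) * pmon D.β γ ∈ D.N (s + 2) := by
    refine sum_mem fun γ hγ => Ideal.mul_mem_right _ _ ?_
    have := D.N_pow ((D.res_iff _).mp (h0 γ hγ)) (p ^ (s + 1))
    exact D.Nanti (Nat.succ_le_of_lt (Nat.lt_pow_self D.prime.one_lt)) this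
  refine ⟨w, hw, ?_⟩
  have := add_mem hz hs
  convert this using 1
  ring

theorem M_anti : Antitone D.M :=
  antitone_nat_of_succ_le fun t _ hv => D.pM t _ (Ideal.mul_mem_left _ _ hv)

theorem L11 : ∀ (t s : ℕ) (v : O), t ≤ s + 1 → v ∈ D.Vs s → v ∈ D.M t → v ∈ D.N t := by
  intro t
  induction t with
  | zero => intro s v _ _ _; rw [D.N0]; trivial
  | succ t ih =>
    intro s v hs hv hM
    cases t with
    | zero => exact D.M1 hM
    | succ t =>
      obtain ⟨s, rfl⟩ : ∃ s', s = s' + 1 := ⟨s - 1, by omega⟩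
      have h1 : v ∈ D.N 1 := D.M1 (D.M_anti (show 1 ≤ t + 1 + 1 by omega) hM)
      obtain ⟨w, hw, h⟩ := D.L10 hv h1
      have hN : v - p * w ∈ D.N (t + 2) := D.Nanti (by omega) h
      have hw' : w ∈ D.M (t + 1) := by
        apply D.pM
        have := sub_mem hM (D.NM _ hN)
        rwa [sub_sub_cancel] at this
      have := D.p_pow_mul (ih s w (by omega) hw hw') 1
      rw [pow_one, add_comm] at this
      have := add_mem hN this
      rwa [sub_add_cancel] at this

theorem V_le (s : ℕ) : D.V ≤ D.Vs s := fun _ h => D.mem_V.mp h s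

theorem L14 (z : ℕ → O) (hz : ∀ s, z s ∈ D.Vs s) (hd : ∀ s, z (s + 1) - z s ∈ D.M (s + 1)) :
    ∃ w ∈ D.V, ∀ s, w - z s ∈ D.M (s + 1) := by
  have h : ∀ s, ∃ v ∈ D.V, z s - v ∈ D.N (s + 1) := fun s => D.exists_V (hz s)
  choose v hv hzv using h
  have hvd : ∀ s, v (s + 1) - v s ∈ D.N (s + 1) := by
    intro s
    refine D.L11 (s + 1) (s + 1) _ (by omega) (D.V_le _ (sub_mem (hv _) (hv _))) ?_
    have h1 := D.NM _ (D.Nanti (show s + 1 ≤ s + 1 + 1 by omega) (hzv (s + 1)))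
    have h2 := D.NM _ (hzv s)
    have := add_mem (sub_mem h2 h1) (hd s)
    convert this using 1
    ring
  obtain ⟨w, hw⟩ := D.complete v hvd
  refine ⟨w, D.mem_V_of_approx 0 v w (fun i => D.V_le _ (hv i)) (fun i => by
    rw [zero_add]; exact hw i), fun s => ?_⟩
  have := D.NM _ (sub_mem (hw s) (hzv s))
  convert this using 1
  ring

theorem sep' {v : O} (hv : v ∈ D.V) (h : ∀ t, v ∈ D.M t) : v = 0 :=
  D.sep _ fun t => D.L11 t t v (by omega) (D.V_le t hv) (h t)

theorem L12 {v : O} (hv : v ∈ D.V) (h1 : v ∈ D.N 1) : ∃ w ∈ D.V, v = p * w := by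
  have h : ∀ s, ∃ w ∈ D.V, v - p * w ∈ D.N (s + 2) := by
    intro s
    obtain ⟨w, hw, h⟩ := D.L10 (D.V_le (s + 1) hv) h1
    obtain ⟨w', hw', h'⟩ := D.exists_V hw
    refine ⟨w', hw', ?_⟩
    have h2 := D.p_pow_mul h' 1
    rw [pow_one, show 1 + (s + 1) = s + 2 by ring] at h2
    have := add_mem h h2
    convert this using 1
    ring
  choose z hz hzd using h
  obtain ⟨w, hw, hwz⟩ := D.L14 z (fun s => D.V_le s (hz s)) (by
    intro s
    apply D.pM
    have := D.NM _ (sub_mem (hzd s) (D.Nanti (show s + 2 ≤ s + 1 + 2 by omega) (hzd (s + 1))))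
    convert this using 1
    ring)
  refine ⟨w, hw, sub_eq_zero.mp (D.sep' (sub_mem hv (mul_mem (natCast_mem _ _) hw)) ?_)⟩
  intro t
  have h3 := Ideal.mul_mem_left _ (p : O) (D.M_anti (show t ≤ t + 1 by omega) (hwz t))
  have h4 := D.M_anti (show t ≤ t + 2 by omega) (D.NM _ (hzd t))
  have := sub_mem h4 h3
  convert this using 1
  ring

theorem L13 : ∀ (t : ℕ) {v : O}, v ∈ D.V → v ∈ D.M t → ∃ w ∈ D.V, v = p ^ t * w := by
  intro t
  induction t with
  | zero => intro v hv _; exact ⟨v, hv, by simp⟩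
  | succ t ih =>
    intro v hv h
    obtain ⟨w, hw, rfl⟩ := D.L12 hv (D.M1 (D.M_anti (show 1 ≤ t + 1 by omega) h))
    obtain ⟨w', hw', rfl⟩ := ih hw (D.pM _ _ h)
    exact ⟨w', hw', by ring⟩

theorem V_complete (v : ℕ → O) (hv : ∀ s, v s ∈ D.V) (hd : ∀ s, v (s + 1) - v s ∈ D.N (s + 1)) :
    ∃ w ∈ D.V, ∀ s, w - v s ∈ D.N (s + 1) := by
  obtain ⟨w, hw⟩ := D.complete v hd
  exact ⟨w, D.mem_V_of_approx 0 v w (fun i => D.V_le _ (hv i)) (fun i => by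
    rw [zero_add]; exact hw i), hw⟩

end CohenData
end cohen2

end P4csec

section P4dsec
section cohen3

theorem complete_seq {S : Type*} [CommRing S] (I : Ideal S) [IsAdicComplete I S] (v : ℕ → S)
    (hv : ∀ s, v (s + 1) - v s ∈ I ^ (s + 1)) : ∃ w, ∀ s, w - v s ∈ I ^ (s + 1) := by
  have h1 : ∀ m d, v (m + d) - v m ∈ I ^ (m + 1) := by
    intro m d
    induction d with
    | zero => simp
    | succ d ih =>
      have := add_mem (Ideal.pow_le_pow_right (show m + 1 ≤ m + d + 1 by omega) (hv (m + d))) ih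
      rwa [sub_add_sub_cancel] at this
  obtain ⟨L, hL⟩ := IsPrecomplete.prec (I := I) (M := S) inferInstance (f := v) (by
    intro m n hmn
    obtain ⟨d, rfl⟩ := Nat.exists_eq_add_of_le hmn
    rw [SModEq.sub_mem, smul_eq_mul, Ideal.mul_top]
    have := neg_mem (Ideal.pow_le_pow_right (show m ≤ m + 1 by omega) (h1 m d))
    rwa [neg_sub] at this)
  refine ⟨L, fun s => ?_⟩
  have h2 := hL (s + 1)
  rw [SModEq.sub_mem, smul_eq_mul, Ideal.mul_top] at h2
  have := sub_mem (hv s) h2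
  convert this using 1
  ring

theorem hausdorff_zero {S : Type*} [CommRing S] (I : Ideal S) [IsAdicComplete I S] (a : S)
    (h : ∀ t, a ∈ I ^ t) : a = 0 := by
  refine IsHausdorff.haus (I := I) (M := S) inferInstance a fun n => ?_
  rw [SModEq.zero, smul_eq_mul, Ideal.mul_top]
  exact h n

theorem isAdicComplete_of_seq {S : Type*} [CommRing S] (I : Ideal S)
    (hs : ∀ a, (∀ t, a ∈ I ^ t) → a = 0)
    (hc : ∀ v : ℕ → S, (∀ s, v (s + 1) - v s ∈ I ^ (s + 1)) → ∃ w, ∀ s, w - v s ∈ I ^ (s + 1)) :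
    IsAdicComplete I S where
  haus' a h := hs a fun t => by
    have := h t
    rwa [SModEq.zero, smul_eq_mul, Ideal.mul_top] at this
  prec' f hf := by
    obtain ⟨w, hw⟩ := hc (fun s => f (s + 1)) (fun s => by
      have := hf (show s + 1 ≤ s + 1 + 1 by omega)
      rw [SModEq.sub_mem, smul_eq_mul, Ideal.mul_top] at this
      have := neg_mem this
      rwa [neg_sub] at this)
    refine ⟨w, fun n => ?_⟩
    rw [SModEq.sub_mem, smul_eq_mul, Ideal.mul_top]
    have h1 := hf (show n ≤ n + 1 by omega)
    rw [SModEq.sub_mem, smul_eq_mul, Ideal.mul_top] at h1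
    have := sub_mem h1 (Ideal.pow_le_pow_right (show n ≤ n + 1 by omega) (hw n))
    convert this using 1
    ring

variable {p : ℕ} {W K k R : Type*} [CommRing W] [Field K] [Field k] [CommRing R]

def cohenO (c : W →+* K) (j : k →+* K) (π : R →+* k) : Subring (W × R) :=
  RingHom.eqLocus (c.comp (RingHom.fst W R)) ((j.comp π).comp (RingHom.snd W R))

theorem mem_cohenO {c : W →+* K} {j : k →+* K} {π : R →+* k} {z : W × R} :
    z ∈ cohenO c j π ↔ c z.1 = j (π z.2) := Iff.rfl

def oFst (c : W →+* K) (j : k →+* K) (π : R →+* k) : cohenO c j π →+* W :=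
  (RingHom.fst W R).comp (cohenO c j π).subtype

def oSnd (c : W →+* K) (j : k →+* K) (π : R →+* k) : cohenO c j π →+* R :=
  (RingHom.snd W R).comp (cohenO c j π).subtype

theorem oComm (c : W →+* K) (j : k →+* K) (π : R →+* k) (z : cohenO c j π) :
    c (oFst c j π z) = j (π (oSnd c j π z)) := z.2

theorem exists_O (c : W →+* K) (j : k →+* K) (π : R →+* k) (w : W) (r : R) (h : c w = j (π r)) :
    ∃ z : cohenO c j π, oFst c j π z = w ∧ oSnd c j π z = r := ⟨⟨(w, r), h⟩, rfl, rfl⟩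

theorem O_ext (c : W →+* K) (j : k →+* K) (π : R →+* k) {z z' : cohenO c j π}
    (h1 : oFst c j π z = oFst c j π z') (h2 : oSnd c j π z = oSnd c j π z') : z = z' :=
  Subtype.ext (Prod.ext h1 h2)

theorem exists_cohenData [IsDomain W] (hp : p.Prime) (c : W →+* K) (j : k →+* K) (π : R →+* k)
    [CharP k p]
    (τ : K → W) (hτ : ∀ a, c (τ a) = a) (hc : RingHom.ker c = Ideal.span {(p : W)})
    (hpW : (p : W) ≠ 0)
    [IsAdicComplete (Ideal.span {(p : W)}) W] (m : Ideal R) (hm : RingHom.ker π = m)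
    [IsAdicComplete m R] (hπ : Function.Surjective π) :
    ∃ (B : Set k) (D : CohenData p (cohenO c j π) k B),
      (∀ t z, z ∈ D.N t ↔ oFst c j π z ∈ Ideal.span {(p : W)} ^ t ∧ oSnd c j π z ∈ m ^ t) ∧
      (∀ t z, z ∈ D.M t ↔ oFst c j π z ∈ Ideal.span {(p : W)} ^ t) ∧
      (∀ z, D.res z = π (oSnd c j π z)) ∧
      (∀ b, ∃ a, oFst c j π (D.β b) = τ a) := by
  obtain ⟨B, hB1, hB2⟩ := exists_pbasis k p hp
  have hpm : (p : R) ∈ m := by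
    rw [← hm, RingHom.mem_ker, map_natCast, CharP.cast_eq_zero]
  have hlift : ∀ b : k, ∃ z : cohenO c j π, oFst c j π z = τ (j b) ∧ π (oSnd c j π z) = b := by
    intro b
    obtain ⟨r, rfl⟩ := hπ b
    obtain ⟨z, h1, h2⟩ := exists_O c j π (τ (j (π r))) r (hτ _)
    exact ⟨z, h1, by rw [h2]⟩
  choose β hβ1 hβ2 using hlift
  refine ⟨B, {
    N := fun t => Ideal.comap (oFst c j π) (Ideal.span {(p : W)} ^ t) ⊓
      Ideal.comap (oSnd c j π) (m ^ t)
    M := fun t => Ideal.comap (oFst c j π) (Ideal.span {(p : W)} ^ t)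
    res := π.comp (oSnd c j π)
    β := fun b => β b
    prime := hp
    res_surj := ?_
    N0 := ?_
    Nmul := ?_
    Nanti := ?_
    res_iff := ?_
    p_mem := ?_
    complete := ?_
    sep := ?_
    NM := ?_
    M1 := ?_
    pM := ?_
    gen := ?_
    indep := ?_ }, ?_, ?_, ?_, ?_⟩
  · intro b
    exact ⟨β b, hβ2 b⟩
  · simp only [pow_zero, Ideal.one_eq_top, Ideal.comap_top, inf_idem]
  · rintro i j a b ⟨h1, h2⟩ ⟨h3, h4⟩
    constructor
    · rw [SetLike.mem_coe, Ideal.mem_comap, map_mul, pow_add]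
      exact Ideal.mul_mem_mul h1 h3
    · rw [SetLike.mem_coe, Ideal.mem_comap, map_mul, pow_add]
      exact Ideal.mul_mem_mul h2 h4
  · intro i j hij
    exact inf_le_inf (Ideal.comap_mono (Ideal.pow_le_pow_right hij))
      (Ideal.comap_mono (Ideal.pow_le_pow_right hij))
  · intro a
    rw [Ideal.mem_inf, Ideal.mem_comap, Ideal.mem_comap, pow_one, pow_one, ← hc, ← hm,
      RingHom.mem_ker, RingHom.mem_ker, oComm, RingHom.comp_apply]
    constructor
    · intro h; rw [h]; exact ⟨map_zero _, rfl⟩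
    · intro h; exact h.2
  · rw [Ideal.mem_inf, Ideal.mem_comap, Ideal.mem_comap, pow_one, pow_one, map_natCast,
      map_natCast]
    exact ⟨Ideal.mem_span_singleton_self _, hpm⟩
  · intro v hv
    obtain ⟨w, hw⟩ := complete_seq (Ideal.span {(p : W)}) (fun s => oFst c j π (v s)) (fun s => by
      rw [← map_sub]; exact (hv s).1)
    obtain ⟨r, hr⟩ := complete_seq m (fun s => oSnd c j π (v s)) (fun s => by
      rw [← map_sub]; exact (hv s).2)
    obtain ⟨z, rfl, rfl⟩ := exists_O c j π w r (by
      have h1 := hw 0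
      have h2 := hr 0
      rw [zero_add, pow_one, ← hc, RingHom.mem_ker, map_sub, sub_eq_zero] at h1
      rw [zero_add, pow_one, ← hm, RingHom.mem_ker, map_sub, sub_eq_zero] at h2
      rw [h1, h2, oComm])
    refine ⟨z, fun s => ⟨?_, ?_⟩⟩
    · rw [SetLike.mem_coe, Ideal.mem_comap, map_sub]; exact hw s
    · rw [SetLike.mem_coe, Ideal.mem_comap, map_sub]; exact hr s
  · intro a h
    apply O_ext
    · rw [map_zero]; exact hausdorff_zero _ _ fun t => (h t).1
    · rw [map_zero]; exact hausdorff_zero _ _ fun t => (h t).2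
  · intro t; exact inf_le_left
  · intro a ha
    refine ⟨ha, ?_⟩
    rw [Ideal.mem_comap, pow_one, ← hc, RingHom.mem_ker, oComm, map_eq_zero] at ha
    rw [SetLike.mem_coe, Ideal.mem_comap, pow_one, ← hm, RingHom.mem_ker, ha]
  · intro t w h
    rw [Ideal.mem_comap, Ideal.span_singleton_pow, Ideal.mem_span_singleton, map_mul,
      map_natCast, pow_succ', mul_dvd_mul_iff_left hpW] at h
    rwa [Ideal.mem_comap, Ideal.span_singleton_pow, Ideal.mem_span_singleton]
  · intro s
    have e : Set.range (fun b : B => (π.comp (oSnd c j π)) (β b)) = B := by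
      ext a
      constructor
      · rintro ⟨b, rfl⟩
        show π _ ∈ B
        rw [hβ2]; exact b.2
      · intro ha; exact ⟨⟨a, ha⟩, hβ2 a⟩
    rw [e]; exact hB1 s
  · intro s F c' h1 h2
    have e : (fun b : B => (π.comp (oSnd c j π)) (β b)) = fun b : B => (b : k) :=
      funext fun b => hβ2 b
    rw [e] at h2
    exact hB2 s F c' h1 h2
  · intro t z; rfl
  · intro t z; rfl
  · intro z; rfl
  · intro b; exact ⟨_, hβ1 _⟩

theorem exists_hom_of_inj {V W : Type*} [CommRing V] [CommRing W] (f : V →+* W)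
    (hf : Function.Injective f) (F : W →+* W) (h : ∀ v, ∃ z, f z = F (f v)) :
    ∃ φ : V →+* V, ∀ v, f (φ v) = F (f v) := by
  choose φ hφ using h
  exact ⟨{ toFun := φ
           map_one' := hf (by rw [hφ]; simp)
           map_mul' := fun a b => hf (by rw [hφ]; simp [hφ])
           map_zero' := hf (by rw [hφ]; simp)
           map_add' := fun a b => hf (by rw [hφ]; simp [hφ]) }, hφ⟩

theorem cohen_abs [IsDomain W] (hp : p.Prime) (c : W →+* K) (j : k →+* K) (π : R →+* k)
    [CharP k p] [CharZero R]
    (τ : K → W) (hτ : ∀ a, c (τ a) = a) (hc : RingHom.ker c = Ideal.span {(p : W)})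
    (hpW : (p : W) ≠ 0) (F : W →+* W) (hF : ∀ w, (p : W) ∣ F w - w ^ p)
    (hFτ : ∀ a, F (τ a) = τ a ^ p)
    [IsAdicComplete (Ideal.span {(p : W)}) W] (m : Ideal R) (hm : RingHom.ker π = m)
    [IsAdicComplete m R] (hπ : Function.Surjective π) :
    ∃ (V : Subring (cohenO c j π)) (_ : IsDomain V) (_ : CharZero V)
      (φ : V →+* V) (ι : V →+* R),
      IsAdicComplete (Ideal.span {(p : V)}) V ∧ IsFrobLift p φ ∧ (∀ r, ∃ v, r - ι v ∈ m) ∧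
      (∀ v, ι v ∈ m ↔ (p : V) ∣ v) := by
  obtain ⟨B, D, hN, hM, hres, hβ⟩ := exists_cohenData hp c j π τ hτ hc hpW m hm hπ
  have hpm : (p : R) ∈ m := by
    rw [← hm, RingHom.mem_ker, map_natCast, CharP.cast_eq_zero]
  obtain ⟨f, hf⟩ : ∃ f : D.V →+* W, ∀ v : D.V, f v = oFst c j π v :=
    ⟨(oFst c j π).comp D.V.subtype, fun _ => rfl⟩
  obtain ⟨ι, hι⟩ : ∃ ι : D.V →+* R, ∀ v : D.V, ι v = oSnd c j π v :=
    ⟨(oSnd c j π).comp D.V.subtype, fun _ => rfl⟩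
  have hinj : Function.Injective f := by
    rw [injective_iff_map_eq_zero]
    intro v hv
    apply Subtype.ext
    refine D.sep' v.2 fun t => ?_
    rw [hM, ← hf, hv]
    exact zero_mem _
  have hιm : ∀ v : D.V, ι v ∈ m ↔ (p : D.V) ∣ v := by
    intro v
    constructor
    · intro h
      obtain ⟨w, hw, h⟩ := D.L12 v.2 (by
        rw [← D.res_iff, hres, ← hι, ← RingHom.mem_ker, hm]; exact h)
      exact ⟨⟨w, hw⟩, Subtype.ext h⟩
    · rintro ⟨w, rfl⟩
      rw [map_mul, map_natCast]
      exact Ideal.mul_mem_right _ _ hpm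
  have hpt : ∀ t (v : D.V), v ∈ Ideal.span {(p : D.V)} ^ t ↔ (v : cohenO c j π) ∈ D.N t := by
    intro t v
    rw [Ideal.span_singleton_pow, Ideal.mem_span_singleton]
    constructor
    · rintro ⟨w, rfl⟩
      have := Ideal.mul_mem_right (w : cohenO c j π) _ (D.N_pow D.p_mem t)
      simpa using this
    · intro h
      obtain ⟨w, hw, h⟩ := D.L13 t v.2 (D.NM _ h)
      exact ⟨⟨w, hw⟩, Subtype.ext (by simpa using h)⟩
  -- lifting of Frobenius
  have hFp : ∀ t w, w ∈ Ideal.span {(p : W)} ^ t → F w ∈ Ideal.span {(p : W)} ^ t := by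
    intro t w
    rw [Ideal.span_singleton_pow, Ideal.mem_span_singleton, Ideal.mem_span_singleton]
    rintro ⟨w', rfl⟩
    exact ⟨F w', by simp⟩
  have hcF : ∀ w, c (F w) = c w ^ p := by
    intro w
    rw [← sub_eq_zero, ← map_pow, ← map_sub, ← RingHom.mem_ker, hc, Ideal.mem_span_singleton]
    exact hF w
  have hVs : ∀ s, ∀ v ∈ D.Vs s, ∃ z ∈ D.Vs s, oFst c j π z = F (oFst c j π v) := by
    intro s v hv
    unfold CohenData.Vs at hv
    induction hv using Subring.closure_induction with
    | mem z hz =>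
      rcases hz with (⟨o, rfl⟩ | ⟨b, rfl⟩) | h
      · obtain ⟨z, h1, h2⟩ := exists_O c j π (F (oFst c j π o)) (oSnd c j π o ^ p) (by
          rw [hcF, oComm, map_pow, map_pow])
        exact ⟨z ^ p ^ s, D.pow_mem_Vs s z, by simp only [map_pow, h1]⟩
      · obtain ⟨a, ha⟩ := hβ b
        exact ⟨D.β b ^ p, pow_mem (D.β_mem_Vs s b) _, by rw [map_pow, ha, hFτ]⟩
      · have h : z ∈ D.N (s + 1) := h
        have h' := hFp _ _ ((hN _ _).mp h).1
        obtain ⟨z', h1, h2⟩ := exists_O c j π (F (oFst c j π z)) 0 (by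
          rw [map_zero, map_zero, ← RingHom.mem_ker, hc]
          exact Ideal.pow_le_self (by omega) h')
        refine ⟨z', D.N_le_Vs ?_, h1⟩
        rw [hN, h1, h2]
        exact ⟨h', zero_mem _⟩
    | zero => exact ⟨0, zero_mem _, by simp⟩
    | one => exact ⟨1, one_mem _, by simp⟩
    | add x y _ _ hx hy =>
      obtain ⟨x', hx', hx⟩ := hx
      obtain ⟨y', hy', hy⟩ := hy
      exact ⟨x' + y', add_mem hx' hy', by simp only [map_add, hx, hy]⟩
    | neg x _ hx =>
      obtain ⟨x', hx', hx⟩ := hx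
      exact ⟨-x', neg_mem hx', by simp only [map_neg, hx]⟩
    | mul x y _ _ hx hy =>
      obtain ⟨x', hx', hx⟩ := hx
      obtain ⟨y', hy', hy⟩ := hy
      exact ⟨x' * y', mul_mem hx' hy', by simp only [map_mul, hx, hy]⟩
  obtain ⟨φ, hφ⟩ := exists_hom_of_inj f hinj F (by
    intro v
    have h1 : ∀ s, ∃ z ∈ D.Vs s, oFst c j π z = F (oFst c j π v) :=
      fun s => hVs s v (D.V_le s v.2)
    choose z hz hzF using h1
    obtain ⟨w, hw, hwz⟩ := D.L14 z hz (fun s => by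
      rw [hM, map_sub, hzF, hzF, sub_self]; exact zero_mem _)
    refine ⟨⟨w, hw⟩, ?_⟩
    rw [hf, hf, ← sub_eq_zero]
    refine hausdorff_zero (Ideal.span {(p : W)}) _ fun t => ?_
    have := (hM _ _).mp (hwz t)
    rw [map_sub, hzF] at this
    exact Ideal.pow_le_pow_right (Nat.le_succ t) this)
  refine ⟨D.V, Function.Injective.isDomain f hinj, ⟨fun a b hab => ?_⟩, φ, ι, ?_, ?_, ?_, hιm⟩
  · have := congrArg ι hab
    simpa using this
  · refine isAdicComplete_of_seq _ (fun a ha => ?_) (fun v hv => ?_)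
    · exact Subtype.ext (D.sep _ fun t => (hpt t a).mp (ha t))
    · obtain ⟨w, hw, h⟩ := D.V_complete (fun s => (v s : cohenO c j π)) (fun s => (v s).2)
        (fun s => (hpt _ _).mp (hv s))
      exact ⟨⟨w, hw⟩, fun s => (hpt _ _).mpr (h s)⟩
  · intro v
    rw [← hιm, ← hm, RingHom.mem_ker, hι, ← hres, D.res_iff]
    apply D.M1
    rw [hM, pow_one, Ideal.mem_span_singleton, ← hf, map_sub, map_pow, hφ]
    exact hF _
  · intro r
    obtain ⟨v, hv, h⟩ := D.V_surj (π r)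
    refine ⟨⟨v, hv⟩, ?_⟩
    rw [hι, ← hm, RingHom.mem_ker, map_sub, ← hres, h, sub_self]


theorem exists_cohen (p : ℕ) (hp : p.Prime) (R : Type u) [CommRing R] [IsLocalRing R]
    [IsAdicComplete (IsLocalRing.maximalIdeal R) R] [CharZero R]
    [CharP (IsLocalRing.ResidueField R) p] :
    ∃ (V : Type u) (_ : CommRing V) (_ : IsDomain V) (_ : CharZero V)
      (φ : V →+* V) (ι : V →+* R),
      IsAdicComplete (Ideal.span {(p : V)}) V ∧ IsFrobLift p φ ∧
      (∀ r, ∃ v, r - ι v ∈ IsLocalRing.maximalIdeal R) ∧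
      (∀ v, ι v ∈ IsLocalRing.maximalIdeal R ↔ (p : V) ∣ v) := by
  haveI : Fact p.Prime := ⟨hp⟩
  have hF : ∀ w : WittVector p (PerfectClosure (IsLocalRing.ResidueField R) p),
      (p : WittVector p (PerfectClosure (IsLocalRing.ResidueField R) p)) ∣
        WittVector.frobenius w - w ^ p := by
    intro w
    rw [← Ideal.mem_span_singleton, ← WittVector.ker_constantCoeff, RingHom.mem_ker, map_sub,
      map_pow]
    show (WittVector.frobenius w).coeff 0 - w.coeff 0 ^ p = 0
    rw [WittVector.coeff_frobenius_charP, sub_self]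
  obtain ⟨V, h1, h2, φ, ι, h⟩ := cohen_abs (p := p)
    (W := WittVector p (PerfectClosure (IsLocalRing.ResidueField R) p)) hp
    WittVector.constantCoeff (PerfectClosure.of (IsLocalRing.ResidueField R) p)
    (IsLocalRing.residue R)
    (fun a => WittVector.teichmuller p a) (fun a => WittVector.teichmuller_coeff_zero p a)
    WittVector.ker_constantCoeff (WittVector.p_nonzero _ _) WittVector.frobenius hF
    (fun a => by
      ext n
      rw [WittVector.coeff_frobenius_charP, ← map_pow]
      cases n with
      | zero => rw [WittVector.teichmuller_coeff_zero, WittVector.teichmuller_coeff_zero]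
      | succ n =>
        rw [WittVector.teichmuller_coeff_pos p _ _ (Nat.succ_pos n),
          WittVector.teichmuller_coeff_pos p _ _ (Nat.succ_pos n), zero_pow hp.ne_zero])
    (IsLocalRing.maximalIdeal R) IsLocalRing.ker_residue IsLocalRing.residue_surjective
  exact ⟨V, inferInstance, h1, h2, φ, ι, h⟩

end cohen3

end P4dsec

section P5asec
section cic

open PowerSeries

def CIC (S : Type*) [CommRing S] : Prop :=
  ∀ f g d : S, g ≠ 0 → d ≠ 0 → (∀ n : ℕ, g ^ n ∣ d * f ^ n) → g ∣ f

theorem CIC.isIntegrallyClosed {S : Type*} [CommRing S] [IsDomain S] (h : CIC S) :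
    IsIntegrallyClosed S := by
  rw [isIntegrallyClosed_iff (FractionRing S)]
  intro z hz
  obtain ⟨f, g, hg, rfl⟩ := IsFractionRing.div_surjective (A := S) z
  have hg0 : g ≠ 0 := nonZeroDivisors.ne_zero hg
  obtain ⟨P, hPm, hP⟩ := hz
  have hgF : algebraMap S (FractionRing S) g ≠ 0 :=
    (map_ne_zero_iff _ (IsFractionRing.injective S (FractionRing S))).mpr hg0
  have key : ∀ n : ℕ, ∃ t : S, algebraMap S (FractionRing S) t =
      algebraMap S (FractionRing S) g ^ P.natDegree *
        (algebraMap S (FractionRing S) f / algebraMap S (FractionRing S) g) ^ n := by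
    intro n
    have hmod := Polynomial.modByMonic_add_div (Polynomial.X ^ n : Polynomial S) P
    have h1 := congrArg (Polynomial.eval₂ (algebraMap S (FractionRing S))
      (algebraMap S (FractionRing S) f / algebraMap S (FractionRing S) g)) hmod
    rw [Polynomial.eval₂_add, Polynomial.eval₂_mul, hP, zero_mul, add_zero,
      Polynomial.eval₂_pow, Polynomial.eval₂_X] at h1
    rw [← h1, Polynomial.eval₂_eq_sum_range, Finset.mul_sum]
    refine ⟨∑ i ∈ Finset.range (((Polynomial.X ^ n : Polynomial S) %ₘ P).natDegree + 1),
      ((Polynomial.X ^ n : Polynomial S) %ₘ P).coeff i * f ^ i * g ^ (P.natDegree - i), ?_⟩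
    rw [map_sum]
    refine Finset.sum_congr rfl fun i hi => ?_
    have hle : i ≤ P.natDegree := by
      have h2 := Polynomial.natDegree_modByMonic_le (Polynomial.X ^ n : Polynomial S) hPm
      have h3 := Finset.mem_range.mp hi
      omega
    rw [map_mul, map_mul, map_pow, map_pow, div_pow]
    have h4 : algebraMap S (FractionRing S) g ^ P.natDegree =
      algebraMap S (FractionRing S) g ^ (P.natDegree - i) *
        algebraMap S (FractionRing S) g ^ i := by rw [← pow_add]; congr 1; omega
    rw [h4]
    field_simp
  obtain ⟨c, hc⟩ := h f g (g ^ P.natDegree) hg0 (pow_ne_zero _ hg0) (by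
    intro n
    obtain ⟨t, ht⟩ := key n
    refine ⟨t, IsFractionRing.injective S (FractionRing S) ?_⟩
    rw [map_mul, map_mul, map_pow, map_pow, map_pow, ht, div_pow]
    field_simp)
  refine ⟨c, ?_⟩
  rw [hc, map_mul]
  field_simp

theorem exists_X_pow_mul {S : Type*} [CommRing S] [IsDomain S] (g : S⟦X⟧) (hg : g ≠ 0) :
    ∃ (r : ℕ) (g0 : S⟦X⟧), g = X ^ r * g0 ∧ constantCoeff g0 ≠ 0 := by
  obtain ⟨t, ht⟩ := X_pow_order_dvd (φ := g)
  refine ⟨g.order.toNat, t, ht, ?_⟩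
  have h := coeff_order hg
  obtain ⟨n, hn⟩ : ∃ n, n = g.order.toNat := ⟨_, rfl⟩
  rw [← hn] at ht h
  rw [ht] at h
  have h2 := coeff_X_pow_mul t n 0
  rw [zero_add] at h2
  rw [h2] at h
  simpa using h

/-- dividing series by powers of `X`. -/
theorem X_pow_cancel {S : Type*} [CommRing S] [IsDomain S] {g h : S⟦X⟧} {N : ℕ}
    (hg : constantCoeff g ≠ 0) (hd : g ∣ X ^ N * h) : g ∣ h := by
  obtain ⟨c, hc⟩ := hd
  have h1 : (X : S⟦X⟧) ^ N ∣ g * c := ⟨h, hc.symm⟩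
  have h2 : (X : S⟦X⟧) ^ N ∣ c :=
    X_prime.pow_dvd_of_dvd_mul_left N (by rwa [X_dvd_iff]) h1
  obtain ⟨c', rfl⟩ := h2
  refine ⟨c', mul_left_cancel₀ (pow_ne_zero N (X_prime (R := S)).ne_zero) ?_⟩
  rw [hc]; ring

theorem CIC.powerSeries {S : Type*} [CommRing S] [IsDomain S] (hS : CIC S) : CIC S⟦X⟧ := by
  intro f g d hg hd h
  obtain ⟨r, g, rfl, hg0⟩ := exists_X_pow_mul g hg
  obtain ⟨e, d, rfl, hd0⟩ := exists_X_pow_mul d hd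
  by_cases hf : f = 0
  · rw [hf]; exact dvd_zero _
  obtain ⟨l, f, rfl, hf0⟩ := exists_X_pow_mul f hf
  have hXne : (X : S⟦X⟧) ≠ 0 := X_prime.ne_zero
  have hrl : r ≤ l := by
    by_contra hcon
    have h1 := (dvd_mul_right _ _).trans (mul_pow (X ^ r) g (e + 1) ▸ h (e + 1))
    have h2 : (X : S⟦X⟧) ^ (r * (e + 1)) ∣ X ^ (e + l * (e + 1)) * (d * f ^ (e + 1)) := by
      rw [pow_mul]
      convert h1 using 1
      ring
    have h3 : (X : S⟦X⟧) ^ (e + l * (e + 1) + 1) ∣ X ^ (r * (e + 1)) := by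
      apply pow_dvd_pow
      obtain ⟨t, rfl⟩ : ∃ t, r = l + 1 + t := ⟨r - l - 1, by omega⟩
      nlinarith
    have h4 := h3.trans h2
    rw [pow_succ, mul_dvd_mul_iff_left (pow_ne_zero _ hXne), X_dvd_iff, map_mul, map_pow] at h4
    exact mul_ne_zero hd0 (pow_ne_zero _ hf0) h4
  obtain ⟨l, rfl⟩ := Nat.exists_eq_add_of_le hrl
  -- set of admissible numerators
  have hstep : ∀ F : {F : S⟦X⟧ // ∀ n : ℕ, g ^ n ∣ d * F ^ n},
      ∃ (c : S) (F' : {F : S⟦X⟧ // ∀ n : ℕ, g ^ n ∣ d * F ^ n}),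
        (F : S⟦X⟧) = C c * g + X * (F' : S⟦X⟧) := by
    rintro ⟨F, hF⟩
    obtain ⟨c, hc⟩ := hS (constantCoeff F) (constantCoeff g) (constantCoeff d) hg0 hd0 (by
      intro n
      have := map_dvd (constantCoeff (R := S)) (hF n)
      simpa using this)
    have hX : (X : S⟦X⟧) ∣ F - C c * g := by
      rw [X_dvd_iff, map_sub, map_mul, constantCoeff_C, hc]
      ring
    obtain ⟨F', hF'⟩ := hX
    refine ⟨c, ⟨F', fun n => ?_⟩, by rw [← hF']; ring⟩
    have h1 : g ^ n ∣ d * (F - C c * g) ^ n := by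
      rw [sub_eq_add_neg, add_pow, Finset.mul_sum]
      refine Finset.dvd_sum fun i hi => ?_
      have hi' : i ≤ n := by have := Finset.mem_range.mp hi; omega
      have h2 : g ^ n = g ^ i * g ^ (n - i) := by rw [← pow_add]; congr 1; omega
      have h3 : d * (F ^ i * (-(C c * g)) ^ (n - i) * (n.choose i : S⟦X⟧)) =
        (d * F ^ i) * g ^ (n - i) * ((-C c) ^ (n - i) * (n.choose i : S⟦X⟧)) := by
        rw [show -(C c * g) = g * (-C c) by ring, mul_pow]
        ring
      rw [h2, h3]
      exact (mul_dvd_mul (hF i) dvd_rfl).mul_right _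
    rw [hF', mul_pow] at h1
    refine X_pow_cancel (N := n) (by rw [map_pow]; exact pow_ne_zero _ hg0) ?_
    convert h1 using 1
    ring
  choose cf nf hnf using hstep
  have hinit : ∀ n : ℕ, g ^ n ∣ d * (X ^ l * f) ^ n := by
    intro n
    refine X_pow_cancel (N := e) (by rw [map_pow]; exact pow_ne_zero _ hg0) ?_
    have h1 := h n
    have h2 : (X ^ r * g) ^ n = (X ^ (r * n) : S⟦X⟧) * g ^ n := by rw [mul_pow, pow_mul]
    have h3 : X ^ e * d * (X ^ (r + l) * f) ^ n =
      (X ^ (r * n) : S⟦X⟧) * (X ^ e * (d * (X ^ l * f) ^ n)) := by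
      rw [pow_add, pow_mul]; ring
    rw [h2, h3, mul_dvd_mul_iff_left (pow_ne_zero _ hXne)] at h1
    exact h1
  obtain ⟨s, hs0, hs⟩ : ∃ s : ℕ → {F : S⟦X⟧ // ∀ n : ℕ, g ^ n ∣ d * F ^ n},
      (s 0 : S⟦X⟧) = X ^ l * f ∧ ∀ i, s (i + 1) = nf (s i) :=
    ⟨fun i => Nat.rec ⟨X ^ l * f, hinit⟩ (fun _ F => nf F) i, rfl, fun i => rfl⟩
  have hsum : ∀ N, X ^ l * f = (∑ i ∈ Finset.range N, C (cf (s i)) * X ^ i) * g +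
      X ^ N * (s N : S⟦X⟧) := by
    intro N
    induction N with
    | zero => simp [hs0]
    | succ N ih =>
      rw [ih, Finset.sum_range_succ, hs, hnf (s N)]
      ring
  have hq : X ^ l * f = PowerSeries.mk (fun i => cf (s i)) * g := by
    ext N
    have h1 := hsum (N + 1)
    have h2 : (X : S⟦X⟧) ^ (N + 1) ∣ PowerSeries.mk (fun i => cf (s i)) -
        ∑ i ∈ Finset.range (N + 1), C (cf (s i)) * X ^ i := by
      rw [X_pow_dvd_iff]
      intro m hm
      simp only [map_sub, map_sum, coeff_C_mul, coeff_X_pow, mul_ite, mul_one, mul_zero,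
        coeff_mk, Finset.sum_ite_eq, Finset.mem_range, if_pos hm, sub_self]
    have h3 : (X : S⟦X⟧) ^ (N + 1) ∣ X ^ l * f - PowerSeries.mk (fun i => cf (s i)) * g := by
      obtain ⟨t, ht⟩ := h2
      exact ⟨s (N + 1) - t * g, by
        rw [h1, show PowerSeries.mk (fun i => cf (s i)) = X ^ (N + 1) * t +
          ∑ i ∈ Finset.range (N + 1), C (cf (s i)) * X ^ i by rw [← ht]; ring]; ring⟩
    rw [X_pow_dvd_iff] at h3
    have := h3 N (Nat.lt_succ_self N)
    rwa [map_sub, sub_eq_zero] at this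
  rw [pow_add, mul_assoc, hq]
  exact ⟨PowerSeries.mk (fun i => cf (s i)), by ring⟩

end cic

end P5asec

section P5bsec
section psfrob

open PowerSeries

theorem natCast_dvd_ps {S : Type*} [CommRing S] (n : ℕ) (f : S⟦X⟧) :
    (n : S⟦X⟧) ∣ f ↔ ∀ i, (n : S) ∣ coeff i f := by
  have e : (n : S⟦X⟧) = C (n : S) := (map_natCast C n).symm
  constructor
  · rintro ⟨g, rfl⟩ i
    rw [e, coeff_C_mul]
    exact dvd_mul_right _ _
  · intro h
    choose g hg using h
    refine ⟨PowerSeries.mk g, ?_⟩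
    ext i
    rw [e, coeff_C_mul, coeff_mk, hg]

theorem natCast_dvd_ps' {S : Type*} [CommRing S] (n : ℕ) (f : S⟦X⟧) :
    (n : S⟦X⟧) ∣ f ↔ PowerSeries.map (Ideal.Quotient.mk (Ideal.span {(n : S)})) f = 0 := by
  rw [natCast_dvd_ps, PowerSeries.ext_iff]
  refine forall_congr' fun i => ?_
  rw [coeff_map, map_zero, Ideal.Quotient.eq_zero_iff_mem, Ideal.mem_span_singleton]

theorem prime_ps {S : Type*} [CommRing S] [IsDomain S] (p : ℕ) (hp : Prime (p : S)) :
    Prime (p : S⟦X⟧) := by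
  haveI : (Ideal.span {(p : S)}).IsPrime :=
    (Ideal.span_singleton_prime hp.ne_zero).mpr hp
  refine ⟨?_, ?_, ?_⟩
  · intro h
    apply hp.ne_zero
    have := congrArg constantCoeff h
    simpa using this
  · intro h
    apply hp.not_unit
    have := h.map constantCoeff
    simpa using this
  · intro f g
    rw [natCast_dvd_ps', natCast_dvd_ps', natCast_dvd_ps', map_mul, mul_eq_zero]
    exact id

theorem coeff_pow_dvd {S : Type*} [CommRing S] [IsDomain S] (p : ℕ) (hpp : p.Prime)
    (hp : Prime (p : S)) (f : S⟦X⟧) (l j : ℕ) :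
    (p : S) ∣ coeff (p ^ l * j) (f ^ p ^ l) - coeff j f ^ p ^ l := by
  haveI : Fact p.Prime := ⟨hpp⟩
  haveI : CharP (S ⧸ Ideal.span {(p : S)}) p := CharP.quotient S p hp.not_unit
  rw [← Ideal.mem_span_singleton, ← Ideal.Quotient.eq_zero_iff_mem, map_sub, sub_eq_zero,
    map_pow (Ideal.Quotient.mk (Ideal.span {(p : S)})) (coeff j f), ← coeff_map, ← coeff_map,
    map_pow (PowerSeries.map (Ideal.Quotient.mk (Ideal.span {(p : S)}))) f]
  obtain ⟨g, hg⟩ : ∃ g, g = PowerSeries.map (Ideal.Quotient.mk (Ideal.span {(p : S)})) f :=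
    ⟨_, rfl⟩
  rw [← hg]
  have h1 : PowerSeries.map (iterateFrobenius (S ⧸ Ideal.span {(p : S)}) p l)
      (expand (p ^ l) (pow_ne_zero l hpp.ne_zero) g) = g ^ p ^ l :=
    MvPowerSeries.map_iterateFrobenius_expand p hpp.ne_zero g l
  rw [← h1, coeff_map, coeff_expand_mul, iterateFrobenius_def]

theorem frobLift_ps {S : Type*} [CommRing S] [IsDomain S] (p : ℕ) (hpp : p.Prime)
    (hp : Prime (p : S)) (φ : S →+* S) (hφ : IsFrobLift p φ) :
    ∃ ψ : S⟦X⟧ →+* S⟦X⟧, IsFrobLift p ψ ∧ (∀ s, ψ (C s) = C (φ s)) ∧ ψ X = X ^ p := by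
  haveI : Fact p.Prime := ⟨hpp⟩
  haveI : CharP (S ⧸ Ideal.span {(p : S)}) p := CharP.quotient S p hp.not_unit
  refine ⟨(expand p hpp.ne_zero).toRingHom.comp (PowerSeries.map φ), ?_, ?_, ?_⟩
  · intro f
    rw [natCast_dvd_ps', map_sub, sub_eq_zero, map_pow]
    have h1 : PowerSeries.map (frobenius (S ⧸ Ideal.span {(p : S)}) p)
      (expand p hpp.ne_zero (PowerSeries.map (Ideal.Quotient.mk (Ideal.span {(p : S)})) f)) =
        PowerSeries.map (Ideal.Quotient.mk (Ideal.span {(p : S)})) f ^ p :=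
      MvPowerSeries.map_frobenius_expand p hpp.ne_zero
    rw [← h1]
    ext i
    show coeff i (PowerSeries.map _ (expand p hpp.ne_zero (PowerSeries.map φ f))) = _
    rw [coeff_map, coeff_map, coeff_expand, coeff_expand]
    split_ifs
    · rw [coeff_map, coeff_map, frobenius_def, ← map_pow, Ideal.Quotient.eq,
        Ideal.mem_span_singleton]
      exact hφ _
    · simp
  · intro s
    show expand p hpp.ne_zero (PowerSeries.map φ (C s)) = _
    rw [map_C, expand_C]
  · show expand p hpp.ne_zero (PowerSeries.map φ X) = _
    rw [map_X, expand_X]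

theorem mem_map_sup_iff {S : Type*} [CommRing S] (I : Ideal S) (M : ℕ) (t : S⟦X⟧) :
    t ∈ Ideal.map (C (R := S)) I ⊔ Ideal.span {X ^ M} ↔ ∀ j < M, coeff j t ∈ I := by
  constructor
  · intro h j hj
    have h1 : Ideal.map (C (R := S)) I ⊔ Ideal.span {X ^ M} ≤
        RingHom.ker (PowerSeries.map (Ideal.Quotient.mk I)) ⊔ Ideal.span {X ^ M} := by
      refine sup_le_sup_right ?_ _
      rw [Ideal.map_le_iff_le_comap]
      intro a ha
      rw [Ideal.mem_comap, RingHom.mem_ker, map_C, Ideal.Quotient.eq_zero_iff_mem.mpr ha, map_zero]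
    obtain ⟨a, ha, b, hb, rfl⟩ := Submodule.mem_sup.mp (h1 h)
    rw [map_add]
    refine add_mem ?_ ?_
    · have := congrArg (coeff j) ha
      rwa [coeff_map, map_zero, Ideal.Quotient.eq_zero_iff_mem] at this
    · rw [Ideal.mem_span_singleton, X_pow_dvd_iff] at hb
      rw [hb j hj]; exact zero_mem _
  · intro h
    have h1 : t = (∑ j ∈ Finset.range M, C (coeff j t) * X ^ j) +
        (t - ∑ j ∈ Finset.range M, C (coeff j t) * X ^ j) := by ring
    rw [h1]
    refine Submodule.add_mem_sup (sum_mem fun j hj => Ideal.mul_mem_right _ _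
      (Ideal.mem_map_of_mem _ (h j (Finset.mem_range.mp hj)))) ?_
    rw [Ideal.mem_span_singleton, X_pow_dvd_iff]
    intro m hm
    simp only [map_sub, map_sum, coeff_C_mul, coeff_X_pow, mul_ite, mul_one, mul_zero,
        Finset.sum_ite_eq, Finset.mem_range, if_pos hm, sub_self]

theorem mem_pair_iff {S : Type*} [CommRing S] (a : S) (M : ℕ) (t : S⟦X⟧) :
    t ∈ Ideal.span {C a, X ^ M} ↔ ∀ j < M, a ∣ coeff j t := by
  have e : Ideal.span {C a} = Ideal.map (C (R := S)) (Ideal.span {a}) := by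
    rw [Ideal.map_span, Set.image_singleton]
  rw [Ideal.span_insert, e, mem_map_sup_iff]
  simp only [Ideal.mem_span_singleton]

theorem mem_triple_iff {S : Type*} [CommRing S] (a b : S) (M : ℕ) (t : S⟦X⟧) :
    t ∈ Ideal.span {C a, C b, X ^ M} ↔ ∀ j < M, coeff j t ∈ Ideal.span {a, b} := by
  have e : Ideal.span {C a, C b, X ^ M} =
      Ideal.map (C (R := S)) (Ideal.span {a, b}) ⊔ Ideal.span {X ^ M} := by
    rw [Ideal.map_span, Set.image_pair, Ideal.span_insert, Ideal.span_insert, Ideal.span_insert,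
      sup_assoc]
  rw [e, mem_map_sup_iff]

/-- Frobenius flatness step. -/
theorem frob_step {S : Type*} [CommRing S] [IsDomain S] (p : ℕ) (hpp : p.Prime)
    (hp : Prime (p : S)) (J Jq : Ideal S) (hpq : (p : S) ∈ Jq) (l N : ℕ)
    (h : ∀ s : S, s ^ p ^ l ∈ Jq → s ∈ J) (t : S⟦X⟧)
    (ht : ∀ j < N * p ^ l, coeff j (t ^ p ^ l) ∈ Jq) : ∀ j < N, coeff j t ∈ J := by
  intro j hj
  apply h
  have h1 := ht (p ^ l * j) (by
    rw [mul_comm]; exact Nat.mul_lt_mul_of_pos_right hj (pow_pos hpp.pos l))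
  obtain ⟨c, hc⟩ := coeff_pow_dvd p hpp hp t l j
  have : coeff j t ^ p ^ l = coeff (p ^ l * j) (t ^ p ^ l) - p * c := by rw [← hc]; ring
  rw [this]
  exact sub_mem h1 (Ideal.mul_mem_right _ _ hpq)

end psfrob

end P5bsec

section P5csec
section vring

open PowerSeries

/-- Data recovered from the Cohen ring: it is a DVR with uniformizer `p`. -/
theorem cohen_props {V : Type*} [CommRing V] [IsDomain V] [CharZero V] (p : ℕ) (hpp : p.Prime)
    [IsAdicComplete (Ideal.span {(p : V)}) V]
    (h1 : ¬ (p : V) ∣ 1) (hu : ∀ v : V, ¬ (p : V) ∣ v → ∃ v', (p : V) ∣ v * v' - 1) :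
    Prime (p : V) ∧ (∀ v : V, ¬ (p : V) ∣ v → IsUnit v) ∧ IsNoetherianRing V ∧ IsLocalRing V ∧
      CIC V := by
  have hp0 : (p : V) ≠ 0 := Nat.cast_ne_zero.mpr hpp.ne_zero
  have hunit : ∀ v : V, ¬ (p : V) ∣ v → IsUnit v := by
    intro v hv
    obtain ⟨v', c, hc⟩ := hu v hv
    have h2 := IsAdicComplete.le_jacobson_bot (Ideal.span {(p : V)})
      (Ideal.mem_span_singleton_self (p : V))
    rw [Ideal.mem_jacobson_bot] at h2
    have h3 := h2 c
    rw [← hc, sub_add_cancel] at h3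
    exact isUnit_of_mul_isUnit_left h3
  have hnu : ¬ IsUnit (p : V) := fun h => h1 h.dvd
  have hprime : Prime (p : V) := by
    refine ⟨hp0, hnu, fun a b hab => ?_⟩
    by_contra hcon
    push Not at hcon
    have := (hunit a hcon.1).mul (hunit b hcon.2)
    exact hnu (isUnit_of_dvd_unit hab this)
  have hhaus : ∀ v : V, (∀ n, (p : V) ^ n ∣ v) → v = 0 := by
    intro v hv
    refine hausdorff_zero (Ideal.span {(p : V)}) v fun t => ?_
    rw [Ideal.span_singleton_pow, Ideal.mem_span_singleton]
    exact hv t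
  have hfac : ∀ {v : V}, v ≠ 0 → ∃ n : ℕ, Associated ((p : V) ^ n) v := by
    intro v hv
    have hex : ∃ n, ¬ (p : V) ^ n ∣ v := by
      by_contra hcon
      push Not at hcon
      exact hv (hhaus v hcon)
    classical
    obtain ⟨n, hn, hmin⟩ : ∃ n, ¬ (p : V) ^ n ∣ v ∧ ∀ m < n, (p : V) ^ m ∣ v :=
      ⟨Nat.find hex, Nat.find_spec hex, fun m hm => not_not.mp (Nat.find_min hex hm)⟩
    obtain _ | k := n
    · exact absurd (by simp) hn
    obtain ⟨w, hw⟩ := hmin k (Nat.lt_succ_self k)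
    have hwu : IsUnit w := by
      apply hunit
      rintro ⟨z, rfl⟩
      exact hn ⟨z, by rw [hw, pow_succ]; ring⟩
    obtain ⟨u, rfl⟩ := hwu
    exact ⟨k, u, hw.symm⟩
  haveI hdvr : IsDiscreteValuationRing V :=
    IsDiscreteValuationRing.ofHasUnitMulPowIrreducibleFactorization ⟨(p : V), hprime.irreducible, hfac⟩
  refine ⟨hprime, hunit, inferInstance, inferInstance, ?_⟩
  intro f g d hg hd h
  by_cases hf : f = 0
  · rw [hf]; exact dvd_zero g
  obtain ⟨n, u, hu⟩ := hfac hf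
  obtain ⟨m, w, hw⟩ := hfac hg
  rcases le_total m n with hmn | hmn
  · rw [← hu, ← hw]
    have : IsUnit (w : V) := w.isUnit
    rw [this.mul_right_dvd]
    exact Dvd.dvd.mul_right (pow_dvd_pow _ hmn) _
  · obtain ⟨k, rfl⟩ := Nat.exists_eq_add_of_le hmn
    obtain _ | k := k
    · rw [← hu, ← hw]
      have : IsUnit (w : V) := w.isUnit
      rw [this.mul_right_dvd]
      exact Dvd.dvd.mul_right (pow_dvd_pow _ (le_of_eq rfl)) _
    exfalso
    apply hd
    apply hhaus
    intro t
    have h2 := h t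
    have h3 : (p : V) ^ t * f ^ t ∣ g ^ t := by
      rw [← mul_pow]
      apply pow_dvd_pow_of_dvd
      rw [← hu, ← hw]
      have : IsUnit (u : V) := u.isUnit
      rw [← mul_assoc, this.mul_right_dvd]
      refine Dvd.dvd.mul_right ?_ _
      rw [← pow_succ']
      exact pow_dvd_pow _ (by omega)
    exact (mul_dvd_mul_iff_right (pow_ne_zero t hf)).mp (h3.trans h2)

theorem ps_natCast {S : Type*} [CommRing S] (n : ℕ) : (n : S⟦X⟧) = C (n : S) :=
  (map_natCast C n).symm

theorem ps_charZero {S : Type*} [CommRing S] [CharZero S] : CharZero S⟦X⟧ := by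
  constructor
  intro a b hab
  have := congrArg constantCoeff hab
  simpa using this

/-- All the properties of `A = V⟦X⟧⟦X⟧`. -/
theorem base_props {V : Type*} [CommRing V] [IsDomain V] [CharZero V] (p : ℕ) (hpp : p.Prime)
    (hprime : Prime (p : V)) (hcic : CIC V) (φ : V →+* V) (hφ : IsFrobLift p φ) :
    IsIntegrallyClosed V⟦X⟧⟦X⟧ ∧ CharZero V⟦X⟧⟦X⟧ ∧ Prime (p : V⟦X⟧⟦X⟧) ∧
    (∃ ψ : V⟦X⟧⟦X⟧ →+* V⟦X⟧⟦X⟧, IsFrobLift p ψ ∧ ψ (C X) = C X ^ p ∧ ψ X = X ^ p) ∧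
    (C X : V⟦X⟧⟦X⟧) ∉ Ideal.span {(p : V⟦X⟧⟦X⟧)} ∧
    (∀ M, Nzd (p : V⟦X⟧⟦X⟧) (Ideal.span {(C X : V⟦X⟧⟦X⟧) ^ M, X ^ M})) ∧
    (∀ M, Nzd (C X : V⟦X⟧⟦X⟧) (Ideal.span {(p : V⟦X⟧⟦X⟧), X ^ M})) ∧
    (∀ (a : V⟦X⟧⟦X⟧) (N l : ℕ), a ^ p ^ l ∈
      Ideal.span {(p : V⟦X⟧⟦X⟧), (C X : V⟦X⟧⟦X⟧) ^ (N * p ^ l), X ^ (N * p ^ l)} →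
      a ∈ Ideal.span {(p : V⟦X⟧⟦X⟧), (C X : V⟦X⟧⟦X⟧) ^ N, X ^ N}) := by
  have hprime1 : Prime (p : V⟦X⟧) := prime_ps p hprime
  have hprime2 : Prime (p : V⟦X⟧⟦X⟧) := prime_ps p hprime1
  obtain ⟨φ1, hφ1, hφ1C, hφ1X⟩ := frobLift_ps p hpp hprime φ hφ
  obtain ⟨φ2, hφ2, hφ2C, hφ2X⟩ := frobLift_ps p hpp hprime1 φ1 hφ1
  haveI : CharZero V⟦X⟧ := ps_charZero
  refine ⟨hcic.powerSeries.powerSeries.isIntegrallyClosed, ps_charZero, hprime2,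
    ⟨φ2, hφ2, ?_, hφ2X⟩, ?_, ?_, ?_, ?_⟩
  · rw [hφ2C, hφ1X, map_pow]
  · rw [Ideal.mem_span_singleton, natCast_dvd_ps]
    intro h
    have h0 := h 0
    rw [coeff_zero_C, natCast_dvd_ps] at h0
    have h1 := h0 1
    rw [coeff_one_X] at h1
    exact hprime.not_unit (isUnit_of_dvd_one h1)
  · intro M t ht
    rw [← map_pow, mem_pair_iff] at ht ⊢
    intro j hj
    have h1 := ht j hj
    rw [ps_natCast, coeff_C_mul, X_pow_dvd_iff] at h1
    rw [X_pow_dvd_iff]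
    intro m hm
    have h2 := h1 m hm
    rw [ps_natCast, coeff_C_mul] at h2
    exact (mul_eq_zero.mp h2).resolve_left hprime.ne_zero
  · intro M t ht
    rw [ps_natCast, mem_pair_iff] at ht ⊢
    intro j hj
    have h1 := ht j hj
    rw [coeff_C_mul] at h1
    refine (hprime1.dvd_or_dvd h1).resolve_left ?_
    intro h2
    rw [natCast_dvd_ps] at h2
    have h3 := h2 1
    rw [coeff_one_X] at h3
    exact hprime.not_unit (isUnit_of_dvd_one h3)
  · intro a N l ha
    rw [ps_natCast, ← map_pow, mem_triple_iff] at ha ⊢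
    refine frob_step p hpp hprime1 _ _ (Ideal.subset_span (by simp)) l N ?_ a ha
    intro s hs
    rw [ps_natCast, mem_pair_iff] at hs ⊢
    simp only [← Ideal.mem_span_singleton] at hs ⊢
    refine frob_step p hpp hprime _ _ (Ideal.mem_span_singleton_self _) l N ?_ s hs
    intro v hv
    rw [Ideal.mem_span_singleton] at hv ⊢
    exact hprime.dvd_of_dvd_pow hv

end vring

end P5csec

section P5dsec
section evalhom

open PowerSeries

theorem eval₂_congr_low {S T : Type*} [CommRing S] [CommRing T] (θ : S →+* T) (x : T) (n : ℕ)
    (hx : x ^ n = 0) (P Q : Polynomial S) (h : ∀ j < n, P.coeff j = Q.coeff j) :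
    P.eval₂ θ x = Q.eval₂ θ x := by
  have h1 : Polynomial.X ^ n ∣ P - Q := by
    rw [Polynomial.X_pow_dvd_iff]
    intro d hd
    rw [Polynomial.coeff_sub, h d hd, sub_self]
  obtain ⟨c, hc⟩ := h1
  have h2 := congrArg (Polynomial.eval₂ θ x) hc
  rw [Polynomial.eval₂_sub, Polynomial.eval₂_mul, Polynomial.eval₂_pow, Polynomial.eval₂_X, hx,
    zero_mul, sub_eq_zero] at h2
  exact h2

/-- Evaluation of power series at a nilpotent element. -/
theorem exists_nilEval {S T : Type*} [CommRing S] [CommRing T] (θ : S →+* T) (x : T) (n : ℕ)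
    (hx : x ^ n = 0) :
    ∃ ψ : S⟦X⟧ →+* T, ∀ f, ψ f = (trunc n f).eval₂ θ x := by
  refine ⟨⟨⟨⟨fun f => (trunc n f).eval₂ θ x, ?_⟩, ?_⟩, ?_, ?_⟩, fun f => rfl⟩
  · rw [← Polynomial.eval₂_one θ x]
    refine eval₂_congr_low θ x n hx _ _ fun j hj => ?_
    rw [coeff_trunc, if_pos hj, coeff_one, Polynomial.coeff_one]
  · intro f g
    show (trunc n (f * g)).eval₂ θ x = (trunc n f).eval₂ θ x * (trunc n g).eval₂ θ x
    rw [← Polynomial.eval₂_mul]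
    refine eval₂_congr_low θ x n hx _ _ fun j hj => ?_
    rw [coeff_trunc, if_pos hj, coeff_mul_eq_coeff_trunc_mul_trunc f g hj, ← Polynomial.coe_mul,
      Polynomial.coeff_coe]
  · show (trunc n (0 : S⟦X⟧)).eval₂ θ x = 0
    rw [map_zero, Polynomial.eval₂_zero]
  · intro f g
    show (trunc n (f + g)).eval₂ θ x = (trunc n f).eval₂ θ x + (trunc n g).eval₂ θ x
    rw [map_add, Polynomial.eval₂_add]

theorem exists_psEval {S R : Type*} [CommRing S] [CommRing R] (I : Ideal R) [IsAdicComplete I R]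
    (ι : S →+* R) (x : R) (hx : x ∈ I) :
    ∃ ψ : S⟦X⟧ →+* R, (∀ s, ψ (C s) = ι s) ∧ ψ X = x := by
  have hn : ∀ n, Ideal.Quotient.mk (I ^ n) x ^ n = 0 := by
    intro n
    rw [← map_pow, Ideal.Quotient.eq_zero_iff_mem]
    exact Ideal.pow_mem_pow hx n
  choose f hf using fun n => exists_nilEval ((Ideal.Quotient.mk (I ^ n)).comp ι)
    (Ideal.Quotient.mk (I ^ n) x) n (hn n)
  have hcomp : ∀ {m n : ℕ} (hle : m ≤ n),
      (Ideal.Quotient.factorPow I hle).comp (f n) = f m := by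
    intro m n hle
    ext1 g
    rw [RingHom.comp_apply, hf, hf, Polynomial.hom_eval₂]
    have e1 : (Ideal.Quotient.factorPow I hle).comp ((Ideal.Quotient.mk (I ^ n)).comp ι) =
        (Ideal.Quotient.mk (I ^ m)).comp ι := by
      ext1 s; simp
    have e2 : Ideal.Quotient.factorPow I hle (Ideal.Quotient.mk (I ^ n) x) =
        Ideal.Quotient.mk (I ^ m) x := by simp
    rw [e1, e2]
    refine eval₂_congr_low _ _ m (hn m) _ _ fun j hj => ?_
    rw [coeff_trunc, coeff_trunc, if_pos hj, if_pos (lt_of_lt_of_le hj hle)]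
  have hz : ∀ a b : R, (∀ n, Ideal.Quotient.mk (I ^ n) a = Ideal.Quotient.mk (I ^ n) b) → a = b := by
    intro a b h
    rw [← sub_eq_zero]
    refine hausdorff_zero I _ fun t => ?_
    exact Ideal.Quotient.eq.mp (h t)
  have hz' : ∀ a b : R, (∀ n, Ideal.Quotient.mk (I ^ (n + 2)) a =
      Ideal.Quotient.mk (I ^ (n + 2)) b) → a = b := by
    intro a b h
    refine hz a b fun n => ?_
    have := h n
    rw [Ideal.Quotient.eq] at this ⊢
    exact Ideal.pow_le_pow_right (by omega) this
  refine ⟨IsAdicComplete.liftRingHom I f hcomp, ?_, ?_⟩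
  · intro s
    refine hz' _ _ fun n => ?_
    rw [IsAdicComplete.mk_liftRingHom, hf, trunc_C, Polynomial.eval₂_C, RingHom.comp_apply]
  · refine hz' _ _ fun n => ?_
    rw [IsAdicComplete.mk_liftRingHom, hf, trunc_X, Polynomial.eval₂_X]

end evalhom

end P5dsec

section P5esec
section finiteness

open PowerSeries IsLocalRing

/-- `R` is generated by `r` over `S` modulo `J`. -/
def GenMod {S R : Type*} [CommRing S] [CommRing R] (ψ : S →+* R) {k : ℕ} (r : Fin k → R)
    (J : Ideal R) : Prop :=
  ∀ z, ∃ s : Fin k → S, z - ∑ i, ψ (s i) * r i ∈ J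

theorem genMod_step {S S' R : Type*} [CommRing S] [CommRing S'] [CommRing R] (ψ₀ : S →+* R)
    (ψ : S' →+* R) {k : ℕ} (r : Fin k → R) (x : R) (J : Ideal R)
    (hK : ∀ z, (∀ n, z ∈ Ideal.span {x ^ n} ⊔ J) → z ∈ J)
    (hlim : ∀ s : ℕ → S, ∃ t : S', ∀ n, x ^ n ∣ ψ t - ∑ l ∈ Finset.range n, ψ₀ (s l) * x ^ l)
    (h : GenMod ψ₀ r (Ideal.span {x} ⊔ J)) : GenMod ψ r J := by
  intro z
  have h1 : ∀ z, ∃ (s : Fin k → S) (z' : R), z - ∑ i, ψ₀ (s i) * r i - x * z' ∈ J := by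
    intro z
    obtain ⟨s, hs⟩ := h z
    obtain ⟨a, ha, b, hb, hab⟩ := Submodule.mem_sup.mp hs
    obtain ⟨c, rfl⟩ := Ideal.mem_span_singleton.mp ha
    refine ⟨s, c, ?_⟩
    rw [← hab, add_sub_cancel_left]
    exact hb
  choose σ τ hστ using h1
  obtain ⟨ζ, hζ0, hζ⟩ : ∃ ζ : ℕ → R, ζ 0 = z ∧ ∀ n, ζ (n + 1) = τ (ζ n) :=
    ⟨fun n => Nat.rec z (fun _ w => τ w) n, rfl, fun n => rfl⟩
  choose t ht using fun i => hlim (fun l => σ (ζ l) i)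
  refine ⟨t, hK _ fun n => ?_⟩
  have h2 : z - ∑ i, (∑ l ∈ Finset.range n, ψ₀ (σ (ζ l) i) * x ^ l) * r i - x ^ n * ζ n ∈ J := by
    induction n with
    | zero => simp [hζ0]
    | succ n ih =>
      have h3 := hστ (ζ n)
      rw [← hζ] at h3
      have h4 := add_mem ih (J.mul_mem_left (x ^ n) h3)
      convert h4 using 1
      simp only [Finset.sum_range_succ, add_mul, Finset.sum_add_distrib]
      have : x ^ n * ∑ i, ψ₀ (σ (ζ n) i) * r i = ∑ i, ψ₀ (σ (ζ n) i) * x ^ n * r i := by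
        rw [Finset.mul_sum]
        exact Finset.sum_congr rfl fun i _ => by ring
      rw [← this]
      ring
  have h5 : ∑ i, (∑ l ∈ Finset.range n, ψ₀ (σ (ζ l) i) * x ^ l) * r i - ∑ i, ψ (t i) * r i ∈
      Ideal.span {x ^ n} := by
    rw [← Finset.sum_sub_distrib]
    refine sum_mem fun i _ => ?_
    rw [← sub_mul]
    refine Ideal.mul_mem_right _ _ ?_
    rw [← neg_mem_iff, neg_sub, Ideal.mem_span_singleton]
    exact ht i n
  have h6 : z - ∑ i, ψ (t i) * r i = (∑ i, (∑ l ∈ Finset.range n, ψ₀ (σ (ζ l) i) * x ^ l) * r i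
      - ∑ i, ψ (t i) * r i + x ^ n * ζ n) + (z - ∑ i, (∑ l ∈ Finset.range n,
        ψ₀ (σ (ζ l) i) * x ^ l) * r i - x ^ n * ζ n) := by ring
  rw [h6]
  exact Submodule.add_mem_sup (add_mem h5 (Ideal.mul_mem_right _ _
    (Ideal.mem_span_singleton_self _))) h2

theorem krull_closed {R : Type*} [CommRing R] [IsNoetherianRing R] [IsLocalRing R] (x : R)
    (hx : x ∈ maximalIdeal R) (J : Ideal R) (z : R) (h : ∀ n, z ∈ Ideal.span {x ^ n} ⊔ J) :
    z ∈ J := by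
  have h1 := Ideal.iInf_pow_smul_eq_bot_of_isLocalRing (M := R ⧸ J) (Ideal.span {x}) (by
    intro htop
    have h2 : Ideal.span {x} ≤ maximalIdeal R := by
      rw [Ideal.span_singleton_le_iff_mem]; exact hx
    rw [htop, top_le_iff] at h2
    exact (maximalIdeal.isMaximal R).ne_top h2)
  rw [← Ideal.Quotient.eq_zero_iff_mem, ← Submodule.mem_bot R, ← h1, Submodule.mem_iInf]
  intro n
  obtain ⟨a, ha, b, hb, rfl⟩ := Submodule.mem_sup.mp (h n)
  rw [map_add, Ideal.Quotient.eq_zero_iff_mem.mpr hb, add_zero, Ideal.span_singleton_pow]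
  have h3 : Ideal.Quotient.mk J a = a • (1 : R ⧸ J) := by
    rw [Algebra.smul_def, mul_one]; rfl
  rw [h3]
  exact Submodule.smul_mem_smul ha trivial

theorem hlim_padic {V R : Type*} [CommRing V] [CommRing R] (p : ℕ)
    [IsAdicComplete (Ideal.span {(p : V)}) V] (ι : V →+* R) (s : ℕ → V) :
    ∃ t : V, ∀ n, (p : R) ^ n ∣ ι t - ∑ l ∈ Finset.range n, ι (s l) * (p : R) ^ l := by
  obtain ⟨w, hw⟩ := complete_seq (Ideal.span {(p : V)})
    (fun n => ∑ l ∈ Finset.range (n + 1), s l * (p : V) ^ l) (by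
      intro n
      show ∑ l ∈ Finset.range (n + 1 + 1), s l * (p : V) ^ l -
        ∑ l ∈ Finset.range (n + 1), s l * (p : V) ^ l ∈ _
      rw [Finset.sum_range_succ _ (n + 1), add_sub_cancel_left]
      exact Ideal.mul_mem_left _ _ (Ideal.pow_mem_pow (Ideal.mem_span_singleton_self _) _))
  refine ⟨w, fun n => ?_⟩
  obtain _ | n := n
  · simp
  · have h1 := hw n
    rw [Ideal.span_singleton_pow, Ideal.mem_span_singleton] at h1
    have h2 := map_dvd ι h1
    simpa using h2

theorem hlim_ps {S R : Type*} [CommRing S] [CommRing R] (ι : S →+* R) (x : R)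
    (ψ : S⟦X⟧ →+* R) (hC : ∀ s, ψ (C s) = ι s) (hX : ψ X = x) (s : ℕ → S) :
    ∃ t : S⟦X⟧, ∀ n, x ^ n ∣ ψ t - ∑ l ∈ Finset.range n, ι (s l) * x ^ l := by
  refine ⟨PowerSeries.mk s, fun n => ?_⟩
  have h1 : (X : S⟦X⟧) ^ n ∣ PowerSeries.mk s - ∑ l ∈ Finset.range n, C (s l) * X ^ l := by
    rw [X_pow_dvd_iff]
    intro m hm
    simp only [map_sub, map_sum, coeff_mk, coeff_C_mul, coeff_X_pow, mul_ite, mul_one, mul_zero,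
        Finset.sum_ite_eq, Finset.mem_range, if_pos hm, sub_self]
  have h2 := map_dvd ψ h1
  simpa [hC, hX] using h2

theorem genMod_pow {V R : Type*} [CommRing V] [CommRing R] [IsNoetherianRing R] [IsLocalRing R]
    (ι : V →+* R) (hι : ∀ r, ∃ v, r - ι v ∈ maximalIdeal R) (n : ℕ) :
    ∃ (k : ℕ) (r : Fin k → R), GenMod ι r (maximalIdeal R ^ n) := by
  letI : Algebra V R := ι.toAlgebra
  have hsm : ∀ (v : V) (a : R), v • a = ι v * a := fun v a => rfl
  have key : ∃ N : Submodule V R, N.FG ∧ ∀ z, ∃ a ∈ N, z - a ∈ maximalIdeal R ^ n := by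
    induction n with
    | zero => exact ⟨⊥, Submodule.fg_bot, fun z => ⟨0, zero_mem _, by simp⟩⟩
    | succ n ih =>
      obtain ⟨N, hN, h⟩ := ih
      obtain ⟨T, hT⟩ := (IsNoetherian.noetherian (maximalIdeal R ^ n) : (maximalIdeal R ^ n).FG)
      refine ⟨N ⊔ Submodule.span V (T : Set R), hN.sup (Submodule.fg_span T.finite_toSet), ?_⟩
      have h2 : ∀ w ∈ maximalIdeal R ^ n, ∃ b ∈ Submodule.span V (T : Set R),
          b ∈ maximalIdeal R ^ n ∧ w - b ∈ maximalIdeal R ^ (n + 1) := by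
        intro w hw
        rw [← hT] at hw
        induction hw using Submodule.span_induction with
        | mem w hw =>
          exact ⟨w, Submodule.subset_span hw, hT ▸ Submodule.subset_span hw, by simp⟩
        | zero => exact ⟨0, zero_mem _, zero_mem _, by simp⟩
        | add a b _ _ ha hb =>
          obtain ⟨a', h1, h2, h3⟩ := ha
          obtain ⟨b', h4, h5, h6⟩ := hb
          exact ⟨a' + b', add_mem h1 h4, add_mem h2 h5, by rw [add_sub_add_comm]; exact add_mem h3 h6⟩
        | smul c w hw ih =>
          obtain ⟨b, h1, h2, h3⟩ := ih
          obtain ⟨v, hv⟩ := hι c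
          refine ⟨v • b, Submodule.smul_mem _ _ h1, ?_, ?_⟩
          · rw [hsm]; exact Ideal.mul_mem_left _ _ h2
          · have e : c • w - v • b = c * (w - b) + (c - ι v) * b := by
              rw [hsm, smul_eq_mul]; ring
            rw [e]
            refine add_mem (Ideal.mul_mem_left _ _ h3) ?_
            rw [pow_succ']
            exact Ideal.mul_mem_mul hv h2
      intro z
      obtain ⟨a, ha, hza⟩ := h z
      obtain ⟨b, hb, -, hb2⟩ := h2 _ hza
      exact ⟨a + b, Submodule.add_mem_sup ha hb, by rw [← sub_sub]; exact hb2⟩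
  obtain ⟨N, hN, h⟩ := key
  obtain ⟨k, r, rfl⟩ := Submodule.fg_iff_exists_fin_generating_family.mp hN
  refine ⟨k, r, fun z => ?_⟩
  obtain ⟨a, ha, hza⟩ := h z
  obtain ⟨c, hc⟩ := (Submodule.mem_span_range_iff_exists_fun V).mp ha
  refine ⟨c, ?_⟩
  rw [← hc] at hza
  exact hza

theorem finite_of_cohen {V R : Type*} [CommRing V] [CommRing R] [IsNoetherianRing R]
    [IsLocalRing R] (p : ℕ) [IsAdicComplete (Ideal.span {(p : V)}) V]
    (ι : V →+* R) (hι : ∀ r, ∃ v, r - ι v ∈ maximalIdeal R) (x y : R)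
    (hsop : (Ideal.span {(p : R), x, y}).radical = maximalIdeal R)
    (ψ₁ : V⟦X⟧ →+* R) (h1C : ∀ s, ψ₁ (C s) = ι s) (h1X : ψ₁ X = x)
    (ψ₂ : V⟦X⟧⟦X⟧ →+* R) (h2C : ∀ s, ψ₂ (C s) = ψ₁ s) (h2X : ψ₂ X = y) :
    ψ₂.Finite := by
  have hm : Ideal.span {(p : R), x, y} ≤ maximalIdeal R := hsop ▸ Ideal.le_radical
  have hpm : (p : R) ∈ maximalIdeal R := hm (Ideal.subset_span (by simp))
  have hxm : x ∈ maximalIdeal R := hm (Ideal.subset_span (by simp))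
  have hym : y ∈ maximalIdeal R := hm (Ideal.subset_span (by simp))
  obtain ⟨N, hN⟩ := Ideal.exists_radical_pow_le_of_fg (Ideal.span {(p : R), x, y})
    (IsNoetherian.noetherian _)
  rw [hsop] at hN
  obtain ⟨k, r, hr⟩ := genMod_pow ι hι N
  have g0 : GenMod ι r (Ideal.span {(p : R)} ⊔ (Ideal.span {x} ⊔ (Ideal.span {y} ⊔ ⊥))) := by
    intro z
    obtain ⟨s, hs⟩ := hr z
    refine ⟨s, ?_⟩
    have := hN hs
    rwa [Ideal.span_insert, Ideal.span_insert, ← sup_bot_eq (Ideal.span {y})] at this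
  have g1 := genMod_step ι ι r (p : R) _ (krull_closed _ hpm _) (hlim_padic p ι) g0
  have g2 := genMod_step ι ψ₁ r x _ (krull_closed _ hxm _) (hlim_ps ι x ψ₁ h1C h1X) g1
  have g3 := genMod_step ψ₁ ψ₂ r y _ (krull_closed _ hym _) (hlim_ps ψ₁ y ψ₂ h2C h2X) g2
  letI : Algebra V⟦X⟧⟦X⟧ R := ψ₂.toAlgebra
  show Module.Finite V⟦X⟧⟦X⟧ R
  refine ⟨Submodule.fg_iff_exists_fin_generating_family.mpr ⟨k, r, ?_⟩⟩
  rw [eq_top_iff]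
  intro z _
  obtain ⟨s, hs⟩ := g3 z
  rw [Ideal.mem_bot, sub_eq_zero] at hs
  rw [Submodule.mem_span_range_iff_exists_fun]
  exact ⟨s, hs.symm⟩

end finiteness

end P5esec

section P5fsec
section inj

open PowerSeries IsLocalRing

theorem maxIdeal_eq {V : Type*} [CommRing V] [IsDomain V] [IsLocalRing V] (p : ℕ)
    (hprime : Prime (p : V)) (hunit : ∀ v : V, ¬ (p : V) ∣ v → IsUnit v) :
    maximalIdeal V⟦X⟧⟦X⟧ = Ideal.span {(p : V⟦X⟧⟦X⟧), C X, X} := by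
  apply le_antisymm
  · intro t ht
    rw [ps_natCast, ← pow_one (X : V⟦X⟧⟦X⟧), mem_triple_iff]
    intro j hj
    obtain rfl : j = 0 := by omega
    rw [ps_natCast, ← pow_one (X : V⟦X⟧), mem_pair_iff]
    intro i hi
    obtain rfl : i = 0 := by omega
    by_contra hcon
    rw [mem_maximalIdeal, mem_nonunits_iff] at ht
    apply ht
    rw [isUnit_iff_constantCoeff, isUnit_iff_constantCoeff]
    apply hunit
    simpa using hcon
  · rw [Ideal.span_le]
    intro t ht
    rw [SetLike.mem_coe, mem_maximalIdeal, mem_nonunits_iff, isUnit_iff_constantCoeff,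
      isUnit_iff_constantCoeff]
    rcases ht with rfl | rfl | rfl
    · simpa using hprime.not_unit
    · simp
    · simp

theorem dim_base_le {V : Type*} [CommRing V] [IsDomain V] [IsNoetherianRing V] [IsLocalRing V]
    (p : ℕ) (hprime : Prime (p : V)) (hunit : ∀ v : V, ¬ (p : V) ∣ v → IsUnit v) :
    ringKrullDim V⟦X⟧⟦X⟧ ≤ 3 := by
  refine (ringKrullDim_le_spanFinrank_maximalIdeal (R := V⟦X⟧⟦X⟧)).trans ?_
  rw [maxIdeal_eq p hprime hunit]
  have h1 := Submodule.spanFinrank_span_le_ncard_of_finite (R := V⟦X⟧⟦X⟧)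
    (s := {(p : V⟦X⟧⟦X⟧), C X, X}) (Set.toFinite _)
  have h2 : ({(p : V⟦X⟧⟦X⟧), C X, X} : Set V⟦X⟧⟦X⟧).ncard ≤ 3 := Set.ncard_insert_le _ _ |>.trans
    (Nat.succ_le_succ ((Set.ncard_insert_le _ _).trans (by rw [Set.ncard_singleton])))
  have h3 := h1.trans h2
  exact_mod_cast h3

theorem dim_le_of_finite {B R : Type*} [CommRing B] [CommRing R] (ψ : B →+* R) (hψ : ψ.Finite) :
    ringKrullDim R ≤ ringKrullDim B := by
  letI : Algebra B R := ψ.toAlgebra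
  haveI : Module.Finite B R := hψ
  refine Order.krullDim_le_of_strictMono (PrimeSpectrum.comap (algebraMap B R)) ?_
  intro P Q hPQ
  have hP : P.asIdeal < Q.asIdeal := hPQ
  haveI := P.2
  show P.asIdeal.comap (algebraMap B R) < Q.asIdeal.comap (algebraMap B R)
  exact Ideal.IsIntegral.comap_lt_comap hP

theorem inj_of_finite {A R : Type*} [CommRing A] [IsDomain A] [CommRing R]
    (ψ : A →+* R) (hψ : ψ.Finite) (hA : ringKrullDim A ≤ 3) (hR : ringKrullDim R = 3) :
    Function.Injective ψ := by
  rw [injective_iff_map_eq_zero]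
  intro f hf
  by_contra hf0
  have h1 := ringKrullDim_quotient_succ_le_of_nonZeroDivisor
    (mem_nonZeroDivisors_of_ne_zero hf0)
  have h2 : ∀ a ∈ Ideal.span {f}, ψ a = 0 := by
    intro a ha
    obtain ⟨c, rfl⟩ := Ideal.mem_span_singleton.mp ha
    rw [map_mul, hf, zero_mul]
  have h3 : (Ideal.Quotient.lift (Ideal.span {f}) ψ h2).Finite := by
    refine RingHom.Finite.of_comp_finite (f := Ideal.Quotient.mk (Ideal.span {f})) ?_
    rw [Ideal.Quotient.lift_comp_mk]
    exact hψ
  have h4 := dim_le_of_finite _ h3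
  rw [hR] at h4
  have h5 : (3 : WithBot ℕ∞) + 1 ≤ 3 := (add_le_add_left h4 1).trans (h1.trans hA)
  have h6 : ((3 : ℕ∞) + 1 : ℕ∞) ≤ (3 : ℕ∞) := by exact_mod_cast h5
  have h7 : (3 : ℕ) + 1 ≤ 3 := by exact_mod_cast h6
  omega

end inj

end P5fsec

/-- Let `(R,m)` be a 3-dimensional complete local Noetherian domain
of mixed characteristic `p` with system of parameters `p, x, y`, and let
`J_n = (x,y)R :_R pⁿ`. Then for every minimal prime `𝔭` of `pR` and every `n ≥ 1`,
the image of `J_n` in `R̄ = R/𝔭` is contained in the tight closure of `(x̄,ȳ)R̄`. -/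
theorem colon_capturing_dimension_three
    (p : ℕ) (hp : p.Prime)
    (R : Type u) [CommRing R] [IsNoetherianRing R] [IsLocalRing R] [IsDomain R]
    [IsAdicComplete (IsLocalRing.maximalIdeal R) R]
    (hchar0 : CharZero R) (hresp : CharP (IsLocalRing.ResidueField R) p)
    (hdim : ringKrullDim R = 3)
    (x y : R)
    (hsop : (Ideal.span {(p : R), x, y}).radical = IsLocalRing.maximalIdeal R)
    (𝔭 : Ideal R) (h𝔭 : 𝔭 ∈ (Ideal.span {(p : R)}).minimalPrimes)
    (n : ℕ) (hn : 1 ≤ n) (u : R) (hu : (p : R) ^ n * u ∈ Ideal.span {x, y}) :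
    MemTightClosure (R ⧸ 𝔭) p
      (Ideal.span {Ideal.Quotient.mk 𝔭 x, Ideal.Quotient.mk 𝔭 y})
      (Ideal.Quotient.mk 𝔭 u) := by
  haveI := hchar0
  haveI := hresp
  obtain ⟨V, iV, iD, iC, φ, ι, hc, hφ, hι, hιm⟩ := exists_cohen p hp R
  haveI := hc
  have h1 : ¬ (p : V) ∣ 1 := by
    rw [← hιm, map_one]
    exact (Ideal.ne_top_iff_one _).mp (IsLocalRing.maximalIdeal.isMaximal R).ne_top
  have hu1 : ∀ v : V, ¬ (p : V) ∣ v → ∃ v', (p : V) ∣ v * v' - 1 := by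
    intro v hv
    rw [← hιm, IsLocalRing.mem_maximalIdeal, mem_nonunits_iff, not_not] at hv
    obtain ⟨w, hw⟩ := hv.exists_right_inv
    obtain ⟨v', hv'⟩ := hι w
    refine ⟨v', ?_⟩
    rw [← hιm, map_sub, map_mul, map_one, ← hw]
    have e : ι v * ι v' - ι v * w = - (ι v * (w - ι v')) := by ring
    rw [e]
    exact neg_mem (Ideal.mul_mem_left _ _ hv')
  obtain ⟨hprime, hunit, iN, iL, hcic⟩ := cohen_props p hp h1 hu1
  have hm : Ideal.span {(p : R), x, y} ≤ IsLocalRing.maximalIdeal R := hsop ▸ Ideal.le_radical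
  obtain ⟨ψ₁, h1C, h1X⟩ := exists_psEval (IsLocalRing.maximalIdeal R) ι x
    (hm (Ideal.subset_span (by simp)))
  obtain ⟨ψ₂, h2C, h2X⟩ := exists_psEval (IsLocalRing.maximalIdeal R) ψ₁ y
    (hm (Ideal.subset_span (by simp)))
  have hfin := finite_of_cohen p ι hι x y hsop ψ₁ h1C h1X ψ₂ h2C h2X
  have hinj := inj_of_finite ψ₂ hfin (dim_base_le p hprime hunit) hdim
  obtain ⟨iI, iC2, hprime2, ⟨φ₂, hφ₂, hφx, hφy⟩, hx, hpxy, hxpy, hfr⟩ :=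
    base_props p hp hprime hcic φ hφ
  obtain ⟨a, b, hab⟩ := Ideal.mem_span_pair.mp hu
  letI : Algebra (PowerSeries (PowerSeries V)) R := ψ₂.toAlgebra
  haveI : Module.Finite (PowerSeries (PowerSeries V)) R := hfin
  have ex : algebraMap (PowerSeries (PowerSeries V)) R (PowerSeries.C PowerSeries.X) = x := by
    show ψ₂ _ = x
    rw [h2C, h1X]
  have ey : algebraMap (PowerSeries (PowerSeries V)) R PowerSeries.X = y := h2X
  obtain ⟨c, hc0, hcm⟩ := tight_of_base hp hprime2 φ₂ hφ₂ (PowerSeries.C PowerSeries.X)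
    PowerSeries.X hφx hφy hx hpxy hxpy hfr hinj 𝔭 h𝔭 u a b n (by
      rw [ex, ey, ← hab]; ring)
  rw [ex, ey] at hcm
  haveI : 𝔭.IsPrime := h𝔭.1.1
  refine ⟨c, ?_, fun e => ?_⟩
  · intro P hP
    rw [IsDomain.minimalPrimes_eq_singleton_bot, Set.mem_singleton_iff] at hP
    rw [hP, Ideal.mem_bot]
    exact hc0
  · refine Ideal.span_mono ?_ (hcm e)
    rintro _ (rfl | rfl)
    · exact ⟨_, Ideal.subset_span (by simp), rfl⟩
    · exact ⟨_, Ideal.subset_span (by simp), rfl⟩
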